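/- arXiv:cs/0102007 — 4 statements merged into one kernel-verified Lean document; each statement's English description precedes it below -/
import Mathlib

section
/- Let G be a finite simple connected planar graph with a cut vertex w, let G₁,…,G_k be the augmented components induced by w, and let ℳ be a sequence of families of vertex subsets of G in which every set induces a connected subgraph of G. Let 𝒞_h be a family in ℳ, let U_{h,1},…,U_{h,t_h} be the sets in 𝒞_h containing w (possibly t_h = 0), and assume that 𝒞_h − {U_{h,1},…,U_{h,t_h}} is G_i-local for some i ∈ {1,…,k}. Then G satisfies ℳ if and only if G satisfies the sequence obtained from ℳ by replacing 𝒞_h with (𝒞_h − {U_{h,1},…,U_{h,t_h}}) ∪ {U_{h,1} ∩ V(G_i), …, U_{h,t_h} ∩ V(G_i)}. -/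
open Set Topology

/-- A plane embedding of a simple graph `G`: an injective placement of the vertices in the
plane together with, for each edge, an arc (the image of an injective continuous path) whose
endpoints are the images of the endpoints of the edge, such that two distinct arcs intersect
only in images of common endpoints and an arc meets the image of a vertex only if that vertex
is an endpoint of the corresponding edge. -/
structure PlaneEmbedding {V : Type*} (G : SimpleGraph V) where
  vmap : V → ℝ × ℝ
  vmap_inj : Function.Injective vmap
  arc : G.edgeSet → Set (ℝ × ℝ)
  arc_path : ∀ e : G.edgeSet, ∃ f : unitInterval → ℝ × ℝ,
    Continuous f ∧ Function.Injective f ∧ Set.range f = arc e ∧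
    ∃ u v : V, (e : Sym2 V) = s(u, v) ∧ f 0 = vmap u ∧ f 1 = vmap v
  arc_inter : ∀ e e' : G.edgeSet, e ≠ e' →
    arc e ∩ arc e' ⊆ vmap '' {x : V | x ∈ (e : Sym2 V) ∧ x ∈ (e' : Sym2 V)}
  vmap_mem_arc : ∀ (e : G.edgeSet) (x : V), vmap x ∈ arc e → x ∈ (e : Sym2 V)

namespace PlaneEmbedding

variable {V : Type*} {G : SimpleGraph V}

/-- The union of all arcs of the embedding. -/
def drawing (Φ : PlaneEmbedding G) : Set (ℝ × ℝ) :=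
  ⋃ e : G.edgeSet, Φ.arc e

/-- The faces of the embedding: connected components of the complement of the drawing. -/
def IsFace (Φ : PlaneEmbedding G) (F : Set (ℝ × ℝ)) : Prop :=
  ∃ p ∈ Φ.drawingᶜ, F = connectedComponentIn Φ.drawingᶜ p

/-- The vertex `v` lies on the boundary of the face `F`. -/
def OnFace (Φ : PlaneEmbedding G) (F : Set (ℝ × ℝ)) (v : V) : Prop :=
  Φ.vmap v ∈ frontier F

/-- The embedding satisfies a family `C` of vertex subsets: some face has on its boundary
at least one vertex from each set in `C`. -/
def SatisfiesFam (Φ : PlaneEmbedding G) (C : Set (Set V)) : Prop :=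
  ∃ F : Set (ℝ × ℝ), Φ.IsFace F ∧ ∀ U ∈ C, ∃ v ∈ U, Φ.OnFace F v

end PlaneEmbedding

/-- A graph is planar if it has a plane embedding. -/
def Planar {V : Type*} (G : SimpleGraph V) : Prop :=
  Nonempty (PlaneEmbedding G)
/-- A cut vertex: a vertex whose removal increases the number of connected components. -/
def IsCutVertex {V : Type*} (G : SimpleGraph V) (w : V) : Prop :=
  Nat.card G.ConnectedComponent < Nat.card ((G.induce {v : V | v ≠ w}).ConnectedComponent)

/-- A graph is biconnected if it is connected, has at least two vertices and no cut vertex. -/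
def Biconnected {V : Type*} (G : SimpleGraph V) : Prop :=
  G.Connected ∧ 2 ≤ Nat.card V ∧ ∀ w : V, ¬ IsCutVertex G w

/-- A graph is triconnected if it is biconnected, has at least three vertices, and the removal
of any two vertices cannot disconnect it. -/
def Triconnected {V : Type*} (G : SimpleGraph V) : Prop :=
  Biconnected G ∧ 3 ≤ Nat.card V ∧
    ∀ u v : V, u ≠ v → ((G.induce {x : V | x ≠ u ∧ x ≠ v}).Connected)
/-- `G` satisfies a (finitely indexed) sequence of families of vertex subsets: some plane
embedding of `G` satisfies every family of the sequence. -/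
def SatSeq {V : Type*} (G : SimpleGraph V) {q : ℕ} (M : Fin q → Set (Set V)) : Prop :=
  ∃ Φ : PlaneEmbedding G, ∀ j : Fin q, Φ.SatisfiesFam (M j)

/-- `G` satisfies a collection of families of vertex subsets: some plane embedding of `G`
satisfies every family in the collection. -/
def SatColl {V : Type*} (G : SimpleGraph V) (Ms : Set (Set (Set V))) : Prop :=
  ∃ Φ : PlaneEmbedding G, ∀ C ∈ Ms, Φ.SatisfiesFam C

/-- Transport a family of vertex subsets of `G` (all contained in `s`) to a family of vertex
subsets of the induced subgraph on `s`. -/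
def resFam {V : Type*} (s : Set V) (C : Set (Set V)) : Set (Set ↥s) :=
  (fun U => Subtype.val ⁻¹' U) '' C

section PlaneTopology

/-- A preconnected set meeting an open set but not its frontier lies inside it. -/
theorem precon_sub {X : Type*} [TopologicalSpace X] {C F : Set X} (hC : IsPreconnected C)
    (hF : IsOpen F) (hne : (C ∩ F).Nonempty) (hd : ∀ x ∈ C, x ∉ frontier F) : C ⊆ F := by
  have h1 : C ⊆ F ∪ (closure F)ᶜ := by
    intro x hx
    by_cases hxF : x ∈ F
    · exact Or.inl hxF
    · refine Or.inr fun hc => hd x hx ?_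
      rw [hF.frontier_eq]
      exact ⟨hc, hxF⟩
  have h2 : C ∩ (F ∩ (closure F)ᶜ) = ∅ := by
    ext x
    simp only [mem_inter_iff, mem_compl_iff, mem_empty_iff_false, iff_false]
    rintro ⟨-, h1, h2⟩
    exact h2 (subset_closure h1)
  rcases isPreconnected_iff_subset_of_disjoint.1 hC F (closure F)ᶜ hF
    isClosed_closure.isOpen_compl h1 h2 with h | h
  · exact h
  · obtain ⟨x, hx, hxF⟩ := hne
    exact absurd (subset_closure hxF) (h hx)

theorem comp_closed {X : Type*} [TopologicalSpace X] [LocallyConnectedSpace X] {S : Set X}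
    (hS : IsOpen S) {p y : X} (hy : y ∈ S) (hc : y ∈ closure (connectedComponentIn S p)) :
    y ∈ connectedComponentIn S p := by
  obtain ⟨z, hz1, hz2⟩ := mem_closure_iff.1 hc (connectedComponentIn S y)
    hS.connectedComponentIn (mem_connectedComponentIn hy)
  rw [connectedComponentIn_eq hz2, ← connectedComponentIn_eq hz1]
  exact mem_connectedComponentIn hy

theorem comp_frontier {X : Type*} [TopologicalSpace X] [LocallyConnectedSpace X] {S : Set X}
    (hS : IsOpen S) {p y : X} (hy : y ∈ frontier (connectedComponentIn S p)) : y ∉ S := by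
  intro h
  rw [hS.connectedComponentIn.frontier_eq] at hy
  exact hy.2 (comp_closed hS h hy.1)

theorem sc_univ {E : Type*} [NormedAddCommGroup E] [NormedSpace ℝ E] :
    IsSimplyConnected (univ : Set E) := by
  have : ContractibleSpace (univ : Set E) :=
    (convex_univ (𝕜 := ℝ)).contractibleSpace ⟨0, trivial⟩
  exact inferInstanceAs (SimplyConnectedSpace (univ : Set E))

/-- `g` has a continuous logarithm on `K`. -/
def HasLog (K : Set ℂ) (g : ℂ → ℂ) : Prop :=
  ∃ φ : ℂ → ℂ, ContinuousOn φ K ∧ ∀ z ∈ K, Complex.exp (φ z) = g z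

theorem exp_const {X : Type*} [TopologicalSpace X] {S : Set X} (hS : IsPreconnected S)
    {u : X → ℂ} (hu : ContinuousOn u S) {c : ℂ} (h : ∀ x ∈ S, Complex.exp (u x) = c)
    {x y : X} (hx : x ∈ S) (hy : y ∈ S) : u x = u y :=
  Complex.isCoveringMap_exp.constOn_of_comp hS hu
    (fun a ha b hb => Subtype.ext ((h a ha).trans (h b hb).symm)) hx hy

theorem no_circle_log {p : ℂ} {R : ℝ} (hR : 0 < R) {θ : ℂ → ℂ} 
    (hθ : ContinuousOn θ (Metric.sphere p R))
    (h : ∀ z ∈ Metric.sphere p R, Complex.exp (θ z) = z - p) : False := by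
  let c : ℝ → ℂ := fun t => p + R * Complex.exp (t * Complex.I)
  have hc : ∀ t, c t ∈ Metric.sphere p R := by
    intro t
    simp [c, Complex.norm_exp_ofReal_mul_I, abs_of_pos hR]
  have hcc : Continuous c := by fun_prop
  have hcont : Continuous (fun t => θ (c t) - t * Complex.I) :=
    (hθ.comp_continuous hcc hc).sub (by fun_prop)
  have := exp_const (isPreconnected_univ) (hcont.continuousOn (s := univ)) (c := (R : ℂ))
    (fun t _ => by
      rw [Complex.exp_sub, h _ (hc t)]
      simp [c, Complex.exp_ne_zero]) (mem_univ (0 : ℝ)) (mem_univ (2 * Real.pi))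
  have h2 : c (2 * Real.pi) = c 0 := by
    simp [c, Complex.exp_two_pi_mul_I]
  simp only [h2] at this
  have h3 := congrArg Complex.im this
  simp at h3
  linarith [Real.pi_pos]

theorem bounded_core {K : Set ℂ} (hK : IsClosed K) {p q : ℂ} (hp : p ∉ K) (hq : q ∉ K)
    (hb : Bornology.IsBounded (connectedComponentIn Kᶜ p))
    (hl : HasLog K (fun z => (z - p) / (z - q))) : q ∈ connectedComponentIn Kᶜ p := by
  classical
  by_contra hqP
  set P := connectedComponentIn Kᶜ p with hPdef
  have hPo : IsOpen P := hK.isOpen_compl.connectedComponentIn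
  have hpP : p ∈ P := mem_connectedComponentIn hp
  have hqc : q ∉ closure P := fun h => hqP (comp_closed hK.isOpen_compl hq h)
  obtain ⟨φ, hφ, hφe⟩ := hl
  obtain ⟨Ψ, hΨ⟩ := ContinuousMap.exists_restrict_eq hK
    ⟨K.domRestrict φ, continuousOn_iff_continuous_domRestrict.mp hφ⟩
  have hΨK : ∀ z ∈ K, Complex.exp (Ψ z) = (z - p) / (z - q) := by
    intro z hz
    refine Eq.trans ?_ (hφe z hz)
    have := congrArg (fun f => f ⟨z, hz⟩) hΨ
    simp at this
    rw [this]
  let G : ℂ → ℂ := P.piecewise (fun z => 1 / (z - q)) (fun z => Complex.exp (Ψ z) / (z - p))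
  have hG : Continuous G := by
    apply continuous_piecewise
    · intro a ha
      have haK : a ∈ K := by
        by_contra h
        exact comp_frontier hK.isOpen_compl ha h
      have : a - p ≠ 0 := sub_ne_zero.2 (by rintro rfl; exact hp haK)
      have : a - q ≠ 0 := sub_ne_zero.2 (by rintro rfl; exact hq haK)
      simp only [hΨK a haK]
      field_simp
    · apply ContinuousOn.div (by fun_prop) (by fun_prop)
      intro z hz
      exact sub_ne_zero.2 (by rintro rfl; exact hqc hz)
    · rw [hPo.isClosed_compl.closure_eq]
      apply ContinuousOn.div (by fun_prop) (by fun_prop)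
      intro z hz
      exact sub_ne_zero.2 (by rintro rfl; exact hz hpP)
  have hG0 : ∀ z, G z ≠ 0 := by
    intro z
    by_cases hz : z ∈ P
    · simp only [G, piecewise_eq_of_mem _ _ _ hz]
      exact one_div_ne_zero (sub_ne_zero.2 (by rintro rfl; exact hqP hz))
    · simp only [G, piecewise_eq_of_notMem _ _ _ hz]
      exact div_ne_zero (Complex.exp_ne_zero _) (sub_ne_zero.2 (by rintro rfl; exact hz hpP))
  obtain ⟨ψ, hψ, hψe⟩ := Complex.exists_continuousOn_eqOn_exp_comp (U := (univ : Set ℂ))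
    sc_univ isOpen_univ hG.continuousOn
    (by rintro ⟨z, -, hz⟩; exact hG0 z hz)
  obtain ⟨R, hR, hPR⟩ := hb.subset_ball_lt 0 p
  refine no_circle_log (p := p) hR (θ := fun z => Ψ z - ψ z) ?_ ?_
  · exact (Ψ.continuous.continuousOn).sub (hψ.mono (subset_univ _))
  · intro z hz
    have hzP : z ∉ P := fun h => by
      have h1 := hPR h
      rw [Metric.mem_ball] at h1
      rw [Metric.mem_sphere] at hz
      linarith
    have h1 := hψe (mem_univ z)
    simp only [Function.comp, G, piecewise_eq_of_notMem _ _ _ hzP] at h1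
    rw [Complex.exp_sub, h1]
    have : z - p ≠ 0 := sub_ne_zero.2 (by rintro rfl; exact hzP hpP)
    have := Complex.exp_ne_zero (Ψ z)
    field_simp

theorem HasLog.inv {K : Set ℂ} {f g : ℂ → ℂ} (h : HasLog K f) (hg : ∀ z ∈ K, g z = (f z)⁻¹) :
    HasLog K g := by
  obtain ⟨φ, h1, h2⟩ := h
  exact ⟨fun z => - φ z, h1.neg, fun z hz => by rw [Complex.exp_neg, h2 z hz, hg z hz]⟩

theorem HasLog.mul {K : Set ℂ} {f g k : ℂ → ℂ} (hf : HasLog K f) (hg : HasLog K g)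
    (hk : ∀ z ∈ K, k z = f z * g z) : HasLog K k := by
  obtain ⟨φ, h1, h2⟩ := hf
  obtain ⟨ψ, h3, h4⟩ := hg
  exact ⟨fun z => φ z + ψ z, h1.add h3, fun z hz => by
    rw [Complex.exp_add, h2 z hz, h4 z hz, hk z hz]⟩

theorem unbounded_same {K : Set ℂ} (hK : IsCompact K) {p q : ℂ} 
    (hp : ¬ Bornology.IsBounded (connectedComponentIn Kᶜ p))
    (hq : ¬ Bornology.IsBounded (connectedComponentIn Kᶜ q)) :
    q ∈ connectedComponentIn Kᶜ p := by
  obtain ⟨R, hR, hKR⟩ := hK.isBounded.subset_ball_lt 0 0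
  have hrank : 1 < Module.rank ℝ ℂ := by simp [Complex.rank_real_complex]
  have hE : IsPreconnected (Metric.ball (0 : ℂ) R)ᶜ := by
    refine isPreconnected_of_forall (R : ℂ) fun y hy => ?_
    have hy : R ≤ ‖y‖ := by simpa using hy
    have hy0 : 0 < ‖y‖ := hR.trans_le hy
    refine ⟨Metric.sphere 0 R ∪ segment ℝ ((R / ‖y‖ : ℝ) • y) y, ?_, Or.inl (by simp [abs_of_pos hR]),
      Or.inr (right_mem_segment _ _ _), ?_⟩
    · rintro z (hz | hz)
      · simp at hz ⊢
        exact hz.ge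
      · rw [segment_eq_image] at hz
        obtain ⟨t, ⟨ht0, ht1⟩, rfl⟩ := hz
        have : (1 - t) • (R / ‖y‖ : ℝ) • y + t • y = ((1 - t) * (R / ‖y‖) + t) • y := by module
        simp only [this]
        simp only [mem_compl_iff, Metric.mem_ball, dist_zero_right, norm_smul, not_lt]
        have h3 : 0 ≤ (1 - t) * (R / ‖y‖) + t := by
          have : 0 ≤ 1 - t := by linarith
          positivity
        rw [Real.norm_of_nonneg h3, add_mul, mul_assoc, div_mul_cancel₀ _ hy0.ne']
        nlinarith
    · refine IsPreconnected.union ((R / ‖y‖ : ℝ) • y) ?_ (left_mem_segment _ _ _)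
        (isPreconnected_sphere hrank _ _) (convex_segment _ _).isPreconnected
      simp [abs_of_pos hR, hy0.ne']
  have hEK : (Metric.ball (0 : ℂ) R)ᶜ ⊆ Kᶜ := compl_subset_compl.2 hKR
  have key : ∀ x, ¬ Bornology.IsBounded (connectedComponentIn Kᶜ x) →
      (R : ℂ) ∈ connectedComponentIn Kᶜ x := by
    intro x hx
    have : ¬ connectedComponentIn Kᶜ x ⊆ Metric.ball 0 R := fun h =>
      hx (Metric.isBounded_ball.subset h)
    obtain ⟨y, hy, hyB⟩ := not_subset.1 this
    rw [connectedComponentIn_eq hy]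
    exact hE.subset_connectedComponentIn hyB hEK (by simp [abs_of_pos hR])
  rw [connectedComponentIn_eq (key p hp), ← connectedComponentIn_eq (key q hq)]
  by_contra h
  apply hq
  rw [connectedComponentIn_eq_empty]
  · exact Bornology.isBounded_empty
  · exact fun h' => h (mem_connectedComponentIn h')

theorem log_imp_same {K : Set ℂ} (hK : IsCompact K) {p q : ℂ} (hp : p ∉ K) (hq : q ∉ K)
    (hl : HasLog K (fun z => (z - p) / (z - q))) : q ∈ connectedComponentIn Kᶜ p := by
  by_cases h1 : Bornology.IsBounded (connectedComponentIn Kᶜ p)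
  · exact bounded_core hK.isClosed hp hq h1 hl
  by_cases h2 : Bornology.IsBounded (connectedComponentIn Kᶜ q)
  · have := bounded_core hK.isClosed hq hp h2 (hl.inv (by intro z _; simp))
    rw [← connectedComponentIn_eq this]
    exact mem_connectedComponentIn hq
  · exact unbounded_same hK h1 h2

theorem same_imp_log {K : Set ℂ} (hK : IsCompact K) {p q : ℂ}
    (h : q ∈ connectedComponentIn Kᶜ p) : HasLog K (fun z => (z - p) / (z - q)) := by
  have hpK : p ∈ Kᶜ := by
    by_contra h'
    rw [connectedComponentIn_eq_empty h'] at h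
    exact h
  have hne : ∀ x ∈ connectedComponentIn Kᶜ p, ∀ z ∈ K, z - x ≠ 0 := by
    intro x hx z hz
    exact sub_ne_zero.2 (by rintro rfl; exact connectedComponentIn_subset _ _ hx hz)
  refine IsPreconnected.induction₂ (isPreconnected_connectedComponentIn (x := p) (F := Kᶜ))
    (fun p q => HasLog K (fun z => (z - p) / (z - q))) ?_ ?_ ?_ (mem_connectedComponentIn hpK) h
  · intro x hx
    have hxK := connectedComponentIn_subset _ _ hx
    obtain ⟨ε, hε, hb⟩ := Metric.isOpen_iff.1 hK.isClosed.isOpen_compl x hxK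
    filter_upwards [self_mem_nhdsWithin,
      mem_nhdsWithin_of_mem_nhds (Metric.ball_mem_nhds x (half_pos hε))] with y hyC hy
    rw [Metric.mem_ball, dist_eq_norm] at hy
    have hsl : ∀ z ∈ K, (z - x) / (z - y) ∈ Complex.slitPlane := by
      intro z hz
      have h1 : ε ≤ ‖z - x‖ := by
        by_contra h'
        exact hb (by simpa [dist_eq_norm] using h') hz
      have h2 : ‖z - x‖ ≤ ‖z - y‖ + ‖y - x‖ := by
        simpa using norm_add_le (z - y) (y - x)
      have h3 := hne y hyC z hz
      have h4 : (z - x) / (z - y) = 1 + (y - x) / (z - y) := by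
        field_simp
        ring
      rw [h4]
      apply Complex.mem_slitPlane_of_norm_lt_one
      rw [norm_div, div_lt_one (norm_pos_iff.2 h3)]
      linarith
    refine ⟨fun z => Complex.log ((z - x) / (z - y)), ?_, ?_⟩
    · apply ContinuousOn.clog
      · exact ContinuousOn.div (by fun_prop) (by fun_prop) (hne y hyC)
      · exact hsl
    · intro z hz
      exact Complex.exp_log (Complex.slitPlane_ne_zero (hsl z hz))
  · intro x y z hx hy hz h1 h2
    refine h1.mul h2 fun t ht => ?_
    have := hne y hy t ht
    have := hne z hz t ht
    field_simp
  · intro x y hx hy h1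
    exact h1.inv fun t _ => by simp

/-- Janiszewski's theorem in the complex plane. -/
theorem janiszewskiC {A B : Set ℂ} (hA : IsCompact A) (hB : IsCompact B)
    (hAB : IsPreconnected (A ∩ B)) {p q : ℂ} (h1 : q ∈ connectedComponentIn Aᶜ p)
    (h2 : q ∈ connectedComponentIn Bᶜ p) : q ∈ connectedComponentIn (A ∪ B)ᶜ p := by
  classical
  have hpp : ∀ {S : Set ℂ}, q ∈ connectedComponentIn Sᶜ p → p ∉ S := by
    intro S h h'
    rw [connectedComponentIn_eq_empty (by simpa using h')] at h
    exact h
  have hpA := hpp h1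
  have hpB := hpp h2
  have hqA := connectedComponentIn_subset _ _ h1
  have hqB := connectedComponentIn_subset _ _ h2
  apply log_imp_same (hA.union hB) (by simp [hpA, hpB]) (by rintro (h | h); exacts [hqA h, hqB h])
  obtain ⟨φ, hφ, hφe⟩ := same_imp_log hA h1
  obtain ⟨ψ, hψ, hψe⟩ := same_imp_log hB h2
  obtain ⟨c, hc1, hc2⟩ : ∃ c : ℂ, Complex.exp c = 1 ∧ ∀ z ∈ A ∩ B, φ z = ψ z + c := by
    rcases (A ∩ B).eq_empty_or_nonempty with h | ⟨x, hx⟩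
    · exact ⟨0, by simp, by simp [h]⟩
    · have he : ∀ z ∈ A ∩ B, Complex.exp (φ z - ψ z) = 1 := by
        intro z hz
        rw [Complex.exp_sub, hφe z hz.1, ← hψe z hz.2, div_self (Complex.exp_ne_zero _)]
      refine ⟨φ x - ψ x, he x hx, fun z hz => ?_⟩
      have := exp_const (u := fun z => φ z - ψ z) hAB
        ((hφ.mono inter_subset_left).sub (hψ.mono inter_subset_right)) he hz hx
      rw [← this]
      ring
  let χ : ℂ → ℂ := A.piecewise φ (fun z => ψ z + c)
  have hχA : EqOn χ φ A := fun z hz => piecewise_eq_of_mem _ _ _ hz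
  have hχB : EqOn χ (fun z => ψ z + c) B := by
    intro z hz
    by_cases hzA : z ∈ A
    · rw [hχA hzA]
      exact hc2 z ⟨hzA, hz⟩
    · exact piecewise_eq_of_notMem _ _ _ hzA
  refine ⟨χ, ContinuousOn.union_of_isClosed (hφ.congr hχA)
    ((hψ.add continuousOn_const).congr hχB) hA.isClosed hB.isClosed, ?_⟩
  rintro z (hz | hz)
  · rw [hχA hz, hφe z hz]
  · rw [hχB hz, Complex.exp_add, hc1, mul_one, hψe z hz]

/-- An arc does not separate the plane. -/
theorem arc_nonsepC {g : ℝ → ℂ} (hg : Continuous g) {a b : ℝ} (hab : a ≤ b)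
    (hinj : InjOn g (Icc a b)) {p q : ℂ} (hp : p ∉ g '' Icc a b) (hq : q ∉ g '' Icc a b) :
    q ∈ connectedComponentIn (g '' Icc a b)ᶜ p := by
  apply log_imp_same (isCompact_Icc.image hg) hp hq
  let e : C(Icc a b, ℂ) := ⟨(Icc a b).domRestrict g, hg.comp continuous_subtype_val⟩
  have he : IsClosedEmbedding e := 
    e.continuous.isClosedEmbedding (injOn_iff_injective.1 hinj)
  have hne : ∀ x ∉ g '' Icc a b, ∀ t : Icc a b, g t - x ≠ 0 := by
    intro x hx t
    exact sub_ne_zero.2 (by rintro rfl; exact hx ⟨t, t.2, rfl⟩)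
  let k : ℝ → ℂ := fun t => (g (projIcc a b hab t) - p) / (g (projIcc a b hab t) - q)
  have hpr : Continuous (fun t => (projIcc a b hab t : ℝ)) :=
    continuous_subtype_val.comp continuous_projIcc
  have hk : Continuous k := by
    apply Continuous.div
    · exact (hg.comp hpr).sub continuous_const
    · exact (hg.comp hpr).sub continuous_const
    · intro t
      exact hne q hq _
  obtain ⟨θ, hθ, hθe⟩ := Complex.exists_continuousOn_eqOn_exp_comp (U := (univ : Set ℝ))
    sc_univ isOpen_univ hk.continuousOn
    (by rintro ⟨z, -, hz⟩; exact div_ne_zero (hne p hp _) (hne q hq _) hz)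
  rw [continuousOn_univ] at hθ
  obtain ⟨φ, hφ⟩ := ContinuousMap.exists_extension' (e := e) he
    (⟨fun t => θ t, hθ.comp continuous_subtype_val⟩ : C(Icc a b, ℂ))
  refine ⟨φ, φ.continuous.continuousOn, ?_⟩
  rintro z ⟨t, ht, rfl⟩
  have h1 := congrFun hφ ⟨t, ht⟩
  have h2 := hθe (mem_univ t)
  have h1 : φ (g t) = θ t := h1
  rw [h1]
  simp only [Function.comp, k, projIcc_of_mem hab ht] at h2
  exact h2

/-- The real plane is the complex plane. -/
noncomputable def planeH : (ℝ × ℝ) ≃ₜ ℂ := Complex.equivRealProdCLM.symm.toHomeomorph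

theorem planeH_comp {A : Set (ℝ × ℝ)} {p q : ℝ × ℝ} (hp : p ∉ A) :
    q ∈ connectedComponentIn Aᶜ p ↔ planeH q ∈ connectedComponentIn (planeH '' A)ᶜ (planeH p) := by
  have := planeH.image_connectedComponentIn (s := Aᶜ) (x := p) hp
  rw [image_compl_eq planeH.bijective] at this
  rw [← this, planeH.injective.mem_set_image]

theorem janiszewski {A B : Set (ℝ × ℝ)} (hA : IsCompact A) (hB : IsCompact B)
    (hAB : IsPreconnected (A ∩ B)) {p q : ℝ × ℝ} (hpA : p ∉ A) (hpB : p ∉ B)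
    (h1 : q ∈ connectedComponentIn Aᶜ p)
    (h2 : q ∈ connectedComponentIn Bᶜ p) : q ∈ connectedComponentIn (A ∪ B)ᶜ p := by
  rw [planeH_comp (by simp [hpA, hpB]), image_union]
  rw [planeH_comp hpA] at h1
  rw [planeH_comp hpB] at h2
  refine janiszewskiC (hA.image planeH.continuous) (hB.image planeH.continuous) ?_ h1 h2
  rw [← image_inter planeH.injective]
  exact hAB.image _ planeH.continuous.continuousOn

theorem arc_nonsep {g : ℝ → ℝ × ℝ} (hg : Continuous g) {a b : ℝ} (hab : a ≤ b)
    (hinj : InjOn g (Icc a b)) {p q : ℝ × ℝ} (hp : p ∉ g '' Icc a b) (hq : q ∉ g '' Icc a b) :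
    q ∈ connectedComponentIn (g '' Icc a b)ᶜ p := by
  rw [planeH_comp hp, ← image_comp]
  refine arc_nonsepC (planeH.continuous.comp hg) hab (planeH.injective.comp_injOn hinj) ?_ ?_
  · rwa [image_comp, planeH.injective.mem_set_image]
  · rwa [image_comp, planeH.injective.mem_set_image]

end PlaneTopology

section PlaneArcs

theorem comp_shrink {K K' : Set (ℝ × ℝ)} (hK : IsClosed K) {p : ℝ × ℝ}
    (hp : p ∉ K) (hKK : K' ⊆ K) (hfr : frontier (connectedComponentIn Kᶜ p) ⊆ K') :
    connectedComponentIn K'ᶜ p ⊆ connectedComponentIn Kᶜ p := by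
  refine precon_sub isPreconnected_connectedComponentIn hK.isOpen_compl.connectedComponentIn
    ⟨p, mem_connectedComponentIn fun h => hp (hKK h), mem_connectedComponentIn hp⟩ ?_
  intro x hx hxf
  exact connectedComponentIn_subset _ _ hx (hfr hxf)

theorem frontier_sub {K : Set (ℝ × ℝ)} (hK : IsClosed K) {p : ℝ × ℝ} :
    frontier (connectedComponentIn Kᶜ p) ⊆ K := by
  intro x hx
  by_contra h
  exact comp_frontier hK.isOpen_compl hx h

/-- If two continua meet in one point and a complementary component of the union touches both, 
then it touches the common point. -/
theorem touch_common {X Y : Set (ℝ × ℝ)} (hX : IsCompact X) (hY : IsCompact Y) {w : ℝ × ℝ}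
    (hXY : X ∩ Y = {w}) (hXc : IsPreconnected X) (hYc : IsPreconnected Y) {p x y : ℝ × ℝ}
    (hp : p ∉ X ∪ Y)
    (hx : x ∈ X) (hxF : x ∈ frontier (connectedComponentIn (X ∪ Y)ᶜ p))
    (hy : y ∈ Y) (hyF : y ∈ frontier (connectedComponentIn (X ∪ Y)ᶜ p)) :
    w ∈ frontier (connectedComponentIn (X ∪ Y)ᶜ p) := by
  by_contra hw
  have hwXY : w ∈ X ∩ Y := by rw [hXY]; rfl
  have hK : IsClosed (X ∪ Y) := (hX.union hY).isClosed
  set F := connectedComponentIn (X ∪ Y)ᶜ p with hF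
  have hFo : IsOpen F := hK.isOpen_compl.connectedComponentIn
  have hwF : w ∉ F := fun h => connectedComponentIn_subset _ _ h (Or.inl hwXY.1)
  have hwc : w ∉ closure F := fun h => hw (by rw [hFo.frontier_eq]; exact ⟨h, hwF⟩)
  set B := (closure F)ᶜ with hB
  -- the part of the frontier away from `w`
  obtain ⟨r, hr, hrB⟩ := Metric.isOpen_iff.1 (isClosed_closure (s := F)).isOpen_compl w hwc
  have hX' : IsCompact (X \ Metric.ball w r) := hX.diff Metric.isOpen_ball
  have hY' : IsCompact (Y \ Metric.ball w r) := hY.diff Metric.isOpen_ball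
  have hwb : w ∈ Metric.ball w r := Metric.mem_ball_self hr
  have hfr : frontier F ⊆ (X \ Metric.ball w r) ∪ (Y \ Metric.ball w r) := by
    intro z hz
    have h1 : z ∉ Metric.ball w r := fun h => hrB h (frontier_subset_closure hz)
    rcases frontier_sub hK hz with h | h
    · exact Or.inl ⟨h, h1⟩
    · exact Or.inr ⟨h, h1⟩
  have hsub : (X \ Metric.ball w r) ∪ (Y \ Metric.ball w r) ⊆ X ∪ Y :=
    union_subset_union sdiff_subset sdiff_subset
  have key : ∀ {X Y : Set (ℝ × ℝ)}, X ∩ Y = {w} → IsCompact X → IsPreconnected Y → w ∈ Y →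
      F ⊆ Xᶜ → p ∉ X → ∀ y ∈ Y, y ∈ frontier F →
      w ∈ connectedComponentIn (X \ Metric.ball w r)ᶜ p := by
    intro X Y hXY hX hYc hwY hFX hpX y hy hyF
    have hXo : IsOpen (X \ Metric.ball w r)ᶜ :=
      (hX.diff Metric.isOpen_ball).isClosed.isOpen_compl
    have hYs : Y ⊆ (X \ Metric.ball w r)ᶜ := by
      rintro z hz ⟨h1, h2⟩
      have : z ∈ X ∩ Y := ⟨h1, hz⟩
      rw [hXY] at this
      rw [mem_singleton_iff] at this
      subst this
      exact h2 hwb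
    have hFC : F ⊆ connectedComponentIn (X \ Metric.ball w r)ᶜ p :=
      isPreconnected_connectedComponentIn.subset_connectedComponentIn
        (mem_connectedComponentIn hp) (fun z hz h => hFX hz h.1)
    have hyC := comp_closed hXo (hYs hy) (closure_mono hFC (frontier_subset_closure hyF))
    rw [connectedComponentIn_eq hyC]
    exact hYc.subset_connectedComponentIn hy hYs hwY
  have hFs : F ⊆ (X ∪ Y)ᶜ := connectedComponentIn_subset _ _
  have h1 := key hXY hX hYc hwXY.2 (fun z hz h => hFs hz (Or.inl h)) (fun h => hp (Or.inl h))
    y hy hyF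
  have h2 := key (by rw [inter_comm]; exact hXY) hY hXc hwXY.1 (fun z hz h => hFs hz (Or.inr h))
    (fun h => hp (Or.inr h)) x hx hxF
  refine hwF (comp_shrink hK hp hsub hfr (janiszewski hX' hY' ?_ (fun h => hp (Or.inl h.1))
    (fun h => hp (Or.inr h.1)) h1 h2))
  apply Set.Subsingleton.isPreconnected
  intro a ha b hb
  have h3 : a ∈ X ∩ Y := ⟨ha.1.1, ha.2.1⟩
  have h4 : b ∈ X ∩ Y := ⟨hb.1.1, hb.2.1⟩
  rw [hXY] at h3 h4
  rw [h3, h4]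

/-- An arc has empty interior. -/
theorem arc_interior {g : ℝ → ℝ × ℝ} (hg : Continuous g) {a b : ℝ}
    (hinj : InjOn g (Icc a b)) : interior (g '' Icc a b) = ∅ := by
  by_contra hne
  obtain ⟨p, hp⟩ := nonempty_iff_ne_empty.2 hne
  obtain ⟨r, hr, hrB⟩ := Metric.isOpen_iff.1 isOpen_interior p hp
  have hB : Metric.ball p r ⊆ g '' Icc a b := hrB.trans interior_subset
  let e : Icc a b → ℝ × ℝ := (Icc a b).domRestrict g
  have he : IsClosedEmbedding e :=
    (hg.comp continuous_subtype_val).isClosedEmbedding (injOn_iff_injective.1 hinj)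
  -- intermediate values
  have iv : ∀ C ⊆ g '' Icc a b, IsPreconnected C → ∀ s ∈ Icc a b, ∀ u ∈ Icc a b,
      g s ∈ C → g u ∈ C → ∀ m ∈ Icc s u, g m ∈ C := by
    intro C hC hCc s hs u hu hgs hgu m hm
    have hpre : IsPreconnected (e ⁻¹' C) := by
      apply hCc.preimage_of_isClosedMap he.injective he.isClosedMap
      rintro z hz
      obtain ⟨t, ht, rfl⟩ := hC hz
      exact ⟨⟨t, ht⟩, rfl⟩
    have h2 := (hpre.image _ continuous_subtype_val.continuousOn).Icc_subset
      (a := s) (b := u) ⟨⟨s, hs⟩, hgs, rfl⟩ ⟨⟨u, hu⟩, hgu, rfl⟩ hm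
    obtain ⟨m', hm', rfl⟩ := h2
    exact hm'
  set d := r / 2 with hd
  have hd0 : 0 < d := by positivity
  have hx : (p.1 + d, p.2) ∈ Metric.ball p r := by
    simp [Prod.dist_eq, abs_of_pos hd0]; constructor <;> linarith
  have hy : (p.1 - d, p.2) ∈ Metric.ball p r := by
    simp [Prod.dist_eq, abs_of_pos hd0]; constructor <;> linarith
  have hz : (p.1, p.2 + d) ∈ Metric.ball p r := by
    simp [Prod.dist_eq, abs_of_pos hd0]; constructor <;> linarith
  have hcv := convex_ball p r
  set x : ℝ × ℝ := (p.1 + d, p.2)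
  set y : ℝ × ℝ := (p.1 - d, p.2)
  set z : ℝ × ℝ := (p.1, p.2 + d)
  have hxy : x ≠ y := by
    intro h
    have := congrArg Prod.fst h
    simp only [x, y] at this
    linarith
  have hC1 : IsPreconnected (segment ℝ x y) := (convex_segment _ _).isPreconnected
  have hC2 : IsPreconnected (segment ℝ x z ∪ segment ℝ z y) :=
    IsPreconnected.union z (right_mem_segment _ _ _) (left_mem_segment _ _ _)
      (convex_segment _ _).isPreconnected (convex_segment _ _).isPreconnected
  have hS1 : segment ℝ x y ⊆ g '' Icc a b := (hcv.segment_subset hx hy).trans hB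
  have hS2 : segment ℝ x z ∪ segment ℝ z y ⊆ g '' Icc a b :=
    (union_subset (hcv.segment_subset hx hz) (hcv.segment_subset hz hy)).trans hB
  have hmeet : ∀ c ∈ segment ℝ x y, c ∈ segment ℝ x z ∪ segment ℝ z y → c = x ∨ c = y := by
    intro c hc hc2
    rw [segment_eq_image] at hc
    obtain ⟨t, ht, rfl⟩ := hc
    rcases hc2 with hc2 | hc2
    · rw [segment_eq_image] at hc2
      obtain ⟨u, hu, hut⟩ := hc2
      left
      have h1 := congrArg Prod.snd hut
      simp [x, y, z] at h1
      have h2 : u = 0 := by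
        have : u * d = 0 := by nlinarith
        rcases mul_eq_zero.1 this with h | h
        · exact h
        · exact absurd h hd0.ne'
      rw [← hut, h2]
      simp
    · rw [segment_eq_image] at hc2
      obtain ⟨u, hu, hut⟩ := hc2
      right
      have h1 := congrArg Prod.snd hut
      simp [x, y, z] at h1
      have h2 : u = 1 := by
        have : (1 - u) * d = 0 := by nlinarith
        rcases mul_eq_zero.1 this with h | h
        · linarith
        · exact absurd h hd0.ne'
      rw [← hut, h2]
      simp
  obtain ⟨s, hs, hsx⟩ := hB hx
  obtain ⟨u, hu, huy⟩ := hB hy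
  have hsu : s ≠ u := by
    rintro rfl
    exact hxy (hsx.symm.trans huy)
  have fin : ∀ s ∈ Icc a b, ∀ u ∈ Icc a b, s < u →
      ((g s = x ∧ g u = y) ∨ (g s = y ∧ g u = x)) → False := by
    intro s hs u hu hlt hcase
    have hm : (s + u) / 2 ∈ Icc s u := ⟨by linarith, by linarith⟩
    have hmI : (s + u) / 2 ∈ Icc a b := ⟨hs.1.trans hm.1, hm.2.trans hu.2⟩
    have e1 : g s ∈ segment ℝ x y ∧ g u ∈ segment ℝ x y := by
      rcases hcase with ⟨h1, h2⟩ | ⟨h1, h2⟩ <;> rw [h1, h2] <;>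
        simp [left_mem_segment, right_mem_segment]
    have e2 : g s ∈ segment ℝ x z ∪ segment ℝ z y ∧ g u ∈ segment ℝ x z ∪ segment ℝ z y := by
      rcases hcase with ⟨h1, h2⟩ | ⟨h1, h2⟩ <;> rw [h1, h2] <;>
        simp [left_mem_segment, right_mem_segment]
    have hne1 : g ((s + u) / 2) ≠ g s := fun h => by
      have := hinj hmI hs h
      linarith
    have hne2 : g ((s + u) / 2) ≠ g u := fun h => by
      have := hinj hmI hu h
      linarith
    rcases hmeet _ (iv _ hS1 hC1 s hs u hu e1.1 e1.2 _ hm)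
      (iv _ hS2 hC2 s hs u hu e2.1 e2.2 _ hm) with h | h <;>
    rcases hcase with ⟨h1, h2⟩ | ⟨h1, h2⟩
    · exact hne1 (h.trans h1.symm)
    · exact hne2 (h.trans h2.symm)
    · exact hne2 (h.trans h2.symm)
    · exact hne1 (h.trans h1.symm)
  rcases lt_or_gt_of_ne hsu with h | h
  · exact fin s hs u hu h (Or.inl ⟨hsx, huy⟩)
  · exact fin u hu s hs h (Or.inr ⟨huy, hsx⟩)

/-- A face touching an arc of the drawing in an inner point touches the endpoint. -/
theorem arc_endpoint {K0 : Set (ℝ × ℝ)} (hK0 : IsCompact K0) {g : ℝ → ℝ × ℝ} (hg : Continuous g)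
    (hinj : InjOn g (Icc 0 1)) (hmeet : K0 ∩ g '' Icc 0 1 ⊆ {g 0, g 1}) {p : ℝ × ℝ}
    (hp : p ∉ K0 ∪ g '' Icc 0 1) {s : ℝ} (hs : s ∈ Ioo (0 : ℝ) 1)
    (hsF : g s ∈ frontier (connectedComponentIn (K0 ∪ g '' Icc 0 1)ᶜ p)) :
    g 0 ∈ frontier (connectedComponentIn (K0 ∪ g '' Icc 0 1)ᶜ p) := by
  by_contra h0
  have hK : IsClosed (K0 ∪ g '' Icc 0 1) := (hK0.union (isCompact_Icc.image hg)).isClosed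
  set F := connectedComponentIn (K0 ∪ g '' Icc 0 1)ᶜ p with hF
  have hFo : IsOpen F := hK.isOpen_compl.connectedComponentIn
  have hFs : F ⊆ (K0 ∪ g '' Icc 0 1)ᶜ := connectedComponentIn_subset _ _
  have h0F : g 0 ∉ closure F := by
    intro h
    apply h0
    rw [hFo.frontier_eq]
    exact ⟨h, fun h' => hFs h' (Or.inr ⟨0, by simp, rfl⟩)⟩
  have hev : ∀ᶠ u in 𝓝 (0 : ℝ), g u ∉ closure F :=
    hg.continuousAt.eventually (isClosed_closure.isOpen_compl.mem_nhds h0F)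
  obtain ⟨ε, hε, hεF⟩ := Metric.eventually_nhds_iff.1 hev
  obtain ⟨t, ht0, htε, hts⟩ : ∃ t, 0 < t ∧ t < ε ∧ t < s := by
    refine ⟨min ε s / 2, ?_, ?_, ?_⟩
    · have := lt_min hε hs.1
      linarith
    · have := min_le_left ε s
      linarith
    · have := min_le_right ε s
      have := hs.1
      linarith
  have htF : ∀ u ∈ Icc 0 t, g u ∉ closure F := by
    intro u hu
    apply hεF
    rw [Real.dist_eq, sub_zero, abs_of_nonneg hu.1]
    exact hu.2.trans_lt htε
  have ht1 : t < 1 := hts.trans hs.2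
  have hsubI : Icc t 1 ⊆ Icc (0 : ℝ) 1 := Icc_subset_Icc_left ht0.le
  set a1 := g '' Icc t 1 with ha1
  have ha1c : IsCompact a1 := isCompact_Icc.image hg
  have hsub : K0 ∪ a1 ⊆ K0 ∪ g '' Icc 0 1 := union_subset_union_right _ (image_mono hsubI)
  have hfr : frontier F ⊆ K0 ∪ a1 := by
    intro z hz
    rcases frontier_sub hK hz with h | ⟨u, hu, rfl⟩
    · exact Or.inl h
    · refine Or.inr ⟨u, ⟨?_, hu.2⟩, rfl⟩
      by_contra hut
      exact htF u ⟨hu.1, (not_le.1 hut).le⟩ (frontier_subset_closure hz)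
  have hpK0 : p ∉ K0 := fun h => hp (Or.inl h)
  have hpa1 : p ∉ a1 := fun h => hp (hsub (Or.inr h))
  have hK0o : IsOpen K0ᶜ := hK0.isClosed.isOpen_compl
  have hI : ∀ u ∈ Ico t 1, g u ∉ K0 := by
    intro u hu h
    have huI : u ∈ Icc (0 : ℝ) 1 := hsubI ⟨hu.1, hu.2.le⟩
    rcases hmeet ⟨h, u, huI, rfl⟩ with h' | h'
    · have := hinj huI (by simp) h'
      linarith [hu.1]
    · have := hinj huI (by simp) h'
      linarith [hu.2]
  set C := connectedComponentIn K0ᶜ p with hC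
  have hCo : IsOpen C := hK0o.connectedComponentIn
  have hFC : F ⊆ C := isPreconnected_connectedComponentIn.subset_connectedComponentIn
        (mem_connectedComponentIn hp) (fun z hz h => hFs hz (Or.inl h))
  have hsC : g s ∈ C := comp_closed hK0o (hI s ⟨hts.le, hs.2⟩)
    (closure_mono hFC (frontier_subset_closure hsF))
  have htC : g t ∈ C := by
    rw [hC, connectedComponentIn_eq hsC]
    refine (isPreconnected_Ico.image g hg.continuousOn).subset_connectedComponentIn
      (s := g '' Ico t 1) ⟨s, ⟨hts.le, hs.2⟩, rfl⟩ ?_ ⟨t, ⟨le_rfl, ht1⟩, rfl⟩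
    rintro _ ⟨u, hu, rfl⟩
    exact hI u hu
  have hN : IsOpen (C ∩ (closure F)ᶜ) := hCo.inter isClosed_closure.isOpen_compl
  have hnot : ¬ (C ∩ (closure F)ᶜ ⊆ a1) := by
    intro h
    have : g t ∈ interior a1 := mem_interior.2 ⟨_, h, hN, htC, htF t ⟨ht0.le, le_rfl⟩⟩
    rw [arc_interior hg (hinj.mono hsubI)] at this
    exact this
  obtain ⟨q, ⟨hqC, hqF⟩, hqa⟩ := not_subset.1 hnot
  have hqs := arc_nonsep hg ht1.le (hinj.mono hsubI) hpa1 hqa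
  refine hqF (subset_closure (comp_shrink hK hp hsub hfr
    (janiszewski hK0 ha1c ?_ hpK0 hpa1 hqC hqs)))
  apply Set.Subsingleton.isPreconnected
  have h1 : ∀ z ∈ K0 ∩ a1, z = g 1 := by
    rintro _ ⟨h, u, hu, rfl⟩
    by_contra hne
    refine hI u ⟨hu.1, lt_of_le_of_ne hu.2 ?_⟩ h
    rintro rfl
    exact hne rfl
  intro x hx y hy
  rw [h1 x hx, h1 y hy]

end PlaneArcs

section GraphPart

theorem precon_part {X Y : Set (ℝ × ℝ)} (hX : IsClosed X) (hY : IsClosed Y) {w : ℝ × ℝ}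
    (hXY : X ∩ Y = {w}) (hK : IsPreconnected (X ∪ Y)) : IsPreconnected X := by
  have hw : w ∈ X ∩ Y := by rw [hXY]; rfl
  have key : ∀ t t' : Set (ℝ × ℝ), IsClosed t → IsClosed t' → X ⊆ t ∪ t' →
      (X ∩ t').Nonempty → w ∈ t → (X ∩ (t ∩ t')).Nonempty := by
    intro t t' ht ht' hc hne hwt
    obtain ⟨x, hx, hxt⟩ := hne
    obtain ⟨z, -, hz1, hz2, hz3⟩ := isPreconnected_closed_iff.1 hK ((X ∩ t) ∪ Y) (X ∩ t')
      ((hX.inter ht).union hY) (hX.inter ht') (by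
        rintro z (hz | hz)
        · rcases hc hz with h | h
          · exact Or.inl (Or.inl ⟨hz, h⟩)
          · exact Or.inr ⟨hz, h⟩
        · exact Or.inl (Or.inr hz))
      ⟨w, Or.inl hw.1, Or.inr hw.2⟩ ⟨x, Or.inl hx, hx, hxt⟩
    rcases hz1 with hz1 | hz1
    · exact ⟨z, hz2, hz1.2, hz3⟩
    · have : z ∈ X ∩ Y := ⟨hz2, hz1⟩
      rw [hXY, mem_singleton_iff] at this
      subst this
      exact ⟨z, hz2, hwt, hz3⟩
  rw [isPreconnected_closed_iff]
  intro t t' ht ht' hc hn hn'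
  rcases hc hw.1 with h | h
  · exact key t t' ht ht' hc hn' h
  · have := key t' t ht' ht (by rwa [union_comm]) hn h
    rwa [inter_comm t t']

variable {V : Type} {G : SimpleGraph V}

theorem arc_param (Φ : PlaneEmbedding G) (e : G.edgeSet) {w : V} (hw : w ∈ (e : Sym2 V)) :
    ∃ (g : ℝ → ℝ × ℝ) (v : V), Continuous g ∧ InjOn g (Icc 0 1) ∧ g '' Icc 0 1 = Φ.arc e ∧
      (e : Sym2 V) = s(w, v) ∧ g 0 = Φ.vmap w ∧ g 1 = Φ.vmap v := by
  obtain ⟨f, hf, hfi, hfr, u, v, he, h0, h1⟩ := Φ.arc_path e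
  let k : ℝ → ℝ × ℝ := IccExtend (zero_le_one' ℝ) f
  have hk : Continuous k := hf.Icc_extend'
  have hkf : ∀ (t : ℝ) (ht : t ∈ Icc (0 : ℝ) 1), k t = f ⟨t, ht⟩ := fun t ht =>
    IccExtend_of_mem _ _ ht
  have hki : InjOn k (Icc 0 1) := by
    intro a ha b hb hab
    rw [hkf a ha, hkf b hb] at hab
    exact congrArg Subtype.val (hfi hab)
  have hkr : k '' Icc 0 1 = Φ.arc e := by
    rw [← hfr]
    ext z
    constructor
    · rintro ⟨t, ht, rfl⟩
      exact ⟨⟨t, ht⟩, (hkf t ht).symm⟩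
    · rintro ⟨⟨t, ht⟩, rfl⟩
      exact ⟨t, ht, hkf t ht⟩
  have hk0 : k 0 = Φ.vmap u := (hkf 0 (by simp)).trans h0
  have hk1 : k 1 = Φ.vmap v := (hkf 1 (by simp)).trans h1
  rw [he, Sym2.mem_iff] at hw
  rcases hw with rfl | rfl
  · exact ⟨k, v, hk, hki, hkr, he, hk0, hk1⟩
  · refine ⟨fun t => k (1 - t), u, by fun_prop, ?_, ?_, by rw [he, Sym2.eq_swap], ?_, ?_⟩
    · intro a ha b hb hab
      have := @hki (1 - a) ⟨by linarith [ha.2], by linarith [ha.1]⟩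
        (1 - b) ⟨by linarith [hb.2], by linarith [hb.1]⟩ hab
      linarith
    · rw [← hkr]
      ext z
      constructor
      · rintro ⟨t, ht, rfl⟩
        exact ⟨1 - t, ⟨by linarith [ht.2], by linarith [ht.1]⟩, rfl⟩
      · rintro ⟨t, ht, rfl⟩
        exact ⟨1 - t, ⟨by linarith [ht.2], by linarith [ht.1]⟩, by simp⟩
    · simpa using hk1
    · simpa using hk0

theorem exists_mem_sym2 (e : Sym2 V) : ∃ u, u ∈ e := by
  induction e using Sym2.ind with
  | _ x y => exact ⟨x, by simp⟩

theorem arc_compact (Φ : PlaneEmbedding G) (e : G.edgeSet) : IsCompact (Φ.arc e) := by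
  obtain ⟨u, hu⟩ := exists_mem_sym2 (e : Sym2 V)
  obtain ⟨g, v, hg, -, hr, -⟩ := arc_param Φ e hu
  rw [← hr]
  exact isCompact_Icc.image hg

theorem arc_precon (Φ : PlaneEmbedding G) (e : G.edgeSet) : IsPreconnected (Φ.arc e) := by
  obtain ⟨u, hu⟩ := exists_mem_sym2 (e : Sym2 V)
  obtain ⟨g, v, hg, -, hr, -⟩ := arc_param Φ e hu
  rw [← hr]
  exact isPreconnected_Icc.image g hg.continuousOn

theorem arc_int (Φ : PlaneEmbedding G) (e : G.edgeSet) : interior (Φ.arc e) = ∅ := by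
  obtain ⟨u, hu⟩ := exists_mem_sym2 (e : Sym2 V)
  obtain ⟨g, v, hg, hi, hr, -⟩ := arc_param Φ e hu
  rw [← hr]
  exact arc_interior hg hi

theorem vmap_mem (Φ : PlaneEmbedding G) (e : G.edgeSet) {u : V} (hu : u ∈ (e : Sym2 V)) :
    Φ.vmap u ∈ Φ.arc e := by
  obtain ⟨g, v, hg, hi, hr, -, h0, -⟩ := arc_param Φ e hu
  rw [← hr, ← h0]
  exact ⟨0, by simp, rfl⟩

theorem drawing_union (Φ : PlaneEmbedding G) (P : G.edgeSet → Prop) :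
    Φ.drawing = (⋃ e : {e // ¬ P e}, Φ.arc e) ∪ (⋃ e : {e // P e}, Φ.arc e) := by
  ext z
  simp only [PlaneEmbedding.drawing, mem_iUnion, mem_union]
  constructor
  · rintro ⟨e, he⟩
    by_cases h : P e
    · exact Or.inr ⟨⟨e, h⟩, he⟩
    · exact Or.inl ⟨⟨e, h⟩, he⟩
  · rintro (⟨e, he⟩ | ⟨e, he⟩) <;> exact ⟨e, he⟩

set_option maxHeartbeats 1000000 in
theorem exists_face_at [Fintype V] (Φ : PlaneEmbedding G) {w v : V} (hwv : G.Adj w v) :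
    ∃ F, Φ.IsFace F ∧ Φ.OnFace F w := by
  have hKc : IsCompact Φ.drawing := isCompact_iUnion (arc_compact Φ)
  have hwK : Φ.vmap w ∈ Φ.drawing :=
    mem_iUnion.2 ⟨⟨s(w, v), hwv⟩, vmap_mem Φ _ (by simp)⟩
  -- the things not incident to `w`
  let Z : Set (ℝ × ℝ) := (⋃ e : {e : G.edgeSet // w ∉ (e : Sym2 V)}, Φ.arc e) ∪
    Φ.vmap '' {x | x ≠ w}
  have hZ : IsClosed Z := by
    refine IsClosed.union ?_ (Set.toFinite _).isClosed
    exact isClosed_iUnion_of_finite fun e => (arc_compact Φ e).isClosed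
  have hwZ : Φ.vmap w ∉ Z := by
    rintro (h | ⟨x, hx, hxw⟩)
    · obtain ⟨e, he⟩ := mem_iUnion.1 h
      exact e.2 (Φ.vmap_mem_arc _ _ he)
    · exact hx (Φ.vmap_inj hxw)
  obtain ⟨r, hr, hrZ⟩ := Metric.isOpen_iff.1 hZ.isOpen_compl _ hwZ
  have hdense : Dense Φ.drawingᶜ := by
    have := dense_iInter_of_isOpen (f := fun e : G.edgeSet => (Φ.arc e)ᶜ)
      (fun e => (arc_compact Φ e).isClosed.isOpen_compl)
      (fun e => interior_eq_empty_iff_dense_compl.1 (arc_int Φ e))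
    rwa [← compl_iUnion] at this
  obtain ⟨p, hpK, hpr⟩ := hdense.exists_mem_open Metric.isOpen_ball
    ⟨Φ.vmap w, Metric.mem_ball_self hr⟩
  refine ⟨connectedComponentIn Φ.drawingᶜ p, ⟨p, hpK, rfl⟩, ?_⟩
  by_contra hwF
  have hFo : IsOpen (connectedComponentIn Φ.drawingᶜ p) :=
    hKc.isClosed.isOpen_compl.connectedComponentIn
  obtain ⟨q, hqs, hqF⟩ : ∃ q ∈ segment ℝ p (Φ.vmap w),
      q ∈ frontier (connectedComponentIn Φ.drawingᶜ p) := by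
    by_contra! hcon
    have := precon_sub (convex_segment p (Φ.vmap w)).isPreconnected hFo
      ⟨p, left_mem_segment _ _ _, mem_connectedComponentIn hpK⟩ hcon (right_mem_segment _ _ _)
    exact connectedComponentIn_subset _ _ this hwK
  have hqb : q ∈ Metric.ball (Φ.vmap w) r :=
    (convex_ball _ _).segment_subset hpr (Metric.mem_ball_self hr) hqs
  have hqZ := hrZ hqb
  obtain ⟨e, he⟩ := mem_iUnion.1 (frontier_sub hKc.isClosed hqF)
  have hwe : w ∈ (e : Sym2 V) := by
    by_contra h
    exact hqZ (Or.inl (mem_iUnion.2 ⟨⟨e, h⟩, he⟩))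
  obtain ⟨g, x, hg, hi, hgr, hex, h0, h1⟩ := arc_param Φ e hwe
  have hxw : x ≠ w := by
    rintro rfl
    have := e.2
    rw [hex] at this
    exact G.loopless.irrefl _ this
  have hdr : Φ.drawing = (⋃ e' : {e' // ¬ e' = e}, Φ.arc e') ∪ g '' Icc 0 1 := by
    rw [drawing_union Φ (fun e' => e' = e), hgr]
    congr 1
    ext z
    simp
  rw [← hgr] at he
  obtain ⟨s, hs, rfl⟩ := he
  have hs0 : s ≠ 0 := by
    rintro rfl
    apply hwF
    rw [h0] at hqF
    exact hqF
  have hs1 : s ≠ 1 := by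
    rintro rfl
    rw [h1] at hqZ
    exact hqZ (Or.inr ⟨x, hxw, rfl⟩)
  apply hwF
  unfold PlaneEmbedding.OnFace
  rw [hdr] at hqF hpK ⊢
  rw [← h0]
  refine arc_endpoint (K0 := ⋃ e' : {e' // ¬ e' = e}, Φ.arc e')
    (isCompact_iUnion fun e' => arc_compact Φ e'.1) hg hi ?_ hpK
    ⟨lt_of_le_of_ne hs.1 hs0.symm, lt_of_le_of_ne hs.2 hs1⟩ hqF
  rintro z ⟨hz1, hz2⟩
  obtain ⟨e', he'⟩ := mem_iUnion.1 hz1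
  rw [hgr] at hz2
  obtain ⟨y, ⟨hy1, hy2⟩, rfl⟩ := Φ.arc_inter _ _ e'.2 ⟨he', hz2⟩
  rw [hex, Sym2.mem_iff] at hy2
  rw [h0, h1]
  rcases hy2 with rfl | rfl
  · exact Or.inl rfl
  · exact Or.inr rfl

theorem exists_nbr (hconn : G.Connected) {u v : V} (huv : u ≠ v) : ∃ x, G.Adj u x := by
  obtain ⟨p⟩ := hconn.preconnected u v
  cases p with
  | nil => exact absurd rfl huv
  | cons h _ => exact ⟨_, h⟩

theorem drawing_precon (Φ : PlaneEmbedding G) (hconn : G.Connected) {w v : V} (hwv : G.Adj w v) :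
    IsPreconnected Φ.drawing := by
  have hwK : Φ.vmap w ∈ Φ.drawing :=
    mem_iUnion.2 ⟨⟨s(w, v), hwv⟩, vmap_mem Φ _ (by simp)⟩
  have key : ∀ {u x : V} (_ : G.Walk u x), Φ.vmap x ∈ Φ.drawing → 
      ∃ t ⊆ Φ.drawing, Φ.vmap u ∈ t ∧ Φ.vmap x ∈ t ∧ IsPreconnected t := by
    intro u x p hx
    induction p with
    | nil => exact ⟨{_}, by simpa using hx, rfl, rfl, isPreconnected_singleton⟩
    | @cons a b c h p ih =>
      obtain ⟨t, ht, hb, hc, hp⟩ := ih hx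
      refine ⟨Φ.arc ⟨s(a, b), h⟩ ∪ t, union_subset (subset_iUnion Φ.arc _) ht,
        Or.inl (vmap_mem Φ _ (by simp)), Or.inr hc, ?_⟩
      exact IsPreconnected.union (Φ.vmap b) (vmap_mem Φ _ (by simp)) hb (arc_precon Φ _) hp
  refine isPreconnected_of_forall (Φ.vmap w) fun y hy => ?_
  obtain ⟨e, he⟩ := mem_iUnion.1 hy
  obtain ⟨u, hu⟩ := exists_mem_sym2 (e : Sym2 V)
  obtain ⟨p⟩ := hconn.preconnected u w
  obtain ⟨t, ht, h1, h2, h3⟩ := key p hwK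
  exact ⟨Φ.arc e ∪ t, union_subset (subset_iUnion Φ.arc _) ht, Or.inr h2, Or.inl he,
    IsPreconnected.union (Φ.vmap u) (vmap_mem Φ _ hu) h1 (arc_precon Φ _) h3⟩

theorem cut_on_face [Fintype V] (Φ : PlaneEmbedding G) (hconn : G.Connected) {w : V} {S : Set V}
    (hwS : w ∉ S) (hS : ∀ u v, G.Adj u v → u ∈ S → v ∈ S ∨ v = w) {F : Set (ℝ × ℝ)}
    (hF : Φ.IsFace F) {u v : V} (hu : u ∈ S) (huF : Φ.OnFace F u) (hv : v ∉ S) (hvw : v ≠ w)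
    (hvF : Φ.OnFace F v) : Φ.OnFace F w := by
  obtain ⟨p, hp, rfl⟩ := hF
  let P : G.edgeSet → Prop := fun e => ∃ x ∈ (e : Sym2 V), x ∈ S
  let Y : Set (ℝ × ℝ) := ⋃ e : {e // ¬ P e}, Φ.arc e
  let X : Set (ℝ × ℝ) := ⋃ e : {e // P e}, Φ.arc e
  have hdr : Φ.drawing = X ∪ Y := by
    rw [drawing_union Φ P, union_comm]
  have hXc : IsCompact X := isCompact_iUnion fun e => arc_compact Φ e
  have hYc : IsCompact Y := isCompact_iUnion fun e => arc_compact Φ e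
  have huw : u ≠ w := by
    rintro rfl
    exact hwS hu
  obtain ⟨u', hu'⟩ := exists_nbr hconn huw
  obtain ⟨v', hv'⟩ := exists_nbr hconn hvw
  obtain ⟨w', hw'⟩ := exists_nbr hconn huw.symm
  have huX : Φ.vmap u ∈ X :=
    mem_iUnion.2 ⟨⟨⟨s(u, u'), hu'⟩, u, by simp, hu⟩, vmap_mem Φ _ (by simp)⟩
  have hvY : Φ.vmap v ∈ Y := by
    refine mem_iUnion.2 ⟨⟨⟨s(v, v'), hv'⟩, ?_⟩, vmap_mem Φ _ (by simp)⟩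
    rintro ⟨x, hx, hxS⟩
    rcases Sym2.mem_iff.1 hx with rfl | rfl
    · exact hv hxS
    · rcases hS _ _ hv'.symm hxS with h | h
      · exact hv h
      · exact hvw h
  have hK := drawing_precon Φ hconn hw'
  rw [hdr] at hK
  have hsub : X ∩ Y ⊆ {Φ.vmap w} := by
    rintro z ⟨hzX, hzY⟩
    obtain ⟨⟨e, x, hxe, hxS⟩, he⟩ := mem_iUnion.1 hzX
    obtain ⟨⟨e', hne⟩, he'⟩ := mem_iUnion.1 hzY
    have hee : e ≠ e' := by
      rintro rfl
      exact hne ⟨x, hxe, hxS⟩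
    obtain ⟨y, ⟨hy1, hy2⟩, rfl⟩ := Φ.arc_inter _ _ hee ⟨he, he'⟩
    have hyS : y ∉ S := fun h => hne ⟨y, hy2, h⟩
    have hxy : x ≠ y := by
      rintro rfl
      exact hyS hxS
    have hadj : G.Adj x y := by
      have := e.2
      rwa [(Sym2.mem_and_mem_iff hxy).1 ⟨hxe, hy1⟩] at this
    rcases hS x y hadj hxS with h | h
    · exact absurd h hyS
    · rw [h]
      rfl
  have hXY : X ∩ Y = {Φ.vmap w} := by
    refine hsub.antisymm ?_
    obtain ⟨z, -, hz⟩ := isPreconnected_closed_iff.1 hK X Y hXc.isClosed hYc.isClosed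
      subset_rfl ⟨_, Or.inl huX, huX⟩ ⟨_, Or.inr hvY, hvY⟩
    rintro _ rfl
    rw [← mem_singleton_iff.1 (hsub hz)]
    exact hz
  have hXp := precon_part hXc.isClosed hYc.isClosed hXY hK
  have hYp := precon_part hYc.isClosed hXc.isClosed (by rwa [inter_comm])
    (by rwa [union_comm])
  unfold PlaneEmbedding.OnFace at huF hvF ⊢
  rw [hdr] at hp huF hvF ⊢
  exact touch_common hXc hYc hXY hXp hYp hp huX huF hvY hvF

end GraphPart

/-- let `G` be a finite simple connected planar graph with a cut vertex `w`,
whose augmented components induced by `w` have vertex sets `insert w (W i)` (the `W i` being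
the vertex sets of the connected components of `G − {w}`), and let `M` be a sequence of
families of vertex subsets of `G` in which every set induces a connected subgraph. If the
family `M h` with its sets containing `w` removed is `G_i`-local, then `G` satisfies `M` iff
`G` satisfies `M` with `M h` replaced by
`(M h − {U : w ∈ U}) ∪ {U ∩ V(G_i) : U ∈ M h, w ∈ U}`. -/
theorem statement10 {V : Type} [Fintype V] (G : SimpleGraph V)
    (hconn : G.Connected) (hplanar : Planar G)
    (w : V) (hw : IsCutVertex G w)
    (k : ℕ) (W : Fin k → Set V)
    (hWc : ∀ i : Fin k, ∃ v : V, ∃ hv : v ≠ w,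
      W i = {u : V | ∃ hu : u ≠ w,
        (G.induce {x : V | x ≠ w}).Reachable ⟨u, hu⟩ ⟨v, hv⟩})
    (hWcov : ∀ v : V, v ≠ w → ∃ i : Fin k, v ∈ W i)
    (hWinj : Function.Injective W)
    (q : ℕ) (M : Fin q → Set (Set V))
    (hMconn : ∀ j : Fin q, ∀ U ∈ M j, (G.induce U).Connected)
    (h : Fin q) (i : Fin k)
    (hloc : ∀ U ∈ M h, w ∉ U → U ⊆ insert w (W i)) :
    SatSeq G M ↔
      SatSeq G (Function.update M h
        ({U ∈ M h | w ∉ U} ∪ (fun U => U ∩ insert w (W i)) '' {U ∈ M h | w ∈ U})) := by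
  classical
  have hne : ∃ x, x ≠ w := by
    obtain ⟨v, hv, -⟩ := hWc i
    exact ⟨v, hv⟩
  obtain ⟨x0, hx0⟩ := hne
  obtain ⟨w', hw'⟩ := exists_nbr hconn hx0.symm
  have hwW : w ∉ W i := by
    obtain ⟨v, hv, hWi⟩ := hWc i
    rw [hWi]
    rintro ⟨h', -⟩
    exact h' rfl
  have hadj : ∀ u v, G.Adj u v → u ∈ W i → v ∈ W i ∨ v = w := by
    intro u v huv hu
    by_cases hvw : v = w
    · exact Or.inr hvw
    · left
      obtain ⟨x, hx, hWi⟩ := hWc i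
      rw [hWi] at hu ⊢
      obtain ⟨huw, hr⟩ := hu
      refine ⟨hvw, SimpleGraph.Reachable.trans (SimpleGraph.Adj.reachable ?_) hr⟩
      simpa using huv.symm
  constructor
  · rintro ⟨Φ, hΦ⟩
    refine ⟨Φ, fun j => ?_⟩
    by_cases hj : j = h
    · subst hj
      rw [Function.update_self]
      -- a face touching `w` and all sets avoiding `w` suffices
      have good : ∀ F, Φ.IsFace F → Φ.OnFace F w →
          (∀ U ∈ M j, w ∉ U → ∃ v ∈ U, Φ.OnFace F v) →
          Φ.SatisfiesFam ({U ∈ M j | w ∉ U} ∪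
            (fun U => U ∩ insert w (W i)) '' {U ∈ M j | w ∈ U}) := by
        intro F hF hwF hU
        refine ⟨F, hF, ?_⟩
        rintro U (⟨h1, h2⟩ | ⟨U, ⟨h1, h2⟩, rfl⟩)
        · exact hU U h1 h2
        · exact ⟨w, ⟨h2, mem_insert _ _⟩, hwF⟩
      obtain ⟨F, hF, hFU⟩ := hΦ j
      by_cases hwF : Φ.OnFace F w
      · exact good F hF hwF fun U hU _ => hFU U hU
      by_cases hall : ∀ U ∈ M j, w ∈ U
      · obtain ⟨F', hF', hwF'⟩ := exists_face_at Φ hw'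
        exact good F' hF' hwF' fun U hU hn => absurd (hall U hU) hn
      push Not at hall
      obtain ⟨U0, hU0, hwU0⟩ := hall
      obtain ⟨u, huU, huF⟩ := hFU U0 hU0
      have huW : u ∈ W i := by
        rcases hloc U0 hU0 hwU0 huU with rfl | h'
        · exact absurd huU hwU0
        · exact h'
      refine ⟨F, hF, ?_⟩
      rintro U (⟨h1, h2⟩ | ⟨U, ⟨h1, h2⟩, rfl⟩)
      · exact hFU U h1
      · obtain ⟨v, hvU, hvF⟩ := hFU U h1
        by_cases hvw : v = w
        · subst hvw
          exact absurd hvF hwF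
        by_cases hvW : v ∈ W i
        · exact ⟨v, ⟨hvU, Or.inr hvW⟩, hvF⟩
        · exact absurd (cut_on_face Φ hconn hwW hadj hF huW huF hvW hvw hvF) hwF
    · rw [Function.update_of_ne hj]
      exact hΦ j
  · rintro ⟨Φ, hΦ⟩
    refine ⟨Φ, fun j => ?_⟩
    have hj' := hΦ j
    by_cases hj : j = h
    · subst hj
      rw [Function.update_self] at hj'
      obtain ⟨F, hF, hFU⟩ := hj'
      refine ⟨F, hF, fun U hU => ?_⟩
      by_cases hwU : w ∈ U
      · obtain ⟨v, hv, hvF⟩ := hFU _ (Or.inr ⟨U, ⟨hU, hwU⟩, rfl⟩)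
        exact ⟨v, hv.1, hvF⟩
      · exact hFU U (Or.inl ⟨hU, hwU⟩)
    · rw [Function.update_of_ne hj] at hj'
      exact hj'
end

section
/- Let G be a finite simple connected planar graph with a cut vertex w, let G₁,…,G_k be the augmented components induced by w, and let ℳ be a sequence of families of vertex subsets of G in which every set induces a connected subgraph of G. Let 𝒞_h be a family in ℳ, let U_{h,1},…,U_{h,t_h} be the sets in 𝒞_h containing w (possibly t_h = 0), and assume that 𝒞_h is w-global, i.e., for every i ∈ {1,…,k}, the family 𝒞_h − {U_{h,1},…,U_{h,t_h}} is not G_i-local. Then G satisfies ℳ if and only if G satisfies the sequence obtained from ℳ by replacing 𝒞_h with 𝒞_h − {U_{h,1},…,U_{h,t_h}}. -/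
open Set Topology

/-- Unicoherence of the plane. -/
theorem plane_unicoherent {A B P Q : Set (ℝ × ℝ)} (hA : IsClosed A) (hB : IsClosed B)
    (hAc : IsPreconnected A) (hBc : IsPreconnected B) (hAB : A ∪ B = univ)
    (hP : IsClosed P) (hQ : IsClosed Q) (hPQ : Disjoint P Q) (hcov : A ∩ B ⊆ P ∪ Q)
    {p q : ℝ × ℝ} (hp : p ∈ A ∩ B ∩ P) (hq : q ∈ A ∩ B ∩ Q) : False := by
  classical
  obtain ⟨g, hg0, hg1, -⟩ := exists_continuous_zero_one_of_isClosed hP hQ hPQ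
  have hBA : Aᶜ ⊆ B := fun x hx => by
    have : x ∈ A ∪ B := by rw [hAB]; trivial
    exact this.resolve_left hx
  have hagree : ∀ x ∈ A ∩ B, Circle.exp (Real.pi * g x) = Circle.exp (-(Real.pi * g x)) := by
    intro x hx
    rcases hcov hx with h | h
    · have : g x = 0 := hg0 h
      simp [this]
    · have : g x = 1 := hg1 h
      rw [this, Circle.exp_neg, mul_one]
      ext
      simp [Circle.coe_exp]
  let f : ℝ × ℝ → Circle :=
    A.piecewise (fun x => Circle.exp (Real.pi * g x)) (fun x => Circle.exp (-(Real.pi * g x)))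
  have hfA : ∀ x ∈ A, f x = Circle.exp (Real.pi * g x) := fun x hx => by simp [f, hx]
  have hfB : ∀ x ∈ B, f x = Circle.exp (-(Real.pi * g x)) := fun x hx => by
    by_cases h : x ∈ A
    · rw [hfA x h, hagree x ⟨h, hx⟩]
    · simp [f, h]
  have hf : Continuous f := by
    apply Continuous.piecewise
    · intro x hx
      apply hagree
      refine ⟨hA.frontier_subset hx, ?_⟩
      rw [frontier_eq_closure_inter_closure] at hx
      exact closure_minimal hBA hB hx.2
    · fun_prop
    · fun_prop
  have gp : g p = 0 := hg0 hp.2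
  have gq : g q = 1 := hg1 hq.2
  obtain ⟨φ, ⟨hφp, hφ⟩, -⟩ := Circle.isCoveringMap_exp.existsUnique_continuousMap_lifts
    (⟨f, hf⟩ : C(ℝ × ℝ, Circle)) p 0 (by simp [hfA p hp.1.1, gp])
  have h1 : EqOn φ (fun x => Real.pi * g x) A := by
    refine Circle.isCoveringMap_exp.eqOn_of_comp_eqOn hAc φ.continuous.continuousOn
      (by fun_prop) (fun x hx => ?_) hp.1.1 (by simp [hφp, gp])
    rw [hφ]; exact hfA x hx
  have h2 : EqOn φ (fun x => -(Real.pi * g x)) B := by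
    refine Circle.isCoveringMap_exp.eqOn_of_comp_eqOn hBc φ.continuous.continuousOn
      (by fun_prop) (fun x hx => ?_) hp.1.2 (by simp [hφp, gp])
    rw [hφ]; exact hfB x hx
  have e1 := h1 hq.1.1
  have e2 := h2 hq.1.2
  simp only [gq] at e1 e2
  linarith [Real.pi_pos]

theorem frontier_component_subset {D : Set (ℝ × ℝ)} (hD : IsClosed D) (x : ℝ × ℝ) :
    frontier (connectedComponentIn Dᶜ x) ⊆ D := by
  intro y hy
  by_contra hyD
  have hopen : ∀ z, IsOpen (connectedComponentIn Dᶜ z) :=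
    fun z => hD.isOpen_compl.connectedComponentIn
  rw [(hopen x).frontier_eq] at hy
  obtain ⟨z, hz1, hz2⟩ := mem_closure_iff.1 hy.1 _ (hopen y) (mem_connectedComponentIn hyD)
  have e : connectedComponentIn Dᶜ x = connectedComponentIn Dᶜ y :=
    (connectedComponentIn_eq hz2).trans (connectedComponentIn_eq hz1).symm
  exact hy.2 (e ▸ mem_connectedComponentIn hyD)

theorem compl_component_preconnected {D : Set (ℝ × ℝ)} (hD : IsClosed D)
    (hDc : IsPreconnected D) {d : ℝ × ℝ} (hd : d ∈ D) (x : ℝ × ℝ) :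
    IsPreconnected (connectedComponentIn Dᶜ x)ᶜ := by
  apply isPreconnected_of_forall d
  intro y hy
  have hDF : D ⊆ (connectedComponentIn Dᶜ x)ᶜ := fun z hz hz' =>
    connectedComponentIn_subset _ _ hz' hz
  by_cases hyD : y ∈ D
  · exact ⟨D, hDF, hd, hyD, hDc⟩
  have hopen : IsOpen (connectedComponentIn Dᶜ x) := hD.isOpen_compl.connectedComponentIn
  have hmem := mem_connectedComponentIn (show y ∈ Dᶜ from hyD)
  have hne : (frontier (connectedComponentIn Dᶜ y)).Nonempty := by
    rw [nonempty_frontier_iff]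
    refine ⟨⟨y, hmem⟩, fun h => ?_⟩
    have : d ∈ connectedComponentIn Dᶜ y := h ▸ mem_univ d
    exact connectedComponentIn_subset _ _ this hd
  obtain ⟨z, hz⟩ := hne
  refine ⟨D ∪ closure (connectedComponentIn Dᶜ y), union_subset hDF ?_, Or.inl hd,
    Or.inr (subset_closure hmem), ?_⟩
  · refine closure_minimal ?_ hopen.isClosed_compl
    intro t ht ht'
    apply hy
    rw [connectedComponentIn_eq ht', ← connectedComponentIn_eq ht]
    exact hmem
  · exact hDc.union z (frontier_component_subset hD y hz) hz.1
      isPreconnected_connectedComponentIn.closure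

namespace PlaneEmbedding

variable {V : Type*} {G : SimpleGraph V}

theorem arc_compact (Φ : PlaneEmbedding G) (e : G.edgeSet) : IsCompact (Φ.arc e) := by
  obtain ⟨f, hf, -, hr, -⟩ := Φ.arc_path e
  rw [← hr]; exact isCompact_range hf

theorem arc_preconnected (Φ : PlaneEmbedding G) (e : G.edgeSet) : IsPreconnected (Φ.arc e) := by
  obtain ⟨f, hf, -, hr, -⟩ := Φ.arc_path e
  rw [← hr]; exact isPreconnected_range hf

theorem mem_arc (Φ : PlaneEmbedding G) (e : G.edgeSet) {x : V} (hx : x ∈ (e : Sym2 V)) :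
    Φ.vmap x ∈ Φ.arc e := by
  obtain ⟨f, hf, -, hr, u, v, he, h0, h1⟩ := Φ.arc_path e
  rw [← hr]
  rw [he, Sym2.mem_iff] at hx
  rcases hx with rfl | rfl
  · exact ⟨0, h0⟩
  · exact ⟨1, h1⟩

theorem drawing_preconnected (Φ : PlaneEmbedding G) (hG : G.Connected) {a : V}
    (ha : Φ.vmap a ∈ Φ.drawing) : IsPreconnected Φ.drawing := by
  have harc : ∀ (e : G.edgeSet) (x : V), x ∈ (e : Sym2 V) →
      Φ.vmap x ∈ connectedComponentIn Φ.drawing (Φ.vmap a) →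
      Φ.arc e ⊆ connectedComponentIn Φ.drawing (Φ.vmap a) := by
    intro e x hx hxS
    rw [connectedComponentIn_eq hxS]
    exact (Φ.arc_preconnected e).subset_connectedComponentIn (Φ.mem_arc e hx)
      (subset_iUnion _ e)
  have hv : ∀ v : V, Φ.vmap v ∈ connectedComponentIn Φ.drawing (Φ.vmap a) := by
    intro v
    have := (SimpleGraph.reachable_iff_reflTransGen a v).1 (hG.preconnected a v)
    induction this with
    | refl => exact mem_connectedComponentIn ha
    | @tail b c _ hbc ih =>
      exact harc ⟨s(b, c), hbc⟩ b (by simp) ih (Φ.mem_arc _ (by simp))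
  have : Φ.drawing = connectedComponentIn Φ.drawing (Φ.vmap a) := by
    refine subset_antisymm (iUnion_subset fun e => ?_) (connectedComponentIn_subset _ _)
    obtain ⟨f, hf, -, hr, u, v, he, h0, h1⟩ := Φ.arc_path e
    exact harc e u (by simp [he]) (hv u)
  rw [this]
  exact isPreconnected_connectedComponentIn

/-- A face touching both sides of a cut vertex has the cut vertex on its boundary. -/
theorem onFace_cut [Finite V] (Φ : PlaneEmbedding G) (hG : G.Connected) {w : V} {S : Set V}
    (hS : ∀ x y, x ∈ S → y ≠ w → G.Adj x y → y ∈ S) {F : Set (ℝ × ℝ)}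
    (hF : Φ.IsFace F) {a b : V} (ha : a ∈ S) (hb : b ∉ S) (haw : a ≠ w) (hbw : b ≠ w)
    (haF : Φ.OnFace F a) (hbF : Φ.OnFace F b) : Φ.OnFace F w := by
  by_contra hwF
  obtain ⟨p, hp, rfl⟩ := hF
  have hS' : ∀ (e : G.edgeSet) (x y : V), x ∈ (e : Sym2 V) → y ∈ (e : Sym2 V) → x ∈ S →
      y ≠ w → y ∈ S := by
    intro e x y hx hy hxS hyw
    by_cases hxy : x = y
    · exact hxy ▸ hxS
    · have he := (Sym2.mem_and_mem_iff hxy).1 ⟨hx, hy⟩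
      exact hS x y hxS hyw (by rw [← SimpleGraph.mem_edgeSet, ← he]; exact e.2)
  have hclosed : ∀ T : Set G.edgeSet, IsClosed (⋃ e ∈ T, Φ.arc e) := fun T =>
    T.toFinite.isClosed_biUnion fun e _ => (Φ.arc_compact e).isClosed
  have hD : IsClosed Φ.drawing := by
    simpa [drawing] using hclosed univ
  have haD := frontier_component_subset hD p haF
  have hbD := frontier_component_subset hD p hbF
  have hopen : IsOpen (connectedComponentIn Φ.drawingᶜ p) := hD.isOpen_compl.connectedComponentIn
  let T : Set G.edgeSet := {e | ∃ x ∈ (e : Sym2 V), x ∈ S ∧ x ≠ w}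
  have hfr : closure (connectedComponentIn Φ.drawingᶜ p) ∩ (connectedComponentIn Φ.drawingᶜ p)ᶜ
      = frontier (connectedComponentIn Φ.drawingᶜ p) := by
    rw [hopen.frontier_eq]; rfl
  refine plane_unicoherent (A := closure (connectedComponentIn Φ.drawingᶜ p))
    (B := (connectedComponentIn Φ.drawingᶜ p)ᶜ)
    (P := frontier (connectedComponentIn Φ.drawingᶜ p) ∩ ⋃ e ∈ T, Φ.arc e)
    (Q := frontier (connectedComponentIn Φ.drawingᶜ p) ∩ ⋃ e ∈ Tᶜ, Φ.arc e)
    (p := Φ.vmap a) (q := Φ.vmap b)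
    isClosed_closure hopen.isClosed_compl isPreconnected_connectedComponentIn.closure
    (compl_component_preconnected hD (Φ.drawing_preconnected hG haD) haD p) ?_
    (isClosed_frontier.inter (hclosed T)) (isClosed_frontier.inter (hclosed Tᶜ)) ?_ ?_ ?_ ?_
  · rw [eq_univ_iff_forall]
    intro x
    by_cases hx : x ∈ connectedComponentIn Φ.drawingᶜ p
    · exact Or.inl (subset_closure hx)
    · exact Or.inr hx
  · rw [Set.disjoint_left]
    rintro z ⟨hz, hz1⟩ ⟨-, hz2⟩
    simp only [mem_iUnion] at hz1 hz2
    obtain ⟨e, heT, hze⟩ := hz1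
    obtain ⟨e', heT', hze'⟩ := hz2
    have hne : e ≠ e' := fun h => heT' (h ▸ heT)
    obtain ⟨x, ⟨hx, hx'⟩, rfl⟩ := Φ.arc_inter e e' hne ⟨hze, hze'⟩
    have hxw : x ≠ w := by
      rintro rfl
      exact hwF hz
    obtain ⟨y, hy, hyS, hyw⟩ := heT
    exact heT' ⟨x, hx', hS' e y x hy hx hyS hxw, hxw⟩
  · rw [hfr]
    intro z hz
    obtain ⟨e, he⟩ := mem_iUnion.1 (frontier_component_subset hD p hz)
    by_cases heT : e ∈ T
    · exact Or.inl ⟨hz, mem_iUnion₂.2 ⟨e, heT, he⟩⟩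
    · exact Or.inr ⟨hz, mem_iUnion₂.2 ⟨e, heT, he⟩⟩
  · rw [hfr]
    obtain ⟨e, he⟩ := mem_iUnion.1 haD
    exact ⟨haF, haF, mem_iUnion₂.2 ⟨e, ⟨a, Φ.vmap_mem_arc e a he, ha, haw⟩, he⟩⟩
  · rw [hfr]
    obtain ⟨e, he⟩ := mem_iUnion.1 hbD
    refine ⟨hbF, hbF, mem_iUnion₂.2 ⟨e, ?_, he⟩⟩
    rintro ⟨x, hx, hxS, -⟩
    exact hb (hS' e x b hx (Φ.vmap_mem_arc e b he) hxS hbw)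

end PlaneEmbedding

/-- let `G` be a finite simple connected planar graph with a cut vertex `w`,
whose augmented components induced by `w` have vertex sets `insert w (W i)`, and let `M` be a
sequence of families of vertex subsets of `G` in which every set induces a connected subgraph.
If the family `M h` is `w`-global (for every `i`, the family `M h` minus its sets containing
`w` is not `G_i`-local), then `G` satisfies `M` iff `G` satisfies `M` with `M h` replaced by
`M h − {U : w ∈ U}`. -/
theorem statement11 {V : Type} [Fintype V] (G : SimpleGraph V)
    (hconn : G.Connected) (hplanar : Planar G)
    (w : V) (hw : IsCutVertex G w)
    (k : ℕ) (W : Fin k → Set V)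
    (hWc : ∀ i : Fin k, ∃ v : V, ∃ hv : v ≠ w,
      W i = {u : V | ∃ hu : u ≠ w,
        (G.induce {x : V | x ≠ w}).Reachable ⟨u, hu⟩ ⟨v, hv⟩})
    (hWcov : ∀ v : V, v ≠ w → ∃ i : Fin k, v ∈ W i)
    (hWinj : Function.Injective W)
    (q : ℕ) (M : Fin q → Set (Set V))
    (hMconn : ∀ j : Fin q, ∀ U ∈ M j, (G.induce U).Connected)
    (h : Fin q)
    (hglob : ∀ i : Fin k, ∃ U ∈ M h, w ∉ U ∧ ¬ U ⊆ insert w (W i)) :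
    SatSeq G M ↔ SatSeq G (Function.update M h {U ∈ M h | w ∉ U}) := by
  classical
  constructor
  · rintro ⟨Φ, hΦ⟩
    refine ⟨Φ, fun j => ?_⟩
    by_cases hj : j = h
    · subst hj
      obtain ⟨F, hF, hFU⟩ := hΦ j
      rw [Function.update_self]
      exact ⟨F, hF, fun U hU => hFU U hU.1⟩
    · rw [Function.update_of_ne hj]
      exact hΦ j
  · rintro ⟨Φ, hΦ⟩
    refine ⟨Φ, fun j => ?_⟩
    by_cases hj : j = h
    swap
    · have := hΦ j
      rwa [Function.update_of_ne hj] at this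
    subst hj
    have hj := hΦ j
    rw [Function.update_self] at hj
    obtain ⟨F, hF, hFU⟩ := hj
    refine ⟨F, hF, fun U hU => ?_⟩
    by_cases hwU : w ∈ U
    swap
    · exact hFU U ⟨hU, hwU⟩
    refine ⟨w, hwU, ?_⟩
    have hS : ∀ i, ∀ x y, x ∈ W i → y ≠ w → G.Adj x y → y ∈ W i := by
      intro i x y hx hy hxy
      obtain ⟨v, hv, hWi⟩ := hWc i
      rw [hWi] at hx ⊢
      obtain ⟨hxw, hr⟩ := hx
      refine ⟨hy, SimpleGraph.Reachable.trans (SimpleGraph.Adj.reachable ?_) hr⟩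
      exact hxy.symm
    have hpos : 0 < Nat.card ((G.induce {v : V | v ≠ w}).ConnectedComponent) :=
      lt_of_le_of_lt (Nat.zero_le _) hw
    obtain ⟨c⟩ := (Nat.card_pos_iff.1 hpos).1
    obtain ⟨⟨v0, hv0⟩, -⟩ := c.exists_rep
    obtain ⟨i, -⟩ := hWcov v0 hv0
    obtain ⟨U1, hU1, hwU1, -⟩ := hglob i
    obtain ⟨a, haU, haF⟩ := hFU U1 ⟨hU1, hwU1⟩
    have haw : a ≠ w := fun e => hwU1 (e ▸ haU)
    obtain ⟨l, hal⟩ := hWcov a haw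
    obtain ⟨U2, hU2, hwU2, hsub⟩ := hglob l
    obtain ⟨b, hbU, hbF⟩ := hFU U2 ⟨hU2, hwU2⟩
    have hbw : b ≠ w := fun e => hwU2 (e ▸ hbU)
    refine Φ.onFace_cut hconn (hS l) hF hal ?_ haw hbw haF hbF
    intro hbl
    apply hsub
    intro x hx
    right
    have hr := (SimpleGraph.reachable_iff_reflTransGen _ _).1
      ((hMconn j U2 hU2).preconnected ⟨b, hbU⟩ ⟨x, hx⟩)
    have key : ∀ y : U2, Relation.ReflTransGen (G.induce U2).Adj ⟨b, hbU⟩ y → (y : V) ∈ W l := by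
      intro y hy
      induction hy with
      | refl => exact hbl
      | @tail c d _ hcd ih =>
        exact hS l c d ih (fun e => hwU2 (e ▸ d.2)) hcd
    exact key _ hr
end

section
/- Let G be a finite simple planar graph with connected components G₁,…,G_k, and let ℳ be a sequence of families 𝒞₁,…,𝒞_q of vertex subsets of G in which every set induces a connected subgraph of G (so each set is G_i-local for some i). Let H be an edge-labeled multigraph on vertex set {1,…,k} constructed as follows: for each global family 𝒞_h of ℳ, H contains a cycle C, possibly of length 2, whose vertex set is exactly the set of i ∈ {1,…,k} such that some set in 𝒞_h is G_i-local, and all edges of C are labeled h. Let H₁,…,H_ℓ be the connected components of H. For each H_j, let G′_j be the subgraph of G formed by the union of all G_i with i ∈ V(H_j), and let ℳ′_j be the sequence of all G′_j-local families in ℳ. Then G satisfies ℳ if and only if every G′_j satisfies ℳ′_j. -/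
open Set Topology

section Multigraph

/-- Reachability inside the sub-multigraph of the multigraph with edge-endpoint map `ends`
given by the vertex set `Wb` and the edge set `A`. -/
def SubReach {α E : Type*} (ends : E → Sym2 α) (Wb : Set α) (A : Set E) (x y : α) : Prop :=
  Relation.ReflTransGen (fun a b => a ∈ Wb ∧ b ∈ Wb ∧ ∃ e ∈ A, ends e = s(a, b)) x y

/-- `(Wb, A)` is a subgraph of the multigraph: endpoints of edges of `A` lie in `Wb`. -/
def MSubgraph {α E : Type*} (ends : E → Sym2 α) (Wb : Set α) (A : Set E) : Prop :=
  ∀ e ∈ A, ∀ x : α, x ∈ ends e → x ∈ Wb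

/-- The sub-multigraph `(Wb, A)` is connected. -/
def MConnected {α E : Type*} (ends : E → Sym2 α) (Wb : Set α) (A : Set E) : Prop :=
  Wb.Nonempty ∧ ∀ x ∈ Wb, ∀ y ∈ Wb, SubReach ends Wb A x y

/-- The sub-multigraph `(Wb, A)` has no cut vertex: removing any vertex (together with its
incident edges) leaves it connected. -/
def MNoCutVtx {α E : Type*} (ends : E → Sym2 α) (Wb : Set α) (A : Set E) : Prop :=
  ∀ v ∈ Wb, ∀ x ∈ Wb \ {v}, ∀ y ∈ Wb \ {v},
    SubReach ends (Wb \ {v}) {e ∈ A | v ∉ ends e} x y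

/-- `(Wb, A)` is a block of the multigraph: a maximal connected subgraph without cut
vertex. -/
def IsBlock {α E : Type*} (ends : E → Sym2 α) (Wb : Set α) (A : Set E) : Prop :=
  MSubgraph ends Wb A ∧ MConnected ends Wb A ∧ MNoCutVtx ends Wb A ∧
    ∀ Wb' A', Wb ⊆ Wb' → A ⊆ A' → MSubgraph ends Wb' A' → MConnected ends Wb' A' →
      MNoCutVtx ends Wb' A' → Wb' = Wb ∧ A' = A

/-- The edges of the edge-labeled multigraph `H`: for each family index `h` satisfying the
globality predicate `Glob`, a cycle with `nh h` edges (the label of an edge being its first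
component). -/
def HEdge {q : ℕ} (Glob : Fin q → Prop) (nh : Fin q → ℕ) : Type :=
  Σ h : {h : Fin q // Glob h}, ZMod (nh h.1)

/-- The endpoints of the edges of `H`: the `t`-th edge of the cycle of the family `h` joins
the `t`-th and `(t+1)`-st vertices of that cycle. -/
def hEnds {k q : ℕ} (Glob : Fin q → Prop) (nh : Fin q → ℕ)
    (cyc : ∀ h : Fin q, ZMod (nh h) → Fin k) : HEdge Glob nh → Sym2 (Fin k) :=
  fun e => s(cyc e.1.1 e.2, cyc e.1.1 (e.2 + 1))

end Multigraph
/-- The family `M h` is global: it is not local to any single connected component `G_i`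
(with vertex set `W i`). -/
def GGlobal {V : Type*} {k q : ℕ} (W : Fin k → Set V)
    (M : Fin q → Set (Set V)) (h : Fin q) : Prop :=
  ∀ i : Fin k, ∃ U ∈ M h, ¬ U ⊆ W i

namespace PlaneEmbedding

theorem isClosed_drawing {V : Type*} [Finite V] {G : SimpleGraph V} (Φ : PlaneEmbedding G) :
    IsClosed Φ.drawing := by
  unfold drawing
  apply isClosed_iUnion_of_finite
  intro e
  obtain ⟨f, hf, -, hr, -⟩ := Φ.arc_path e
  rw [← hr]
  exact (isCompact_range hf).isClosed

theorem onFace_iff {V : Type*} [Finite V] {G : SimpleGraph V} (Φ : PlaneEmbedding G)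
    {F : Set (ℝ × ℝ)} (hF : Φ.IsFace F) (v : V) :
    Φ.OnFace F v ↔ Φ.vmap v ∈ closure F ∧ Φ.vmap v ∈ Φ.drawing := by
  obtain ⟨p, hp, rfl⟩ := hF
  have hop : IsOpen Φ.drawingᶜ := Φ.isClosed_drawing.isOpen_compl
  have hFo : IsOpen (connectedComponentIn Φ.drawingᶜ p) := hop.connectedComponentIn
  unfold OnFace
  rw [hFo.frontier_eq]
  constructor
  · rintro ⟨h1, h2⟩
    refine ⟨h1, ?_⟩
    by_contra h3
    apply h2
    have ho : IsOpen (connectedComponentIn Φ.drawingᶜ (Φ.vmap v)) := hop.connectedComponentIn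
    obtain ⟨x, hx1, hx2⟩ := mem_closure_iff.1 h1 _ ho (mem_connectedComponentIn h3)
    rw [connectedComponentIn_eq hx2, ← connectedComponentIn_eq hx1]
    exact mem_connectedComponentIn h3
  · rintro ⟨h1, h2⟩
    exact ⟨h1, fun h3 => connectedComponentIn_subset _ _ h3 h2⟩

/-- Restriction of a plane embedding to an induced subgraph. -/
theorem exists_restrict {V : Type*} {G : SimpleGraph V} (Φ : PlaneEmbedding G) (S : Set V) :
    ∃ Ψ : PlaneEmbedding (G.induce S), (∀ v : S, Ψ.vmap v = Φ.vmap v) ∧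
      ∀ e : (G.induce S).edgeSet, ∃ h : Sym2.map Subtype.val (e : Sym2 S) ∈ G.edgeSet,
        Ψ.arc e = Φ.arc ⟨_, h⟩ := by
  have hE : ∀ e : (G.induce S).edgeSet, Sym2.map Subtype.val (e : Sym2 S) ∈ G.edgeSet := by
    rintro ⟨e, he⟩
    induction e with
    | _ a b => simpa using he
  refine ⟨⟨fun v => Φ.vmap v, fun a b h => Subtype.ext (Φ.vmap_inj h),
    fun e => Φ.arc ⟨_, hE e⟩, ?_, ?_, ?_⟩, fun v => rfl, fun e => ⟨hE e, rfl⟩⟩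
  · intro e
    obtain ⟨f, hf, hi, hr, u, v, huv, h0, h1⟩ := Φ.arc_path ⟨_, hE e⟩
    refine ⟨f, hf, hi, hr, ?_⟩
    have hu : u ∈ Sym2.map Subtype.val (e : Sym2 S) := by
      have : Sym2.map Subtype.val (e : Sym2 S) = s(u, v) := huv
      rw [this]; simp
    have hv : v ∈ Sym2.map Subtype.val (e : Sym2 S) := by
      have : Sym2.map Subtype.val (e : Sym2 S) = s(u, v) := huv
      rw [this]; simp
    obtain ⟨u', -, rfl⟩ := Sym2.mem_map.1 hu
    obtain ⟨v', -, rfl⟩ := Sym2.mem_map.1 hv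
    refine ⟨u', v', ?_, h0, h1⟩
    apply Sym2.map.injective Subtype.val_injective
    simpa using huv
  · intro e e' hne x hx
    have hne' : (⟨_, hE e⟩ : G.edgeSet) ≠ ⟨_, hE e'⟩ := by
      intro h
      apply hne
      apply Subtype.ext
      apply Sym2.map.injective Subtype.val_injective
      exact congrArg Subtype.val h
    obtain ⟨w, ⟨h1, h2⟩, rfl⟩ := Φ.arc_inter _ _ hne' hx
    obtain ⟨w1, hw1, rfl⟩ := Sym2.mem_map.1 h1
    obtain ⟨w2, hw2, h3⟩ := Sym2.mem_map.1 h2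
    obtain rfl := Subtype.ext h3
    exact ⟨w2, ⟨hw1, hw2⟩, rfl⟩
  · intro e x hx
    obtain ⟨w, hw, h3⟩ := Sym2.mem_map.1 (Φ.vmap_mem_arc _ _ hx)
    obtain rfl := Subtype.ext h3
    exact hw

/-- Embeddings of unions of components can be drawn side by side. -/
theorem exists_combine {V : Type*} {G : SimpleGraph V} {ι : Type*} (S : ι → Set V) (J : V → ι)
    (hJ : ∀ v j, v ∈ S j ↔ J v = j) (hadj : ∀ u v, G.Adj u v → J u = J v)
    (Φ : ∀ j, PlaneEmbedding (G.induce (S j)))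
    (g : ι → ℝ × ℝ → ℝ × ℝ) (hgc : ∀ j, Continuous (g j))
    (hg : ∀ i j p q, g i p = g j q → i = j ∧ p = q) :
    ∃ Ψ : PlaneEmbedding G, (∀ j (v : S j), Ψ.vmap v = g j ((Φ j).vmap v)) ∧
      Ψ.drawing = ⋃ j, g j '' (Φ j).drawing := by
  let vm : V → ℝ × ℝ := fun v => g (J v) ((Φ (J v)).vmap ⟨v, (hJ v _).2 rfl⟩)
  have hvm : ∀ j (v : S j), vm v = g j ((Φ j).vmap v) := by
    rintro j ⟨v, hv⟩
    obtain rfl := (hJ v j).1 hv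
    rfl
  have hE : ∀ j (e : (G.induce (S j)).edgeSet),
      Sym2.map Subtype.val (e : Sym2 (S j)) ∈ G.edgeSet := by
    rintro j ⟨e, he⟩
    induction e with
    | _ a b => simpa using he
  have hex : ∀ e : G.edgeSet, ∃ (j : ι) (e' : (G.induce (S j)).edgeSet),
      Sym2.map Subtype.val (e' : Sym2 (S j)) = (e : Sym2 V) := by
    rintro ⟨e, he⟩
    induction e with
    | _ a b =>
      have hab : G.Adj a b := he
      refine ⟨J a, ⟨s(⟨a, (hJ a _).2 rfl⟩, ⟨b, (hJ b _).2 (hadj a b hab).symm⟩), ?_⟩, ?_⟩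
      · simpa using hab
      · simp
  choose jj ee hee using hex
  have huniq : ∀ j (e' : (G.induce (S j)).edgeSet) (e : G.edgeSet),
      Sym2.map Subtype.val (e' : Sym2 (S j)) = (e : Sym2 V) →
      g (jj e) '' (Φ (jj e)).arc (ee e) = g j '' (Φ j).arc e' := by
    intro j e' e h
    have h2 := hee e
    generalize ee e = e2 at *
    generalize jj e = j2 at *
    have : j2 = j := by
      rw [← h] at h2
      obtain ⟨x, hx⟩ : ∃ x, x ∈ (e2 : Sym2 (S j2)) := ⟨_, Sym2.out_fst_mem _⟩
      have hx2 : (x : V) ∈ Sym2.map Subtype.val (e2 : Sym2 (S j2)) := Sym2.mem_map.2 ⟨x, hx, rfl⟩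
      rw [h2] at hx2
      obtain ⟨y, -, hy⟩ := Sym2.mem_map.1 hx2
      rw [← (hJ x j2).1 x.2, ← (hJ y j).1 y.2, hy]
    subst this
    have : e2 = e' := Subtype.ext (Sym2.map.injective Subtype.val_injective (h2.trans h.symm))
    rw [this]
  refine ⟨⟨vm, ?_, fun e => g (jj e) '' (Φ (jj e)).arc (ee e), ?_, ?_, ?_⟩, hvm, ?_⟩
  · intro a b h
    have h1 := (hg _ _ _ _ h).1
    rw [hvm (J a) ⟨a, (hJ a _).2 rfl⟩, hvm (J a) ⟨b, (hJ b _).2 h1.symm⟩] at h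
    have := (Φ (J a)).vmap_inj (hg _ _ _ _ h).2
    exact congrArg Subtype.val this
  · intro e
    obtain ⟨f, hf, hi, hr, u, v, huv, h0, h1⟩ := (Φ (jj e)).arc_path (ee e)
    refine ⟨fun t => g (jj e) (f t), (hgc _).comp hf, fun a b h => hi (hg _ _ _ _ h).2, ?_,
      u, v, ?_, ?_, ?_⟩
    · rw [← hr, ← Set.range_comp]; rfl
    · rw [← hee e, huv]; simp
    · rw [hvm, ← h0]
    · rw [hvm, ← h1]
  · rintro e e' hne x ⟨⟨p, hp, rfl⟩, ⟨p', hp', hpp⟩⟩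
    have hj := (hg _ _ _ _ hpp).1
    obtain rfl := (hg _ _ _ _ hpp).2
    have h1 := hee e
    have h2 := hee e'
    generalize ee e = e1 at *
    generalize ee e' = e2 at *
    generalize jj e = j1 at *
    generalize jj e' = j2 at *
    subst hj
    have hne' : e1 ≠ e2 := by
      rintro rfl
      exact hne (Subtype.ext (h1.symm.trans h2))
    obtain ⟨w, ⟨ha, hb⟩, rfl⟩ := (Φ _).arc_inter _ _ hne' ⟨hp, hp'⟩
    refine ⟨w, ⟨?_, ?_⟩, hvm _ _⟩
    · rw [← h1]; exact Sym2.mem_map.2 ⟨w, ha, rfl⟩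
    · rw [← h2]; exact Sym2.mem_map.2 ⟨w, hb, rfl⟩
  · rintro e x ⟨p, hp, hpx⟩
    obtain ⟨hj, rfl⟩ := hg _ _ _ _ hpx
    have hx : x ∈ S (jj e) := (hJ _ _).2 hj.symm
    have hpx' := hpx.trans (hvm (jj e) ⟨x, hx⟩)
    rw [(hg _ _ _ _ hpx').2] at hp
    rw [← hee e]
    exact Sym2.mem_map.2 ⟨_, (Φ _).vmap_mem_arc _ _ hp, rfl⟩
  · ext x
    simp only [drawing, mem_iUnion, Set.image_iUnion]
    constructor
    · rintro ⟨e, he⟩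
      exact ⟨jj e, ee e, he⟩
    · rintro ⟨j, e', he⟩
      refine ⟨⟨_, hE j e'⟩, ?_⟩
      rw [huniq j e' ⟨_, hE j e'⟩ rfl]
      exact he

end PlaneEmbedding

theorem exists_strips (l : ℕ) : ∃ g : Fin l → ℝ × ℝ → ℝ × ℝ, (∀ j, Continuous (g j)) ∧
    ∀ i j p q, g i p = g j q → i = j ∧ p = q := by
  refine ⟨fun j p => (Real.arctan p.1 + 4 * (j : ℕ), p.2), fun j => ?_, ?_⟩
  · exact ((Real.continuous_arctan.comp continuous_fst).add continuous_const).prodMk continuous_snd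
  · rintro i j ⟨a, b⟩ ⟨c, d⟩ h
    simp only [Prod.mk.injEq] at h
    obtain ⟨h1, rfl⟩ := h
    have ha := Real.arctan_lt_pi_div_two a
    have ha' := Real.neg_pi_div_two_lt_arctan a
    have hc := Real.arctan_lt_pi_div_two c
    have hc' := Real.neg_pi_div_two_lt_arctan c
    have hpi := Real.pi_lt_four
    have e1 : ((i : ℕ) : ℝ) < (j : ℕ) + 1 := by linarith
    have e2 : ((j : ℕ) : ℝ) < (i : ℕ) + 1 := by linarith
    norm_cast at e1 e2
    obtain rfl : i = j := Fin.ext (by omega)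
    refine ⟨rfl, ?_⟩
    rw [Real.arctan_injective (add_right_cancel h1)]

theorem satColl_of_satSeq {V : Type*} [Finite V] {G : SimpleGraph V} {q : ℕ}
    {M : Fin q → Set (Set V)} (h : SatSeq G M) (S : Set V)
    (hS : ∀ u v, G.Adj u v → u ∈ S → v ∈ S) :
    SatColl (G.induce S)
          (resFam S '' {Cf : Set (Set V) | ∃ h0 : Fin q, Cf = M h0 ∧ ∀ U ∈ M h0, U ⊆ S}) := by
  obtain ⟨Φ, hΦ⟩ := h
  obtain ⟨Ψ, hv, he⟩ := Φ.exists_restrict S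
  have hsub : Ψ.drawing ⊆ Φ.drawing := by
    intro x hx
    obtain ⟨e, hx⟩ := mem_iUnion.1 hx
    obtain ⟨h, h'⟩ := he e
    rw [h'] at hx
    exact mem_iUnion.2 ⟨_, hx⟩
  refine ⟨Ψ, ?_⟩
  rintro _ ⟨_, ⟨h0, rfl, hloc⟩, rfl⟩
  obtain ⟨F, hF, hFU⟩ := hΦ h0
  have hF' := hF
  obtain ⟨p, hp, rfl⟩ := hF'
  have hG : Ψ.IsFace (connectedComponentIn Ψ.drawingᶜ p) := ⟨p, fun h => hp (hsub h), rfl⟩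
  refine ⟨_, hG, ?_⟩
  rintro _ ⟨U, hU, rfl⟩
  obtain ⟨v, hvU, hvF⟩ := hFU U hU
  have hvS : v ∈ S := hloc U hU hvU
  refine ⟨⟨v, hvS⟩, hvU, ?_⟩
  rw [Φ.onFace_iff hF] at hvF
  rw [Ψ.onFace_iff hG, hv]
  refine ⟨closure_mono (connectedComponentIn_mono p (compl_subset_compl.2 hsub)) hvF.1, ?_⟩
  obtain ⟨⟨e, hG'⟩, hx⟩ := mem_iUnion.1 hvF.2
  have hve : v ∈ e := Φ.vmap_mem_arc _ _ hx
  obtain ⟨w, rfl⟩ := Sym2.mem_iff_exists.1 hve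
  have hvw : G.Adj v w := hG'
  have hwS := hS v w hvw hvS
  have hm : s((⟨v, hvS⟩ : S), ⟨w, hwS⟩) ∈ (G.induce S).edgeSet := by simpa using hvw
  refine mem_iUnion.2 ⟨⟨_, hm⟩, ?_⟩
  obtain ⟨h1, h2⟩ := he ⟨_, hm⟩
  rw [h2]
  exact hx

theorem satSeq_of_satColl {V : Type*} [Finite V] {G : SimpleGraph V} {q l : ℕ}
    {M : Fin q → Set (Set V)} (S : Fin l → Set V) (J : V → Fin l)
    (hJ : ∀ v j, v ∈ S j ↔ J v = j) (hadj : ∀ u v, G.Adj u v → J u = J v)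
    (hloc : ∀ h, ∃ j, ∀ U ∈ M h, U ⊆ S j)
    (h : ∀ j, SatColl (G.induce (S j)) (resFam (S j) ''
      {Cf : Set (Set V) | ∃ h0 : Fin q, Cf = M h0 ∧ ∀ U ∈ M h0, U ⊆ S j})) :
    SatSeq G M := by
  choose Φ hΦ using h
  obtain ⟨g, hgc, hg⟩ := exists_strips l
  obtain ⟨Ψ, hv, hd⟩ := PlaneEmbedding.exists_combine S J hJ hadj Φ g hgc hg
  refine ⟨Ψ, fun h0 => ?_⟩
  obtain ⟨j, hj⟩ := hloc h0
  obtain ⟨F, hF, hFU⟩ := hΦ j _ ⟨_, ⟨h0, rfl, hj⟩, rfl⟩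
  have hF' := hF
  obtain ⟨p, hp, hFp⟩ := hF'
  have himg : g j '' F ⊆ Ψ.drawingᶜ := by
    rintro _ ⟨x, hx, rfl⟩ hx'
    rw [hd] at hx'
    obtain ⟨i, y, hy, hxy⟩ := mem_iUnion.1 hx'
    obtain ⟨rfl, rfl⟩ := hg _ _ _ _ hxy
    rw [hFp] at hx
    exact connectedComponentIn_subset _ _ hx hy
  have hpF : p ∈ F := by rw [hFp]; exact mem_connectedComponentIn hp
  have hcon : IsPreconnected (g j '' F) := by
    rw [hFp]
    exact isPreconnected_connectedComponentIn.image _ (hgc j).continuousOn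
  have hsub := hcon.subset_connectedComponentIn (mem_image_of_mem (g j) hpF) himg
  have hG : Ψ.IsFace (connectedComponentIn Ψ.drawingᶜ (g j p)) :=
    ⟨_, himg (mem_image_of_mem (g j) hpF), rfl⟩
  refine ⟨_, hG, fun U hU => ?_⟩
  obtain ⟨v, hvU, hvF⟩ := hFU _ ⟨U, hU, rfl⟩
  refine ⟨v, hvU, ?_⟩
  rw [(Φ j).onFace_iff hF] at hvF
  rw [Ψ.onFace_iff hG, hv]
  exact ⟨closure_mono hsub (image_closure_subset_closure_image (hgc j) ⟨_, hvF.1, rfl⟩),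
    hd ▸ mem_iUnion.2 ⟨j, _, hvF.2, rfl⟩⟩

/-- let `G` be a finite simple planar graph with connected components `G_i`
(vertex sets `W i`), and let `M` be a sequence of families of vertex subsets, every set
inducing a connected subgraph.  Let `H` be the edge-labeled multigraph on `Fin k` consisting,
for each global family `h`, of a cycle (given by `cyc h`, injective with range
`{i : some set of M h is G_i-local}` and of length `nh h ≥ 2`) all of whose edges are labeled
`h`; let `comp j`, `j < ℓ`, be the connected components of `H`, and for each `j` let `G'_j` be
the union of the `G_i` with `i ∈ comp j` and `M'_j` the collection of `G'_j`-local families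
of `M`.  Then `G` satisfies `M` iff every `G'_j` satisfies `M'_j`. -/
theorem statement13 {V : Type} [Fintype V] (G : SimpleGraph V)
    (hplanar : Planar G)
    (k : ℕ) (W : Fin k → Set V)
    (hWc : ∀ i : Fin k, ∃ v : V, W i = {u : V | G.Reachable u v})
    (hWcov : ∀ v : V, ∃ i : Fin k, v ∈ W i)
    (hWinj : Function.Injective W)
    (q : ℕ) (M : Fin q → Set (Set V))
    (hMconn : ∀ j : Fin q, ∀ U ∈ M j, (G.induce U).Connected)
    (nh : Fin q → ℕ) (cyc : ∀ h : Fin q, ZMod (nh h) → Fin k)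
    (hcyc1 : ∀ h : Fin q, GGlobal W M h → Function.Injective (cyc h))
    (hcyc2 : ∀ h : Fin q, GGlobal W M h →
      Set.range (cyc h) = {i : Fin k | ∃ U ∈ M h, U ⊆ W i})
    (hcyc3 : ∀ h : Fin q, GGlobal W M h → 2 ≤ nh h)
    (l : ℕ) (comp : Fin l → Set (Fin k))
    (hcompc : ∀ j : Fin l, ∃ a : Fin k, comp j =
      {b : Fin k | Relation.ReflTransGen
        (fun x y : Fin k => ∃ e : HEdge (GGlobal W M) nh,
          hEnds (GGlobal W M) nh cyc e = s(x, y)) a b})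
    (hcompcov : ∀ a : Fin k, ∃ j : Fin l, a ∈ comp j)
    (hcompinj : Function.Injective comp) :
    SatSeq G M ↔
      ∀ j : Fin l,
        SatColl (G.induce (⋃ i ∈ comp j, W i))
          (resFam (⋃ i ∈ comp j, W i) ''
            {Cf : Set (Set V) |
              ∃ h0 : Fin q, Cf = M h0 ∧ ∀ U ∈ M h0, U ⊆ ⋃ i ∈ comp j, W i}) := by
  have hWeq : ∀ i v, v ∈ W i → W i = {u | G.Reachable u v} := by
    intro i v hv
    obtain ⟨w, hw⟩ := hWc i
    rw [hw] at hv ⊢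
    ext u
    exact ⟨fun h => h.trans hv.symm, fun h => h.trans hv⟩
  have hWuniq : ∀ i i' v, v ∈ W i → v ∈ W i' → i = i' := fun i i' v h h' =>
    hWinj ((hWeq i v h).trans (hWeq i' v h').symm)
  have hWadj : ∀ u v, G.Reachable u v → ∀ i, u ∈ W i → v ∈ W i := by
    intro u v h i hu
    rw [hWeq i u hu]
    exact h.symm
  have hclosed : ∀ (j : Fin l) (a b : Fin k), a ∈ comp j →
      (∃ e : HEdge (GGlobal W M) nh, hEnds (GGlobal W M) nh cyc e = s(a, b)) → b ∈ comp j := by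
    intro j a b ha hab
    obtain ⟨c, hc⟩ := hcompc j
    rw [hc] at ha ⊢
    exact Relation.ReflTransGen.tail ha hab
  have hcsub : ∀ j j' b, b ∈ comp j → b ∈ comp j' → comp j ⊆ comp j' := by
    intro j j' b hb hb'
    obtain ⟨c, hc⟩ := hcompc j
    have hcb := hb
    rw [hc] at hcb
    have hc' : c ∈ comp j' := by
      clear hb
      revert hb'
      induction hcb with
      | refl => exact id
      | tail _ hxy ih =>
        intro hy
        apply ih
        obtain ⟨e, he⟩ := hxy
        exact hclosed _ _ _ hy ⟨e, he.trans Sym2.eq_swap⟩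
    intro x hx
    rw [hc] at hx
    induction hx with
    | refl => exact hc'
    | tail _ hxy ih => exact hclosed _ _ _ ih hxy
  have hcuniq : ∀ j j' b, b ∈ comp j → b ∈ comp j' → j = j' := fun j j' b h h' =>
    hcompinj (Subset.antisymm (hcsub _ _ b h h') (hcsub _ _ b h' h))
  have hSreach : ∀ (j : Fin l) u v, G.Reachable u v → u ∈ (⋃ i ∈ comp j, W i) →
      v ∈ (⋃ i ∈ comp j, W i) := by
    intro j u v huv hu
    simp only [mem_iUnion] at hu ⊢
    obtain ⟨i, hi, hu⟩ := hu
    exact ⟨i, hi, hWadj u v huv i hu⟩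
  constructor
  · intro h j
    exact satColl_of_satSeq h _ fun u v huv => hSreach j u v huv.reachable
  · intro h
    choose I hI using hWcov
    choose K hK using hcompcov
    have hmem : ∀ v, v ∈ ⋃ i ∈ comp (K (I v)), W i := by
      intro v
      simp only [mem_iUnion]
      exact ⟨I v, hK _, hI v⟩
    have hJ : ∀ v j, (v ∈ ⋃ i ∈ comp j, W i) ↔ K (I v) = j := by
      intro v j
      constructor
      · intro hv
        simp only [mem_iUnion] at hv
        obtain ⟨i, hi, hv⟩ := hv
        obtain rfl := hWuniq _ _ v (hI v) hv
        exact hcuniq _ _ _ (hK _) hi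
      · rintro rfl
        exact hmem v
    refine satSeq_of_satColl (fun j => ⋃ i ∈ comp j, W i) (fun v => K (I v)) hJ ?_ ?_ h
    · intro u v huv
      exact ((hJ v _).1 (hSreach _ u v huv.reachable (hmem u))).symm
    · intro h0
      by_cases hg : GGlobal W M h0
      · have hall : ∀ n : ℕ, cyc h0 (n : ZMod (nh h0)) ∈ comp (K (cyc h0 0)) := by
          intro n
          induction n with
          | zero => simpa using hK (cyc h0 0)
          | succ n ih =>
            refine hclosed _ _ _ ih ⟨⟨⟨h0, hg⟩, (n : ZMod (nh h0))⟩, ?_⟩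
            simp [hEnds]
        refine ⟨K (cyc h0 0), fun U hU => ?_⟩
        have hconn := hMconn h0 U hU
        obtain ⟨u⟩ := hconn.nonempty
        have hUW : U ⊆ W (I u) := by
          intro w hw
          have := (hconn.preconnected u ⟨w, hw⟩).map (SimpleGraph.Embedding.induce U).toHom
          exact hWadj u w this _ (hI u)
        have hr : I u ∈ Set.range (cyc h0) := by
          rw [hcyc2 h0 hg]
          exact ⟨U, hU, hUW⟩
        obtain ⟨t, ht⟩ := hr
        have : NeZero (nh h0) := ⟨by have := hcyc3 h0 hg; omega⟩
        have h2 := hall t.val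
        rw [ZMod.natCast_zmod_val, ht] at h2
        intro w hw
        simp only [mem_iUnion]
        exact ⟨_, h2, hUW hw⟩
      · unfold GGlobal at hg
        push Not at hg
        obtain ⟨i, hi⟩ := hg
        refine ⟨K i, fun U hU w hw => ?_⟩
        simp only [mem_iUnion]
        exact ⟨i, hK i, hi U hU hw⟩
end

section
/- Let G be a finite simple planar graph with connected components G₁,…,G_k, and let ℳ be a sequence of families 𝒞₁,…,𝒞_q of vertex subsets of G in which every set induces a connected subgraph of G (so each set is G_i-local for some i). Let H be an edge-labeled multigraph on vertex set {1,…,k} constructed as follows: for each global family 𝒞_h of ℳ, H contains a cycle C, possibly of length 2, whose vertex set is exactly the set of i ∈ {1,…,k} such that some set in 𝒞_h is G_i-local, and all edges of C are labeled h. Assume H is connected. Let B₁,…,B_p be the blocks of H. For each B_j, let 𝒰_j = ∪_h 𝒞_h, where h ranges over all labels appearing on edges of B_j. For each i ∈ {1,…,k}, let ℳ_i be the sequence consisting of the G_i-local families in ℳ together with the families 𝒰_{j,i} = {U ∈ 𝒰_j : U is G_i-local} for all B_j with i ∈ V(B_j). Then G satisfies ℳ if and only if every G_i satisfies ℳ_i.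 -/
open Set Topology

/-! ### Planar topology -/

lemma rank_plane : 1 < Module.rank ℝ (ℝ × ℝ) := by
  rw [← Module.finrank_eq_rank, Module.finrank_prod, Module.finrank_self]
  norm_num

lemma annulus_preconn (p : ℝ × ℝ) (r r' : ℝ) (hr : 0 < r) :
    IsPreconnected {x : ℝ × ℝ | r < ‖x - p‖ ∧ ‖x - p‖ < r'} := by
  have h1 : IsPreconnected ((Ioo r r') ×ˢ (Metric.sphere (0 : ℝ × ℝ) 1)) :=
    isPreconnected_Ioo.prod (isPreconnected_sphere rank_plane 0 1)
  have h2 := h1.image (fun z : ℝ × (ℝ × ℝ) => p + z.1 • z.2) (by fun_prop)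
  convert h2 using 1
  ext x
  simp only [mem_ofPred_eq, mem_image, mem_prod, mem_Ioo, mem_sphere_iff_norm, sub_zero]
  constructor
  · rintro ⟨h, h'⟩
    have hpos : 0 < ‖x - p‖ := hr.trans h
    refine ⟨(‖x - p‖, ‖x - p‖⁻¹ • (x - p)), ⟨⟨h, h'⟩, ?_⟩, ?_⟩
    · rw [norm_smul, norm_inv, norm_norm, inv_mul_cancel₀ hpos.ne']
    · simp only [smul_smul]
      rw [mul_inv_cancel₀ hpos.ne', one_smul]
      abel
  · rintro ⟨⟨t, u⟩, ⟨⟨h, h'⟩, hu⟩, rfl⟩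
    simp only at h h' hu ⊢
    have : ‖p + t • u - p‖ = t := by
      rw [add_sub_cancel_left, norm_smul, hu, mul_one, Real.norm_of_nonneg (hr.trans h).le]
    rw [this]
    exact ⟨h, h'⟩

lemma diff_ball_preconn {F : Set (ℝ × ℝ)} (hF : IsOpen F) (hFc : IsPreconnected F)
    (p : ℝ × ℝ) (r : ℝ) (hr : 0 < r) (hsub : Metric.closedBall p (2 * r) ⊆ F) :
    IsPreconnected (F \ Metric.closedBall p r) := by
  have key : ∀ u v : Set (ℝ × ℝ), IsOpen u → IsOpen v →
      F \ Metric.closedBall p r ⊆ u ∪ v →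
      ((F \ Metric.closedBall p r) ∩ v).Nonempty →
      (F \ Metric.closedBall p r) ∩ (u ∩ v) = ∅ →
      {x : ℝ × ℝ | r < ‖x - p‖ ∧ ‖x - p‖ < 2 * r} ⊆ u → False := by
    intro u v hu hv hcov hvn hemp hN
    have hD : IsOpen (F \ Metric.closedBall p r) := hF.sdiff Metric.isClosed_closedBall
    have := hFc (((F \ Metric.closedBall p r) ∩ u) ∪ Metric.ball p (2 * r))
      ((F \ Metric.closedBall p r) ∩ v) ((hD.inter hu).union Metric.isOpen_ball) (hD.inter hv)
      (by
        intro x hx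
        by_cases hxb : x ∈ Metric.closedBall p r
        · left; right
          exact Metric.closedBall_subset_ball (by linarith) hxb
        · rcases hcov ⟨hx, hxb⟩ with h | h
          · left; left; exact ⟨⟨hx, hxb⟩, h⟩
          · right; exact ⟨⟨hx, hxb⟩, h⟩)
      ⟨p, hsub (Metric.mem_closedBall_self (by linarith)),
        Or.inr (Metric.mem_ball_self (by linarith))⟩
      (by
        obtain ⟨x, hx, hxv⟩ := hvn
        exact ⟨x, hx.1, hx, hxv⟩)
    obtain ⟨x, -, hx1, hx2, hxv⟩ := this
    have hxu : x ∈ u := by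
      rcases hx1 with h | h
      · exact h.2
      · apply hN
        refine ⟨?_, mem_ball_iff_norm.1 h⟩
        have := hx2.2
        rw [mem_closedBall_iff_norm] at this
        exact not_le.1 this
    have : x ∈ (F \ Metric.closedBall p r) ∩ (u ∩ v) := ⟨hx2, hxu, hxv⟩
    rw [hemp] at this
    exact this
  intro u v hu hv hcov hun hvn
  by_contra hne
  rw [not_nonempty_iff_eq_empty] at hne
  have hNsub : {x : ℝ × ℝ | r < ‖x - p‖ ∧ ‖x - p‖ < 2 * r} ⊆ F \ Metric.closedBall p r := by
    rintro x ⟨h1, h2⟩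
    refine ⟨hsub (mem_closedBall_iff_norm.2 h2.le), fun h => ?_⟩
    exact absurd (mem_closedBall_iff_norm.1 h) (not_le.2 h1)
  have hN := annulus_preconn p r (2 * r) hr
  rcases (isPreconnected_iff_subset_of_disjoint.1 hN) u v hu hv (hNsub.trans hcov)
    (by
      apply subset_eq_empty _ hne
      exact inter_subset_inter_left _ hNsub) with h | h
  · exact key u v hu hv hcov hvn hne h
  · exact key v u hv hu (by rwa [union_comm]) hun (by rwa [inter_comm v u]) h

/-- inversion exchanging the two points `p₂` and `p₁` with infinity. -/
noncomputable def invMap (p₁ p₂ : ℝ × ℝ) (r : ℝ) (x : ℝ × ℝ) : ℝ × ℝ :=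
  p₁ + (2 * r ^ 2 / ‖x - p₂‖ ^ 2) • (x - p₂)

lemma invMap_norm (p₁ p₂ : ℝ × ℝ) (r : ℝ) (x : ℝ × ℝ) (hx : x ≠ p₂) :
    ‖invMap p₁ p₂ r x - p₁‖ = 2 * r ^ 2 / ‖x - p₂‖ := by
  have h : 0 < ‖x - p₂‖ := norm_pos_iff.2 (sub_ne_zero.2 hx)
  rw [invMap, add_sub_cancel_left, norm_smul, Real.norm_of_nonneg (by positivity)]
  field_simp

lemma invMap_inv (p₁ p₂ : ℝ × ℝ) (r : ℝ) (hr : 0 < r) (x : ℝ × ℝ) (hx : x ≠ p₂) :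
    invMap p₂ p₁ r (invMap p₁ p₂ r x) = x := by
  have h : 0 < ‖x - p₂‖ := norm_pos_iff.2 (sub_ne_zero.2 hx)
  have h1 := invMap_norm p₁ p₂ r x hx
  rw [invMap, h1]
  nth_rewrite 1 [invMap]
  rw [add_sub_cancel_left, smul_smul]
  have : 2 * r ^ 2 / (2 * r ^ 2 / ‖x - p₂‖) ^ 2 * (2 * r ^ 2 / ‖x - p₂‖ ^ 2) = 1 := by
    field_simp
  rw [this, one_smul]
  abel

lemma invMap_injOn (p₁ p₂ : ℝ × ℝ) (r : ℝ) (hr : 0 < r) :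
    InjOn (invMap p₁ p₂ r) {p₂}ᶜ := by
  intro x hx y hy h
  rw [← invMap_inv p₁ p₂ r hr x hx, ← invMap_inv p₁ p₂ r hr y hy, h]

lemma invMap_contAt (p₁ p₂ : ℝ × ℝ) (r : ℝ) (x : ℝ × ℝ) (hx : x ≠ p₂) :
    ContinuousAt (invMap p₁ p₂ r) x := by
  have h : ‖x - p₂‖ ^ 2 ≠ 0 := by
    have := norm_ne_zero_iff.2 (sub_ne_zero.2 hx)
    positivity
  unfold invMap
  fun_prop (disch := exact h)

lemma exists_ball_avoid {F : Set (ℝ × ℝ)} (hF : IsOpen F) (hne : F.Nonempty)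
    {T : Set (ℝ × ℝ)} (hT : T.Finite) :
    ∃ p : ℝ × ℝ, ∃ r > 0, Metric.closedBall p (2 * r) ⊆ F \ T := by
  have hTo : IsOpen (F \ T) := hF.sdiff hT.isClosed
  have hn : (F \ T).Nonempty := by
    obtain ⟨x, hx⟩ := hne
    have hinf : F.Infinite := infinite_of_mem_nhds x (hF.mem_nhds hx)
    exact (hinf.sdiff hT).nonempty
  obtain ⟨p, hp⟩ := hn
  obtain ⟨ε, hε, hsub⟩ := Metric.isOpen_iff.1 hTo p hp
  refine ⟨p, ε / 4, by positivity, subset_trans ?_ hsub⟩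
  exact Metric.closedBall_subset_ball (by linarith)

/-! ### Embeddings of the part of a graph on a vertex subset -/

/-- Edges of `G` with both ends in `X`. -/
def ES {V : Type*} (G : SimpleGraph V) (X : Set V) : Set (Sym2 V) :=
  {e | e ∈ G.edgeSet ∧ ∀ x ∈ e, x ∈ X}

/-- Plane embedding of the subgraph of `G` induced by `X`, without dependent types. -/
structure PE {V : Type*} (G : SimpleGraph V) (X : Set V) where
  vmap : V → ℝ × ℝ
  inj : InjOn vmap X
  arc : Sym2 V → Set (ℝ × ℝ)
  arc_path : ∀ e ∈ ES G X, ∃ f : unitInterval → ℝ × ℝ,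
    Continuous f ∧ Function.Injective f ∧ Set.range f = arc e ∧
    ∃ u v : V, e = s(u, v) ∧ f 0 = vmap u ∧ f 1 = vmap v
  arc_inter : ∀ e ∈ ES G X, ∀ e' ∈ ES G X, e ≠ e' →
    arc e ∩ arc e' ⊆ vmap '' {x : V | x ∈ e ∧ x ∈ e'}
  vmap_mem_arc : ∀ e ∈ ES G X, ∀ x ∈ X, vmap x ∈ arc e → x ∈ e

namespace PE

variable {V : Type*} {G : SimpleGraph V} {X : Set V}

def K (Φ : PE G X) : Set (ℝ × ℝ) := ⋃ e ∈ ES G X, Φ.arc e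

def IsFace (Φ : PE G X) (F : Set (ℝ × ℝ)) : Prop :=
  ∃ p ∈ Φ.Kᶜ, F = connectedComponentIn Φ.Kᶜ p

def On (Φ : PE G X) (F : Set (ℝ × ℝ)) (v : V) : Prop :=
  Φ.vmap v ∈ Φ.K ∧ Φ.vmap v ∈ closure F

lemma isClosed_K [Finite V] (Φ : PE G X) : IsClosed Φ.K := by
  have hfin : (ES G X).Finite := by
    have : Finite (Sym2 V) := by unfold Sym2; infer_instance
    exact toFinite _
  apply hfin.isClosed_biUnion
  intro e he
  obtain ⟨f, hf, -, hr, -⟩ := Φ.arc_path e he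
  rw [← hr]
  exact (isCompact_range hf).isClosed

lemma IsFace.isOpen [Finite V] {Φ : PE G X} {F : Set (ℝ × ℝ)} (h : Φ.IsFace F) : IsOpen F := by
  obtain ⟨p, hp, rfl⟩ := h
  exact Φ.isClosed_K.isOpen_compl.connectedComponentIn

lemma IsFace.preconn {Φ : PE G X} {F : Set (ℝ × ℝ)} (h : Φ.IsFace F) : IsPreconnected F := by
  obtain ⟨p, hp, rfl⟩ := h
  exact isPreconnected_connectedComponentIn

lemma IsFace.sub {Φ : PE G X} {F : Set (ℝ × ℝ)} (h : Φ.IsFace F) : F ⊆ Φ.Kᶜ := by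
  obtain ⟨p, hp, rfl⟩ := h
  exact connectedComponentIn_subset _ _

lemma IsFace.nonempty {Φ : PE G X} {F : Set (ℝ × ℝ)} (h : Φ.IsFace F) : F.Nonempty := by
  obtain ⟨p, hp, rfl⟩ := h
  exact ⟨p, mem_connectedComponentIn hp⟩

lemma IsFace.eq_or_disj {Φ : PE G X} {F F' : Set (ℝ × ℝ)} (h : Φ.IsFace F) (h' : Φ.IsFace F') :
    F = F' ∨ Disjoint F F' := by
  obtain ⟨p, hp, rfl⟩ := h
  obtain ⟨p', hp', rfl⟩ := h'
  by_cases hd : Disjoint (connectedComponentIn Φ.Kᶜ p) (connectedComponentIn Φ.Kᶜ p')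
  · exact Or.inr hd
  · left
    obtain ⟨x, hx, hx'⟩ := not_disjoint_iff.1 hd
    rw [connectedComponentIn_eq hx, connectedComponentIn_eq hx']

lemma exists_face (Φ : PE G X) (T : Set (ℝ × ℝ)) (hT : IsPreconnected T) (hne : T.Nonempty)
    (hsub : T ⊆ Φ.Kᶜ) : ∃ F, Φ.IsFace F ∧ T ⊆ F := by
  obtain ⟨p, hp⟩ := hne
  exact ⟨_, ⟨p, hsub hp, rfl⟩, hT.subset_connectedComponentIn hp hsub⟩

end PE

lemma ES_nonempty {V : Type*} (e : Sym2 V) : ∃ x, x ∈ e := by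
  induction e with
  | _ a b => exact ⟨a, Sym2.mem_mk_left a b⟩

lemma ES_union {V : Type*} (G : SimpleGraph V) (X₁ X₂ : Set V)
    (hno : ∀ u ∈ X₁, ∀ v ∈ X₂, ¬ G.Adj u v) :
    ES G (X₁ ∪ X₂) = ES G X₁ ∪ ES G X₂ := by
  ext e
  induction e with
  | _ a b =>
    simp only [ES, mem_union, mem_ofPred_eq, SimpleGraph.mem_edgeSet, Sym2.mem_iff]
    constructor
    · rintro ⟨h, h'⟩
      have ha := h' a (Or.inl rfl)
      have hb := h' b (Or.inr rfl)
      have h1 := hno a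
      have h2 := hno b
      have h3 := h.symm
      rcases ha with ha | ha <;> rcases hb with hb | hb
      · left; refine ⟨h, ?_⟩; rintro x (rfl | rfl) <;> assumption
      · exact absurd h (h1 ha b hb)
      · exact absurd h3 (h2 hb a ha)
      · right; refine ⟨h, ?_⟩; rintro x (rfl | rfl) <;> assumption
    · rintro (⟨h, h'⟩ | ⟨h, h'⟩)
      · exact ⟨h, fun x hx => Or.inl (h' x hx)⟩
      · exact ⟨h, fun x hx => Or.inr (h' x hx)⟩

open Classical in
/-- The merged embedding: `Φ₂` is inverted around `p₂` and put close to `p₁`. -/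
noncomputable def mergePE {V : Type*} {G : SimpleGraph V} {X₁ X₂ : Set V}
    (hdis : Disjoint X₁ X₂)
    (hno : ∀ u ∈ X₁, ∀ v ∈ X₂, ¬ G.Adj u v) (Φ₁ : PE G X₁) (Φ₂ : PE G X₂)
    (p₁ p₂ : ℝ × ℝ) (r : ℝ) (hr : 0 < r)
    (h₁K : ∀ x ∈ Φ₁.K, 2 * r < ‖x - p₁‖) (h₁v : ∀ v ∈ X₁, 2 * r < ‖Φ₁.vmap v - p₁‖)
    (h₂K : ∀ x ∈ Φ₂.K, 2 * r < ‖x - p₂‖) (h₂v : ∀ v ∈ X₂, 2 * r < ‖Φ₂.vmap v - p₂‖) :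
    PE G (X₁ ∪ X₂) := by
  have hφ : ∀ x, 2 * r < ‖x - p₂‖ → x ≠ p₂ ∧ ‖invMap p₁ p₂ r x - p₁‖ < r := by
    intro x hx
    have hne : x ≠ p₂ := by
      rintro rfl
      rw [sub_self, norm_zero] at hx
      linarith
    refine ⟨hne, ?_⟩
    rw [invMap_norm _ _ _ _ hne, div_lt_iff₀ (by linarith)]
    nlinarith
  have hsplit : ∀ e ∈ ES G (X₁ ∪ X₂), e ∈ ES G X₁ ∨ (e ∉ ES G X₁ ∧ e ∈ ES G X₂) := by
    intro e he
    rw [ES_union G X₁ X₂ hno] at he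
    by_cases h : e ∈ ES G X₁
    · exact Or.inl h
    · exact Or.inr ⟨h, he.resolve_left h⟩
  have hd : ∀ v ∈ X₂, v ∉ X₁ := fun v h2 h1 => disjoint_left.1 hdis h1 h2
  have hA₁ : ∀ e ∈ ES G X₁, ∀ x ∈ Φ₁.arc e, 2 * r < ‖x - p₁‖ := fun e he x hx =>
    h₁K x (mem_biUnion he hx)
  have hA₂ : ∀ e ∈ ES G X₂, ∀ x ∈ Φ₂.arc e, 2 * r < ‖x - p₂‖ := fun e he x hx =>
    h₂K x (mem_biUnion he hx)
  refine
    { vmap := fun v => if v ∈ X₁ then Φ₁.vmap v else invMap p₁ p₂ r (Φ₂.vmap v)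
      arc := fun e => if e ∈ ES G X₁ then Φ₁.arc e else invMap p₁ p₂ r '' Φ₂.arc e
      inj := ?_
      arc_path := ?_
      arc_inter := ?_
      vmap_mem_arc := ?_ }
  · have aux : ∀ u ∈ X₁, ∀ v ∈ X₂, Φ₁.vmap u ≠ invMap p₁ p₂ r (Φ₂.vmap v) := by
      intro u hu v hv h
      have h1 := h₁v u hu
      have h2 := (hφ _ (h₂v v hv)).2
      rw [h] at h1
      linarith
    rintro u (hu | hu) v (hv | hv) h
    · simp only [hu, hv, if_true] at h
      exact Φ₁.inj hu hv h
    · simp only [hu, hd v hv, if_true, if_false] at h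
      exact absurd h (aux u hu v hv)
    · simp only [hv, hd u hu, if_true, if_false] at h
      exact absurd h.symm (aux v hv u hu)
    · simp only [hd v hv, hd u hu, if_false] at h
      exact Φ₂.inj hu hv (invMap_injOn p₁ p₂ r hr (hφ _ (h₂v u hu)).1 (hφ _ (h₂v v hv)).1 h)
  · intro e he
    rcases hsplit e he with h1 | ⟨h1, h2⟩
    · obtain ⟨f, hf, hinj, hra, u, v, rfl, hu, hv⟩ := Φ₁.arc_path e h1
      refine ⟨f, hf, hinj, ?_, u, v, rfl, ?_, ?_⟩
      · rw [if_pos h1]; exact hra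
      · rw [if_pos (h1.2 u (Sym2.mem_mk_left u v))]; exact hu
      · rw [if_pos (h1.2 v (Sym2.mem_mk_right u v))]; exact hv
    · obtain ⟨f, hf, hinj, hra, u, v, rfl, hu, hv⟩ := Φ₂.arc_path e h2
      have hfa : ∀ t, f t ∈ Φ₂.arc s(u, v) := fun t => by rw [← hra]; exact mem_range_self t
      have hfn : ∀ t, f t ≠ p₂ := fun t => (hφ _ (hA₂ _ h2 _ (hfa t))).1
      refine ⟨invMap p₁ p₂ r ∘ f, ?_, ?_, ?_, u, v, rfl, ?_, ?_⟩
      · rw [continuous_iff_continuousAt]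
        intro t
        exact (invMap_contAt p₁ p₂ r _ (hfn t)).comp hf.continuousAt
      · intro s t hst
        exact hinj (invMap_injOn p₁ p₂ r hr (hfn s) (hfn t) hst)
      · rw [if_neg h1, range_comp, hra]
      · rw [if_neg (hd _ (h2.2 u (Sym2.mem_mk_left u v)))]
        simp [hu]
      · rw [if_neg (hd _ (h2.2 v (Sym2.mem_mk_right u v)))]
        simp [hv]
  · have aux : ∀ e ∈ ES G X₁, ∀ e' ∈ ES G X₂, ∀ x, x ∈ Φ₁.arc e →
        x ∈ invMap p₁ p₂ r '' Φ₂.arc e' → False := by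
      rintro e he e' he' x hx ⟨y, hy, rfl⟩
      have h1 := hA₁ e he _ hx
      have h2 := (hφ _ (hA₂ e' he' y hy)).2
      linarith
    intro e he e' he' hne
    rcases hsplit e he with h1 | ⟨h1, h2⟩ <;> rcases hsplit e' he' with h1' | ⟨h1', h2'⟩
    · simp only [h1, h1', if_true]
      intro x hx
      obtain ⟨v, hv, rfl⟩ := Φ₁.arc_inter e h1 e' h1' hne hx
      exact ⟨v, hv, if_pos (h1.2 v hv.1)⟩
    · simp only [h1, h1', if_true, if_false]
      rintro x ⟨hx, hx'⟩
      exact (aux e h1 e' h2' x hx hx').elim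
    · simp only [h1, h1', if_true, if_false]
      rintro x ⟨hx, hx'⟩
      exact (aux e' h1' e h2 x hx' hx).elim
    · simp only [h1, h1', if_false]
      rintro x ⟨⟨y, hy, rfl⟩, ⟨z, hz, hzy⟩⟩
      have : z = y := invMap_injOn p₁ p₂ r hr (hφ _ (hA₂ _ h2' z hz)).1
        (hφ _ (hA₂ _ h2 y hy)).1 hzy
      subst this
      obtain ⟨v, hv, rfl⟩ := Φ₂.arc_inter e h2 e' h2' hne ⟨hy, hz⟩
      exact ⟨v, hv, if_neg (hd _ (h2.2 v hv.1))⟩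
  · intro e he x hx
    rcases hsplit e he with h1 | ⟨h1, h2⟩ <;> rcases hx with hx | hx
    · simp only [h1, hx, if_true]
      exact Φ₁.vmap_mem_arc e h1 x hx
    · simp only [h1, hd x hx, if_true, if_false]
      intro h
      have h1 := hA₁ e h1 _ h
      have h2 := (hφ _ (h₂v x hx)).2
      linarith
    · simp only [h1, hx, if_true, if_false]
      rintro ⟨y, hy, hyx⟩
      have h3 := (hφ _ (hA₂ e h2 y hy)).2
      have h4 := h₁v x hx
      rw [hyx] at h3
      linarith
    · simp only [h1, hd x hx, if_false]
      rintro ⟨y, hy, hyx⟩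
      have : y = Φ₂.vmap x := invMap_injOn p₁ p₂ r hr (hφ _ (hA₂ _ h2 y hy)).1
        (hφ _ (h₂v x hx)).1 hyx
      subst this
      exact Φ₂.vmap_mem_arc e h2 x hx hy

/-- Gluing two embeddings along a face of each. -/
lemma merge_lemma {V : Type*} [Finite V] {G : SimpleGraph V} {X₁ X₂ : Set V}
    (hdis : Disjoint X₁ X₂)
    (hno : ∀ u ∈ X₁, ∀ v ∈ X₂, ¬ G.Adj u v) (Φ₁ : PE G X₁) (Φ₂ : PE G X₂)
    (F₁ F₂ : Set (ℝ × ℝ)) (hF₁ : Φ₁.IsFace F₁) (hF₂ : Φ₂.IsFace F₂) :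
    ∃ Φ : PE G (X₁ ∪ X₂), ∃ α₁ α₂ : Set (ℝ × ℝ) → Set (ℝ × ℝ),
      (∀ A, Φ₁.IsFace A → Φ.IsFace (α₁ A) ∧ ∀ v ∈ X₁, Φ₁.On A v → Φ.On (α₁ A) v) ∧
      (∀ A, Φ₂.IsFace A → Φ.IsFace (α₂ A) ∧ ∀ v ∈ X₂, Φ₂.On A v → Φ.On (α₂ A) v) ∧
      α₁ F₁ = α₂ F₂ := by
  classical
  obtain ⟨p₁, r₁, hr₁, hb₁⟩ := exists_ball_avoid hF₁.isOpen hF₁.nonempty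
    (toFinite (Φ₁.vmap '' X₁))
  obtain ⟨p₂, r₂, hr₂, hb₂⟩ := exists_ball_avoid hF₂.isOpen hF₂.nonempty
    (toFinite (Φ₂.vmap '' X₂))
  obtain ⟨r, hr, hrr₁, hrr₂⟩ : ∃ r > 0, r ≤ r₁ ∧ r ≤ r₂ :=
    ⟨min r₁ r₂, lt_min hr₁ hr₂, min_le_left _ _, min_le_right _ _⟩
  replace hb₁ := (Metric.closedBall_subset_closedBall (x := p₁)
    (show 2 * r ≤ 2 * r₁ by linarith)).trans hb₁
  replace hb₂ := (Metric.closedBall_subset_closedBall (x := p₂)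
    (show 2 * r ≤ 2 * r₂ by linarith)).trans hb₂
  clear hrr₁ hrr₂ hr₁ hr₂ r₁ r₂
  have h₁K : ∀ x ∈ Φ₁.K, 2 * r < ‖x - p₁‖ := by
    intro x hx
    by_contra h
    exact hF₁.sub (hb₁ (mem_closedBall_iff_norm.2 (not_lt.1 h))).1 hx
  have h₂K : ∀ x ∈ Φ₂.K, 2 * r < ‖x - p₂‖ := by
    intro x hx
    by_contra h
    exact hF₂.sub (hb₂ (mem_closedBall_iff_norm.2 (not_lt.1 h))).1 hx
  have h₁v : ∀ v ∈ X₁, 2 * r < ‖Φ₁.vmap v - p₁‖ := by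
    intro x hx
    by_contra h
    exact (hb₁ (mem_closedBall_iff_norm.2 (not_lt.1 h))).2 (mem_image_of_mem _ hx)
  have h₂v : ∀ v ∈ X₂, 2 * r < ‖Φ₂.vmap v - p₂‖ := by
    intro x hx
    by_contra h
    exact (hb₂ (mem_closedBall_iff_norm.2 (not_lt.1 h))).2 (mem_image_of_mem _ hx)
  have hφ : ∀ x, 2 * r < ‖x - p₂‖ → x ≠ p₂ ∧ ‖invMap p₁ p₂ r x - p₁‖ < r := by
    intro x hx
    have hne : x ≠ p₂ := by
      rintro rfl
      rw [sub_self, norm_zero] at hx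
      linarith
    refine ⟨hne, ?_⟩
    rw [invMap_norm _ _ _ _ hne, div_lt_iff₀ (by linarith)]
    nlinarith
  have hφ' : ∀ x, r < ‖x - p₂‖ → x ≠ p₂ ∧ ‖invMap p₁ p₂ r x - p₁‖ < 2 * r := by
    intro x hx
    have hne : x ≠ p₂ := by
      rintro rfl
      rw [sub_self, norm_zero] at hx
      linarith
    refine ⟨hne, ?_⟩
    rw [invMap_norm _ _ _ _ hne, div_lt_iff₀ (by linarith)]
    nlinarith
  have hd : ∀ v ∈ X₂, v ∉ X₁ := fun v h2 h1 => disjoint_left.1 hdis h1 h2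
  have hES : ∀ e ∈ ES G X₂, e ∉ ES G X₁ := by
    intro e h2 h1
    obtain ⟨x, hx⟩ := ES_nonempty e
    exact hd x (h2.2 x hx) (h1.2 x hx)
  let Φ := mergePE hdis hno Φ₁ Φ₂ p₁ p₂ r hr h₁K h₁v h₂K h₂v
  have hv1 : ∀ v ∈ X₁, Φ.vmap v = Φ₁.vmap v := fun v hv => if_pos hv
  have hv2 : ∀ v ∈ X₂, Φ.vmap v = invMap p₁ p₂ r (Φ₂.vmap v) := fun v hv => if_neg (hd v hv)
  have hK : Φ.K = Φ₁.K ∪ invMap p₁ p₂ r '' Φ₂.K := by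
    unfold PE.K
    rw [ES_union G X₁ X₂ hno, biUnion_union, image_iUnion₂]
    congr 1
    · exact iUnion₂_congr fun e he => if_pos he
    · exact iUnion₂_congr fun e he => if_neg (hES e he)
  -- the glued face
  set D₁ := Metric.closedBall p₁ r with hD₁
  set D₂ := Metric.closedBall p₂ r with hD₂
  have hc1 : IsPreconnected (F₁ \ D₁) := diff_ball_preconn hF₁.isOpen hF₁.preconn p₁ r hr
    (hb₁.trans sdiff_subset)
  have hc2 : IsPreconnected (F₂ \ D₂) := diff_ball_preconn hF₂.isOpen hF₂.preconn p₂ r hr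
    (hb₂.trans sdiff_subset)
  have hnD : ∀ x, x ∉ D₂ → r < ‖x - p₂‖ := fun x hx => by
    rw [hD₂, mem_closedBall_iff_norm] at hx
    exact not_le.1 hx
  have hc2' : IsPreconnected (invMap p₁ p₂ r '' (F₂ \ D₂)) := by
    apply hc2.image
    intro x hx
    exact (invMap_contAt p₁ p₂ r x (hφ' x (hnD x hx.2)).1).continuousWithinAt
  obtain ⟨w, hw⟩ : ∃ w : ℝ × ℝ, ‖w‖ = 1 := ⟨(1, 0), by simp⟩
  have hmeet : ((F₁ \ D₁) ∩ (invMap p₁ p₂ r '' (F₂ \ D₂))).Nonempty := by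
    have hn : ∀ (p : ℝ × ℝ) (c : ℝ), 0 ≤ c → ‖(p + c • w) - p‖ = c := by
      intro p c hc
      rw [add_sub_cancel_left, norm_smul, hw, mul_one, Real.norm_of_nonneg hc]
    have hx := hn p₂ (4 / 3 * r) (by positivity)
    have hy : ‖invMap p₁ p₂ r (p₂ + (4 / 3 * r) • w) - p₁‖ = 3 / 2 * r := by
      rw [invMap_norm, hx]
      · field_simp; norm_num
      · intro h
        rw [h, sub_self, norm_zero] at hx
        linarith
    refine ⟨invMap p₁ p₂ r (p₂ + (4 / 3 * r) • w), ⟨?_, ?_⟩, mem_image_of_mem _ ⟨?_, ?_⟩⟩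
    · apply (hb₁ _).1
      rw [mem_closedBall_iff_norm, hy]; linarith
    · rw [hD₁, mem_closedBall_iff_norm, hy]; linarith
    · apply (hb₂ _).1
      rw [mem_closedBall_iff_norm, hx]; linarith
    · rw [hD₂, mem_closedBall_iff_norm, hx]; linarith
  have hcS : IsPreconnected ((F₁ \ D₁) ∪ (invMap p₁ p₂ r '' (F₂ \ D₂))) := by
    obtain ⟨x, hx1, hx2⟩ := hmeet
    exact IsPreconnected.union x hx1 hx2 hc1 hc2'
  have hSK : ((F₁ \ D₁) ∪ (invMap p₁ p₂ r '' (F₂ \ D₂))) ⊆ Φ.Kᶜ := by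
    rw [hK]
    rintro x (⟨hx, hxD⟩ | ⟨y, ⟨hy, hyD⟩, rfl⟩) (h | h)
    · exact hF₁.sub hx h
    · obtain ⟨z, hz, rfl⟩ := h
      apply hxD
      rw [hD₁, mem_closedBall_iff_norm]
      exact (hφ z (h₂K z hz)).2.le
    · have h1 := (hφ' y (hnD y hyD)).2
      have h2 := h₁K _ h
      linarith
    · obtain ⟨z, hz, hzy⟩ := h
      have : z = y := invMap_injOn p₁ p₂ r hr (hφ z (h₂K z hz)).1 (hφ' y (hnD y hyD)).1 hzy
      subst this
      exact hF₂.sub hy hz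
  obtain ⟨F, hF, hSF⟩ := Φ.exists_face _ hcS (hmeet.mono (fun x hx => Or.inl hx.1)) hSK
  have hF1F : F₁ \ D₁ ⊆ F := subset_union_left.trans hSF
  have hF2F : invMap p₁ p₂ r '' (F₂ \ D₂) ⊆ F := subset_union_right.trans hSF
  have hclimg : ∀ (A : Set (ℝ × ℝ)) x, x ≠ p₂ → x ∈ closure A →
      invMap p₁ p₂ r x ∈ closure (invMap p₁ p₂ r '' A) := fun A x hx hxA =>
    mem_closure_image (invMap_contAt p₁ p₂ r x hx) hxA
  have hf1 : ∀ A, Φ₁.IsFace A → ∃ B, Φ.IsFace B ∧ (∀ v ∈ X₁, Φ₁.On A v → Φ.On B v) ∧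
      (A = F₁ → B = F) := by
    intro A hA
    by_cases hAF : A = F₁
    · subst hAF
      refine ⟨F, hF, ?_, fun _ => rfl⟩
      rintro v hv ⟨hvK, hvA⟩
      rw [PE.On, hv1 v hv, hK]
      refine ⟨Or.inl hvK, closure_mono hF1F ?_⟩
      have : Φ₁.vmap v ∈ D₁ᶜ ∩ closure A := by
        refine ⟨?_, hvA⟩
        rw [hD₁, mem_compl_iff, mem_closedBall_iff_norm]
        linarith [h₁v v hv]
      have := Metric.isClosed_closedBall.isOpen_compl.inter_closure this
      rwa [inter_comm, ← Set.sdiff_eq] at this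
    · have hdj := (hA.eq_or_disj hF₁).resolve_left hAF
      obtain ⟨B, hB, hAB⟩ := Φ.exists_face A hA.preconn hA.nonempty (by
        rw [hK]
        rintro x hx (h | ⟨z, hz, rfl⟩)
        · exact hA.sub hx h
        · refine disjoint_left.1 hdj hx (hb₁ ?_).1
          rw [mem_closedBall_iff_norm]
          linarith [(hφ z (h₂K z hz)).2])
      refine ⟨B, hB, ?_, fun h => absurd h hAF⟩
      rintro v hv ⟨hvK, hvA⟩
      rw [PE.On, hv1 v hv, hK]
      exact ⟨Or.inl hvK, closure_mono hAB hvA⟩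
  have hf2 : ∀ A, Φ₂.IsFace A → ∃ B, Φ.IsFace B ∧ (∀ v ∈ X₂, Φ₂.On A v → Φ.On B v) ∧
      (A = F₂ → B = F) := by
    intro A hA
    by_cases hAF : A = F₂
    · subst hAF
      refine ⟨F, hF, ?_, fun _ => rfl⟩
      rintro v hv ⟨hvK, hvA⟩
      rw [PE.On, hv2 v hv, hK]
      refine ⟨Or.inr (mem_image_of_mem _ hvK), closure_mono hF2F ?_⟩
      apply hclimg _ _ (hφ _ (h₂v v hv)).1
      have : Φ₂.vmap v ∈ D₂ᶜ ∩ closure A := by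
        refine ⟨?_, hvA⟩
        rw [hD₂, mem_compl_iff, mem_closedBall_iff_norm]
        linarith [h₂v v hv]
      have := Metric.isClosed_closedBall.isOpen_compl.inter_closure this
      rwa [inter_comm, ← Set.sdiff_eq] at this
    · have hdj := (hA.eq_or_disj hF₂).resolve_left hAF
      have hout : ∀ x ∈ A, 2 * r < ‖x - p₂‖ := by
        intro x hx
        by_contra h
        exact disjoint_left.1 hdj hx (hb₂ (mem_closedBall_iff_norm.2 (not_lt.1 h))).1
      obtain ⟨B, hB, hAB⟩ := Φ.exists_face (invMap p₁ p₂ r '' A)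
        (hA.preconn.image _ fun x hx =>
          (invMap_contAt p₁ p₂ r x (hφ x (hout x hx)).1).continuousWithinAt)
        (hA.nonempty.image _) (by
        rw [hK]
        rintro _ ⟨x, hx, rfl⟩ (h | ⟨z, hz, hzx⟩)
        · have h1 := h₁K _ h
          have h2 := (hφ x (hout x hx)).2
          linarith
        · have : z = x := invMap_injOn p₁ p₂ r hr (hφ z (h₂K z hz)).1
            (hφ x (hout x hx)).1 hzx
          subst this
          exact hA.sub hx hz)
      refine ⟨B, hB, ?_, fun h => absurd h hAF⟩
      rintro v hv ⟨hvK, hvA⟩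
      rw [PE.On, hv2 v hv, hK]
      exact ⟨Or.inr (mem_image_of_mem _ hvK),
        closure_mono hAB (hclimg _ _ (hφ _ (h₂v v hv)).1 hvA)⟩
  choose! α₁ ha1 ha2 ha3 using hf1
  choose! α₂ hb1 hb2 hb3 using hf2
  exact ⟨Φ, α₁, α₂, fun A hA => ⟨ha1 A hA, ha2 A hA⟩, fun A hA => ⟨hb1 A hA, hb2 A hA⟩,
    (ha3 F₁ hF₁ rfl).trans (hb3 F₂ hF₂ rfl).symm⟩

/-! ### Comparison with plane embeddings -/

lemma frontier_comp_notMem {U : Set (ℝ × ℝ)} (hU : IsOpen U) {p x : ℝ × ℝ}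
    (hx : x ∈ frontier (connectedComponentIn U p)) : x ∉ U := by
  intro hxU
  have ho : IsOpen (connectedComponentIn U x) := hU.connectedComponentIn
  have hxm := mem_connectedComponentIn hxU
  obtain ⟨y, hy, hy'⟩ := mem_closure_iff.1 hx.1 _ ho hxm
  have : connectedComponentIn U p = connectedComponentIn U x := by
    rw [connectedComponentIn_eq hy', connectedComponentIn_eq hy]
  rw [this, ho.frontier_eq] at hx
  exact hx.2 hxm

lemma PlaneEmbedding.isCompact_drawing {V : Type*} [Finite V] {G : SimpleGraph V}
    (Φ : PlaneEmbedding G) : IsCompact Φ.drawing := by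
  have : Finite (Sym2 V) := by unfold Sym2; infer_instance
  apply isCompact_iUnion
  intro e
  obtain ⟨f, hf, -, hr, -⟩ := Φ.arc_path e
  rw [← hr]
  exact isCompact_range hf

lemma PlaneEmbedding.onFace_iff_s14 {V : Type*} [Finite V] {G : SimpleGraph V}
    (Φ : PlaneEmbedding G) {F : Set (ℝ × ℝ)} (hF : Φ.IsFace F) (v : V) :
    Φ.OnFace F v ↔ Φ.vmap v ∈ Φ.drawing ∧ Φ.vmap v ∈ closure F := by
  obtain ⟨p, hp, rfl⟩ := hF
  constructor
  · intro h
    exact ⟨not_not.1 (frontier_comp_notMem Φ.isCompact_drawing.isClosed.isOpen_compl h), h.1⟩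
  · rintro ⟨h1, h2⟩
    exact ⟨h2, fun h => connectedComponentIn_subset _ _ (interior_subset h) h1⟩

lemma PlaneEmbedding.exists_isFace {V : Type*} [Finite V] {G : SimpleGraph V}
    (Φ : PlaneEmbedding G) : ∃ F, Φ.IsFace F := by
  have : Φ.drawing ≠ univ := fun h => noncompact_univ (ℝ × ℝ) (h ▸ Φ.isCompact_drawing)
  obtain ⟨p, hp⟩ := (ne_univ_iff_exists_notMem _).1 this
  exact ⟨_, p, hp, rfl⟩

open Classical in
lemma exists_toPE {V : Type*} [Finite V] {G : SimpleGraph V} {X : Set V}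
    (Φ : PlaneEmbedding (G.induce X)) :
    ∃ Ψ : PE G X, ∀ F, Φ.IsFace F → Ψ.IsFace F ∧
      ∀ v (hv : v ∈ X), Φ.OnFace F ⟨v, hv⟩ → Ψ.On F v := by
  have hES : ∀ e ∈ ES G X, ∃ e' : (G.induce X).edgeSet, (e' : Sym2 X).map Subtype.val = e := by
    intro e he
    induction e with
    | _ a b =>
      have ha := he.2 a (Sym2.mem_mk_left a b)
      have hb := he.2 b (Sym2.mem_mk_right a b)
      exact ⟨⟨s(⟨a, ha⟩, ⟨b, hb⟩), he.1⟩, rfl⟩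
  have hES' : ∀ e' : (G.induce X).edgeSet, (e' : Sym2 X).map Subtype.val ∈ ES G X := by
    rintro ⟨e, he⟩
    induction e with
    | _ a b =>
      refine ⟨he, ?_⟩
      intro x hx
      rcases Sym2.mem_iff.1 hx with rfl | rfl
      · exact a.2
      · exact b.2
  let vm : V → ℝ × ℝ := fun v => if h : v ∈ X then Φ.vmap ⟨v, h⟩ else 0
  let ar : Sym2 V → Set (ℝ × ℝ) := fun e =>
    ⋃ (e' : (G.induce X).edgeSet) (_ : (e' : Sym2 X).map Subtype.val = e), Φ.arc e'
  have hvm : ∀ x : X, vm x = Φ.vmap x := fun x => dif_pos x.2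
  have har : ∀ e' : (G.induce X).edgeSet, ar ((e' : Sym2 X).map Subtype.val) = Φ.arc e' := by
    intro e'
    apply subset_antisymm
    · refine iUnion₂_subset fun e he => ?_
      have : e = e' := Subtype.ext (Sym2.map.injective Subtype.val_injective he)
      rw [this]
    · exact subset_iUnion₂_of_subset e' rfl subset_rfl
  have hmem : ∀ (x : X) (e : Sym2 X), (x : V) ∈ e.map Subtype.val ↔ x ∈ e := by
    intro x e
    rw [Sym2.mem_map]
    constructor
    · rintro ⟨y, hy, hyx⟩
      rwa [← Subtype.ext hyx]
    · exact fun h => ⟨x, h, rfl⟩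
  let Ψ : PE G X :=
    { vmap := vm
      inj := by
        intro u hu v hv h
        have := hvm ⟨u, hu⟩
        have h2 := hvm ⟨v, hv⟩
        simp only at this h2
        rw [this, h2] at h
        exact congrArg Subtype.val (Φ.vmap_inj h)
      arc := ar
      arc_path := by
        intro e he
        obtain ⟨e', rfl⟩ := hES e he
        obtain ⟨f, hf, hi, hr, u, v, huv, hu, hv⟩ := Φ.arc_path e'
        refine ⟨f, hf, hi, by rw [har, hr], u, v, ?_, ?_, ?_⟩
        · rw [huv]; rfl
        · rw [hu, hvm]
        · rw [hv, hvm]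
      arc_inter := by
        intro e he e₂ he₂ hne
        obtain ⟨e', rfl⟩ := hES e he
        obtain ⟨e₂', rfl⟩ := hES e₂ he₂
        rw [har, har]
        intro x hx
        obtain ⟨v, ⟨h1, h2⟩, rfl⟩ := Φ.arc_inter e' e₂' (fun h => hne (by rw [h])) hx
        exact ⟨v, ⟨(hmem _ _).2 h1, (hmem _ _).2 h2⟩, hvm v⟩
      vmap_mem_arc := by
        intro e he x hx h
        obtain ⟨e', rfl⟩ := hES e he
        rw [har] at h
        have := hvm ⟨x, hx⟩
        simp only at this
        rw [this] at h
        exact (hmem ⟨x, hx⟩ _).2 (Φ.vmap_mem_arc e' _ h) }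
  have hK : Ψ.K = Φ.drawing := by
    apply subset_antisymm
    · refine iUnion₂_subset fun e he => ?_
      obtain ⟨e', rfl⟩ := hES e he
      change ar _ ⊆ _
      rw [har]
      exact subset_iUnion Φ.arc e'
    · refine iUnion_subset fun e' => ?_
      rw [← har]
      exact subset_biUnion_of_mem (u := ar) (hES' e')
  refine ⟨Ψ, fun F hF => ⟨?_, ?_⟩⟩
  · obtain ⟨p, hp, rfl⟩ := hF
    exact ⟨p, by rwa [hK], by rw [hK]⟩
  · intro v hv h
    rw [Φ.onFace_iff_s14 hF] at h
    rw [PE.On, hK]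
    have : Ψ.vmap v = Φ.vmap ⟨v, hv⟩ := hvm ⟨v, hv⟩
    rwa [this]

lemma exists_ofPE {V : Type*} [Finite V] {G : SimpleGraph V} {X : Set V} (hX : X = univ)
    (Ψ : PE G X) : ∃ Φ : PlaneEmbedding G, ∀ F, Ψ.IsFace F → Φ.IsFace F ∧
      ∀ v, Ψ.On F v → Φ.OnFace F v := by
  subst hX
  have hES : ∀ e : G.edgeSet, (e : Sym2 V) ∈ ES G univ := fun e => ⟨e.2, fun _ _ => mem_univ _⟩
  let Φ : PlaneEmbedding G :=
    { vmap := Ψ.vmap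
      vmap_inj := fun u v h => Ψ.inj (mem_univ _) (mem_univ _) h
      arc := fun e => Ψ.arc e
      arc_path := fun e => Ψ.arc_path e (hES e)
      arc_inter := fun e e' hne => Ψ.arc_inter e (hES e) e' (hES e') (fun h => hne (Subtype.ext h))
      vmap_mem_arc := fun e x h => Ψ.vmap_mem_arc e (hES e) x (mem_univ _) h }
  have hK : Φ.drawing = Ψ.K := by
    apply subset_antisymm
    · refine iUnion_subset fun e => ?_
      exact subset_biUnion_of_mem (u := Ψ.arc) (hES e)
    · refine iUnion₂_subset fun e he => ?_
      exact subset_iUnion Φ.arc ⟨e, he.1⟩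
  refine ⟨Φ, fun F hF => ?_⟩
  have hF' : Φ.IsFace F := by
    obtain ⟨p, hp, rfl⟩ := hF
    exact ⟨p, by rwa [hK], by rw [hK]⟩
  refine ⟨hF', fun v hv => ?_⟩
  rw [Φ.onFace_iff_s14 hF', hK]
  exact hv

/-! ### Restricting an embedding to a component -/

lemma restrict_lemma {V : Type*} [Finite V] {G : SimpleGraph V} (X : Set V)
    (hX : ∀ u v, G.Adj u v → u ∈ X → v ∈ X) (Φ : PlaneEmbedding G) :
    ∃ Ψ : PlaneEmbedding (G.induce X),
      (∀ F, Φ.IsFace F → ∃ F', Ψ.IsFace F' ∧ F ⊆ F' ∧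
        ∀ v (hv : v ∈ X), Φ.OnFace F v → Ψ.OnFace F' ⟨v, hv⟩) ∧
      -- every component outside `X` lies inside one face
      (∀ u, u ∉ X → ∃ F', Ψ.IsFace F' ∧ ∀ v, G.Reachable v u → ∀ F, Φ.IsFace F →
        Φ.OnFace F v → F ⊆ F') := by
  have hmem : ∀ (x : X) (e : Sym2 X), (x : V) ∈ e.map Subtype.val ↔ x ∈ e := by
    intro x e
    rw [Sym2.mem_map]
    constructor
    · rintro ⟨y, hy, hyx⟩
      rwa [← Subtype.ext hyx]
    · exact fun h => ⟨x, h, rfl⟩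
  have hES' : ∀ e' : (G.induce X).edgeSet, (e' : Sym2 X).map Subtype.val ∈ G.edgeSet := by
    rintro ⟨e, he⟩
    induction e with
    | _ a b => exact he
  let em : (G.induce X).edgeSet → G.edgeSet := fun e => ⟨_, hES' e⟩
  have hmX : ∀ (e : (G.induce X).edgeSet) (x : V), x ∈ (em e : Sym2 V) → x ∈ X := by
    intro e x hx
    obtain ⟨y, -, rfl⟩ := Sym2.mem_map.1 hx
    exact y.2
  let Ψ : PlaneEmbedding (G.induce X) :=
    { vmap := fun v => Φ.vmap v
      vmap_inj := fun u v h => Subtype.ext (Φ.vmap_inj h)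
      arc := fun e => Φ.arc (em e)
      arc_path := by
        rintro ⟨e, he⟩
        obtain ⟨f, hf, hi, hr, u, v, huv, hu, hv⟩ := Φ.arc_path (em ⟨e, he⟩)
        have huX : u ∈ X := hmX ⟨e, he⟩ u (by rw [huv]; exact Sym2.mem_mk_left u v)
        have hvX : v ∈ X := hmX ⟨e, he⟩ v (by rw [huv]; exact Sym2.mem_mk_right u v)
        refine ⟨f, hf, hi, hr, ⟨u, huX⟩, ⟨v, hvX⟩, ?_, hu, hv⟩
        exact Sym2.map.injective Subtype.val_injective huv
      arc_inter := by
        intro e e' hne x hx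
        have : em e ≠ em e' := by
          intro h
          apply hne
          apply Subtype.ext
          exact Sym2.map.injective Subtype.val_injective (congrArg Subtype.val h)
        obtain ⟨v, ⟨h1, h2⟩, rfl⟩ := Φ.arc_inter _ _ this hx
        have hv := hmX e v h1
        exact ⟨⟨v, hv⟩, ⟨(hmem ⟨v, hv⟩ _).1 h1, (hmem ⟨v, hv⟩ _).1 h2⟩, rfl⟩
      vmap_mem_arc := by
        intro e x h
        exact (hmem x _).1 (Φ.vmap_mem_arc _ _ h) }
  have hsub : Ψ.drawing ⊆ Φ.drawing := iUnion_subset fun e => subset_iUnion Φ.arc (em e)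
  have hcl : IsClosed Ψ.drawing := Ψ.isCompact_drawing.isClosed
  have hface : ∀ F, Φ.IsFace F → ∃ F', Ψ.IsFace F' ∧ F ⊆ F' := by
    rintro F ⟨p, hp, rfl⟩
    have hp' : p ∈ Ψ.drawingᶜ := fun h => hp (hsub h)
    exact ⟨_, ⟨p, hp', rfl⟩, isPreconnected_connectedComponentIn.subset_connectedComponentIn
      (mem_connectedComponentIn hp)
      ((connectedComponentIn_subset _ _).trans (compl_subset_compl.2 hsub))⟩
  have hvd : ∀ v, v ∉ X → Φ.vmap v ∈ Ψ.drawingᶜ := by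
    intro v hv h
    obtain ⟨e, he⟩ := mem_iUnion.1 h
    exact hv (hmX e v (Φ.vmap_mem_arc _ _ he))
  refine ⟨Ψ, ?_, ?_⟩
  · intro F hF
    obtain ⟨F', hF', hFF⟩ := hface F hF
    refine ⟨F', hF', hFF, fun v hv h => ?_⟩
    rw [Ψ.onFace_iff_s14 hF']
    obtain ⟨h1, h2⟩ := (Φ.onFace_iff_s14 hF v).1 h
    refine ⟨?_, closure_mono hFF h2⟩
    obtain ⟨e, he⟩ := mem_iUnion.1 h1
    have hve := Φ.vmap_mem_arc e v he
    obtain ⟨e, heG⟩ := e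
    obtain ⟨w, rfl⟩ := Sym2.mem_iff_exists.1 hve
    have hw : w ∈ X := hX v w heG hv
    exact mem_iUnion.2 ⟨⟨s(⟨v, hv⟩, ⟨w, hw⟩), heG⟩, he⟩
  · intro u hu
    refine ⟨connectedComponentIn Ψ.drawingᶜ (Φ.vmap u), ⟨_, hvd u hu, rfl⟩, ?_⟩
    have hstep : ∀ a b, G.Adj a b → a ∉ X → connectedComponentIn Ψ.drawingᶜ (Φ.vmap a) =
        connectedComponentIn Ψ.drawingᶜ (Φ.vmap b) := by
      intro a b hab ha
      have hb : b ∉ X := fun h => ha (hX b a hab.symm h)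
      let e : G.edgeSet := ⟨s(a, b), hab⟩
      have hdj : Φ.arc e ⊆ Ψ.drawingᶜ := by
        intro x hx h
        obtain ⟨e', he'⟩ := mem_iUnion.1 h
        have hne : e ≠ em e' := by
          intro h
          apply ha
          apply hmX e' a
          rw [← h]
          exact Sym2.mem_mk_left a b
        obtain ⟨v, ⟨h1, h2⟩, rfl⟩ := Φ.arc_inter e (em e') hne ⟨hx, he'⟩
        have h3 := hmX e' v h2
        rcases Sym2.mem_iff.1 h1 with rfl | rfl
        · exact ha h3
        · exact hb h3
      obtain ⟨f, hf, -, hr, c, d, hcd, hc, hd⟩ := Φ.arc_path e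
      have hpre : IsPreconnected (Φ.arc e) := by
        rw [← hr]
        exact isPreconnected_range hf
      have hab' : Φ.vmap a ∈ Φ.arc e ∧ Φ.vmap b ∈ Φ.arc e := by
        have h0 : Φ.vmap c ∈ Φ.arc e := by rw [← hr, ← hc]; exact mem_range_self _
        have h1 : Φ.vmap d ∈ Φ.arc e := by rw [← hr, ← hd]; exact mem_range_self _
        rcases Sym2.eq_iff.1 hcd with ⟨h2, h3⟩ | ⟨h2, h3⟩
        · rw [h2, h3]; exact ⟨h0, h1⟩
        · rw [h2, h3]; exact ⟨h1, h0⟩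
      exact connectedComponentIn_eq (hpre.subset_connectedComponentIn hab'.1 hdj hab'.2)
    have hwalk : ∀ a b, G.Walk a b → b ∉ X → a ∉ X ∧
        connectedComponentIn Ψ.drawingᶜ (Φ.vmap a) =
        connectedComponentIn Ψ.drawingᶜ (Φ.vmap b) := by
      intro a b q hb
      induction q with
      | nil => exact ⟨hb, rfl⟩
      | @cons a c b hac q ih =>
        obtain ⟨h1, h2⟩ := ih hb
        have ha : a ∉ X := fun h => h1 (hX a c hac h)
        exact ⟨ha, (hstep a c hac ha).trans h2⟩
    intro v ⟨q⟩ F hF hv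
    obtain ⟨hvX, heq⟩ := hwalk v u q hu
    obtain ⟨F', hF', hFF⟩ := hface F hF
    obtain ⟨p, hp, rfl⟩ := hF'
    rw [← heq]
    have hcl2 := closure_mono hFF hv.1
    have ho : IsOpen (connectedComponentIn Ψ.drawingᶜ (Φ.vmap v)) :=
      hcl.isOpen_compl.connectedComponentIn
    obtain ⟨y, hy, hy'⟩ := mem_closure_iff.1 hcl2 _ ho (mem_connectedComponentIn (hvd v hvX))
    rw [connectedComponentIn_eq hy, ← connectedComponentIn_eq hy']
    exact hFF

/-! ### Blocks of multigraphs -/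

section Blocks

variable {α E : Type*} {ends : E → Sym2 α}

lemma SubReach.mono {Wb Wb' : Set α} {A A' : Set E} (hW : Wb ⊆ Wb') (hA : A ⊆ A') {x y : α}
    (h : SubReach ends Wb A x y) : SubReach ends Wb' A' x y := by
  induction h with
  | refl => exact Relation.ReflTransGen.refl
  | tail _ hbc ih =>
    obtain ⟨ha, hb, e, he, hab⟩ := hbc
    exact Relation.ReflTransGen.tail ih ⟨hW ha, hW hb, e, hA he, hab⟩

lemma SubReach.symm {Wb : Set α} {A : Set E} {x y : α}
    (h : SubReach ends Wb A x y) : SubReach ends Wb A y x := by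
  induction h with
  | refl => exact Relation.ReflTransGen.refl
  | tail _ hbc ih =>
    obtain ⟨ha, hb, e, he, hab⟩ := hbc
    exact Relation.ReflTransGen.head ⟨hb, ha, e, he, by rw [hab, Sym2.eq_swap]⟩ ih

lemma noCut_all {Wb : Set α} {A : Set E} (hs : MSubgraph ends Wb A)
    (hc : MConnected ends Wb A) (hn : MNoCutVtx ends Wb A) (v x y : α)
    (hx : x ∈ Wb) (hxv : x ≠ v) (hy : y ∈ Wb) (hyv : y ≠ v) :
    SubReach ends (Wb \ {v}) {e ∈ A | v ∉ ends e} x y := by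
  by_cases hv : v ∈ Wb
  · exact hn v hv x ⟨hx, hxv⟩ y ⟨hy, hyv⟩
  · refine (hc.2 x hx y hy).mono ?_ ?_
    · intro z hz
      exact ⟨hz, fun h => hv (h ▸ hz)⟩
    · intro e he
      exact ⟨he, fun h => hv (hs e he v h)⟩

lemma walk_subReach {Γ : SimpleGraph α} (hΓ : ∀ a b, Γ.Adj a b → ∃ e, ends e = s(a, b))
    {Wd : Set α} {Ad : Set E} {x y : α} (q : Γ.Walk x y)
    (h1 : ∀ z ∈ q.support, z ∈ Wd)
    (h2 : ∀ e, (∀ z ∈ ends e, z ∈ q.support) → e ∈ Ad) :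
    SubReach ends Wd Ad x y := by
  induction q with
  | nil => exact Relation.ReflTransGen.refl
  | @cons a c b hac q ih =>
    have hcs : c ∈ q.support := q.start_mem_support
    refine Relation.ReflTransGen.head ⟨h1 a ?_, h1 c ?_, ?_⟩ (ih ?_ ?_)
    · simp
    · simp
    · obtain ⟨e, he⟩ := hΓ a c hac
      refine ⟨e, h2 e ?_, he⟩
      intro z hz
      rw [he, Sym2.mem_iff] at hz
      rcases hz with rfl | rfl
      · simp
      · simp
    · intro z hz
      exact h1 z (by simp [hz])
    · intro e he
      exact h2 e (fun z hz => by simp [he z hz])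

/-- Two blocks with a common vertex `i`, connected outside `i`, coincide. -/
lemma block_eq {Wb Wb' : Set α} {A A' : Set E} (hB : IsBlock ends Wb A)
    (hB' : IsBlock ends Wb' A') {i s s' : α} (hi : i ∈ Wb) (hi' : i ∈ Wb')
    (hs : s ∈ Wb) (hsi : s ≠ i) (hs' : s' ∈ Wb') (hsi' : s' ≠ i)
    (hp : Relation.ReflTransGen (fun x y => x ≠ i ∧ y ≠ i ∧ ∃ e, ends e = s(x, y)) s s') :
    Wb = Wb' ∧ A = A' := by
  classical
  let Γ : SimpleGraph α := SimpleGraph.fromRel (fun x y => x ≠ i ∧ y ≠ i ∧ ∃ e, ends e = s(x, y))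
  have hΓ : ∀ a b, Γ.Adj a b → ∃ e, ends e = s(a, b) := by
    intro a b hab
    rcases (SimpleGraph.fromRel_adj _ _ _).1 hab with ⟨-, ⟨-, -, h⟩ | ⟨-, -, e, h⟩⟩
    · exact h
    · exact ⟨e, by rw [h, Sym2.eq_swap]⟩
  have hΓi : ∀ a b, Γ.Adj a b → a ≠ i := by
    intro a b hab
    rcases (SimpleGraph.fromRel_adj _ _ _).1 hab with ⟨-, ⟨h, -, -⟩ | ⟨-, h, -⟩⟩ <;> exact h
  have hreach : Γ.Reachable s s' := by
    clear hs' hsi'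
    induction hp with
    | refl => exact SimpleGraph.Reachable.refl _
    | @tail b c hb hbc ih =>
      by_cases h : b = c
      · rwa [← h]
      · exact ih.trans (SimpleGraph.Adj.reachable ((SimpleGraph.fromRel_adj _ _ _).2 ⟨h, Or.inl hbc⟩))
  obtain ⟨P, hP⟩ := hreach.exists_isPath
  have hPi : i ∉ P.support := by
    have : ∀ x y (q : Γ.Walk x y), y ≠ i → i ∉ q.support := by
      intro x y q hy
      induction q with
      | nil => simpa using hy.symm
      | cons hac q ih =>
        simp only [SimpleGraph.Walk.support_cons, List.mem_cons, not_or]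
        exact ⟨(hΓi _ _ hac).symm, ih hy⟩
    exact this _ _ P hsi'
  have hsplit : ∀ x (hx : x ∈ P.support) v, v ≠ x →
      v ∉ (P.takeUntil x hx).support ∨ v ∉ (P.dropUntil x hx).support := by
    intro x hx v hv
    by_contra h
    rw [not_or, not_not, not_not] at h
    have hnd := hP.support_nodup
    rw [← P.take_spec hx, SimpleGraph.Walk.support_append] at hnd
    have h2 := h.2
    rw [SimpleGraph.Walk.mem_support_iff] at h2
    exact (List.disjoint_of_nodup_append hnd) h.1 (h2.resolve_left hv)
  obtain ⟨hBs, hBc, hBn, hBm⟩ := hB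
  obtain ⟨hBs', hBc', hBn', hBm'⟩ := hB'
  set W2 : Set α := Wb ∪ Wb' ∪ {x | x ∈ P.support} with hW2
  set A2 : Set E := A ∪ A' ∪ {e | ∀ x ∈ ends e, x ∈ P.support} with hA2
  have hsub2 : MSubgraph ends W2 A2 := by
    rintro e ((he | he) | he) x hx
    · exact Or.inl (Or.inl (hBs e he x hx))
    · exact Or.inl (Or.inr (hBs' e he x hx))
    · exact Or.inr (he x hx)
  have t1 : Wb ⊆ W2 := fun x hx => Or.inl (Or.inl hx)
  have t2 : Wb' ⊆ W2 := fun x hx => Or.inl (Or.inr hx)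
  have t3 : A ⊆ A2 := fun x hx => Or.inl (Or.inl hx)
  have t4 : A' ⊆ A2 := fun x hx => Or.inl (Or.inr hx)
  have hcon2 : MConnected ends W2 A2 := by
    have hub : ∀ x ∈ W2, SubReach ends W2 A2 x i := by
      rintro x ((hx | hx) | hx)
      · exact (hBc.2 x hx i hi).mono t1 t3
      · exact (hBc'.2 x hx i hi').mono t2 t4
      · refine Relation.ReflTransGen.trans ?_ ((hBc.2 s hs i hi).mono t1 t3)
        refine SubReach.symm (walk_subReach hΓ (P.takeUntil x hx) ?_ ?_)
        · exact fun z hz => Or.inr (P.support_takeUntil_subset_support hx hz)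
        · exact fun e he => Or.inr fun z hz => P.support_takeUntil_subset_support hx (he z hz)
    exact ⟨⟨i, t1 hi⟩, fun x hx y hy => (hub x hx).trans (hub y hy).symm⟩
  have hcut2 : MNoCutVtx ends W2 A2 := by
    intro v hv
    have b1 : ∀ x y, x ∈ Wb → x ≠ v → y ∈ Wb → y ≠ v →
        SubReach ends (W2 \ {v}) {e ∈ A2 | v ∉ ends e} x y := fun x y hx hxv hy hyv =>
      (noCut_all hBs hBc hBn v x y hx hxv hy hyv).mono (sdiff_subset_sdiff_left t1)
        (by rintro e ⟨h, h'⟩; exact ⟨t3 h, h'⟩)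
    have b2 : ∀ x y, x ∈ Wb' → x ≠ v → y ∈ Wb' → y ≠ v →
        SubReach ends (W2 \ {v}) {e ∈ A2 | v ∉ ends e} x y := fun x y hx hxv hy hyv =>
      (noCut_all hBs' hBc' hBn' v x y hx hxv hy hyv).mono (sdiff_subset_sdiff_left t2)
        (by rintro e ⟨h, h'⟩; exact ⟨t4 h, h'⟩)
    have b3 : ∀ x y (q : Γ.Walk x y), q.support ⊆ P.support → v ∉ q.support →
        SubReach ends (W2 \ {v}) {e ∈ A2 | v ∉ ends e} x y := by
      intro x y q hq hvq
      refine walk_subReach hΓ q ?_ ?_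
      · intro z hz
        exact ⟨Or.inr (hq hz), fun h => hvq (h ▸ hz)⟩
      · intro e he
        exact ⟨Or.inr fun z hz => hq (he z hz), fun h => hvq (he v h)⟩
    have hub : ∃ c, ∀ x ∈ W2, x ≠ v → SubReach ends (W2 \ {v}) {e ∈ A2 | v ∉ ends e} x c := by
      by_cases hvi : v = i
      · subst hvi
        refine ⟨s, ?_⟩
        rintro x ((hx | hx) | hx) hxv
        · exact b1 x s hx hxv hs hsi
        · exact (b2 x s' hx hxv hs' hsi').trans (b3 _ _ P (fun _ h => h) hPi).symm
        · have hh := P.support_takeUntil_subset_support hx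
          exact (b3 _ _ (P.takeUntil x hx) hh (fun h => hPi (hh h))).symm
      · refine ⟨i, ?_⟩
        rintro x ((hx | hx) | hx) hxv
        · exact b1 x i hx hxv hi (Ne.symm hvi)
        · exact b2 x i hx hxv hi' (Ne.symm hvi)
        · rcases hsplit x hx v (Ne.symm hxv) with h | h
          · have hsv : s ≠ v := fun hh => h (hh ▸ SimpleGraph.Walk.start_mem_support _)
            exact (b3 _ _ (P.takeUntil x hx) (P.support_takeUntil_subset_support hx) h).symm.trans
              (b1 s i hs hsv hi (Ne.symm hvi))
          · have hsv : s' ≠ v := fun hh => h (hh ▸ SimpleGraph.Walk.end_mem_support _)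
            exact (b3 _ _ (P.dropUntil x hx) (P.support_dropUntil_subset_support hx) h).trans
              (b2 s' i hs' hsv hi' (Ne.symm hvi))
    obtain ⟨c, hc⟩ := hub
    exact fun x hx y hy => (hc x hx.1 hx.2).trans (hc y hy.1 hy.2).symm
  obtain ⟨e1, e2⟩ := hBm W2 A2 t1 t3 hsub2 hcon2 hcut2
  obtain ⟨e3, e4⟩ := hBm' W2 A2 t2 t4 hsub2 hcon2 hcut2
  exact ⟨e1.symm.trans e3, e2.symm.trans e4⟩

lemma exists_block [Finite α] [Finite E] {Wb : Set α} {A : Set E} (hs : MSubgraph ends Wb A)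
    (hc : MConnected ends Wb A) (hn : MNoCutVtx ends Wb A) :
    ∃ Wb' A', IsBlock ends Wb' A' ∧ Wb ⊆ Wb' ∧ A ⊆ A' := by
  let T : Set (Set α × Set E) :=
    {p | MSubgraph ends p.1 p.2 ∧ MConnected ends p.1 p.2 ∧ MNoCutVtx ends p.1 p.2}
  obtain ⟨m, hle, hm⟩ := (toFinite T).exists_le_maximal (a := (Wb, A)) ⟨hs, hc, hn⟩
  refine ⟨m.1, m.2, ⟨hm.prop.1, hm.prop.2.1, hm.prop.2.2, ?_⟩, hle.1, hle.2⟩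
  intro W' A' hW hA h1 h2 h3
  have := hm.eq_of_le (y := (W', A')) ⟨h1, h2, h3⟩ ⟨hW, hA⟩
  rw [this]
  exact ⟨rfl, rfl⟩

lemma cycle_noCut {n : ℕ} (hn : 2 ≤ n) (c : ZMod n → α) (hinj : Function.Injective c)
    (A : Set E) (hA1 : ∀ t, ∃ e ∈ A, ends e = s(c t, c (t + 1)))
    (hA2 : ∀ e ∈ A, ∃ t, ends e = s(c t, c (t + 1))) :
    MSubgraph ends (range c) A ∧ MConnected ends (range c) A ∧ MNoCutVtx ends (range c) A := by
  have : NeZero n := ⟨by omega⟩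
  refine ⟨?_, ⟨⟨c 0, mem_range_self _⟩, ?_⟩, ?_⟩
  · intro e he x hx
    obtain ⟨t, ht⟩ := hA2 e he
    rw [ht, Sym2.mem_iff] at hx
    rcases hx with rfl | rfl <;> exact mem_range_self _
  · have hub : ∀ m : ℕ, SubReach ends (range c) A (c 0) (c (m : ZMod n)) := by
      intro m
      induction m with
      | zero => rw [Nat.cast_zero]; exact Relation.ReflTransGen.refl
      | succ m ih =>
        refine Relation.ReflTransGen.tail ih ⟨mem_range_self _, mem_range_self _, ?_⟩
        rw [Nat.cast_succ]
        exact hA1 _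
    have hub' : ∀ t, SubReach ends (range c) A (c 0) (c t) := by
      intro t
      have := hub t.val
      rwa [ZMod.natCast_zmod_val] at this
    rintro _ ⟨s, rfl⟩ _ ⟨t, rfl⟩
    exact (hub' s).symm.trans (hub' t)
  · rintro _ ⟨t₀, rfl⟩
    have hne : ∀ m : ℕ, m + 1 < n → t₀ + 1 + (m : ZMod n) ≠ t₀ := by
      intro m hm h
      have h2 : ((m + 1 : ℕ) : ZMod n) = 0 := by
        push_cast
        linear_combination h
      rw [ZMod.natCast_eq_zero_iff] at h2
      exact absurd (Nat.le_of_dvd (by omega) h2) (by omega)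
    have hub : ∀ m : ℕ, m + 1 < n → SubReach ends (range c \ {c t₀}) {e ∈ A | c t₀ ∉ ends e}
        (c (t₀ + 1)) (c (t₀ + 1 + (m : ZMod n))) := by
      intro m
      induction m with
      | zero => intro _; rw [Nat.cast_zero, add_zero]; exact Relation.ReflTransGen.refl
      | succ m ih =>
        intro hm
        have g1 : c (t₀ + 1 + (m : ZMod n)) ≠ c t₀ := fun h => hne m (by omega) (hinj h)
        have g2 : c (t₀ + 1 + ((m + 1 : ℕ) : ZMod n)) ≠ c t₀ := fun h => hne _ hm (hinj h)
        refine Relation.ReflTransGen.tail (ih (by omega))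
          ⟨⟨mem_range_self _, g1⟩, ⟨mem_range_self _, g2⟩, ?_⟩
        obtain ⟨e, he, hee⟩ := hA1 (t₀ + 1 + (m : ZMod n))
        rw [Nat.cast_succ, ← add_assoc] at g2 ⊢
        refine ⟨e, ⟨he, ?_⟩, hee⟩
        rw [hee, Sym2.mem_iff, not_or]
        exact ⟨g1.symm, g2.symm⟩
    have hub' : ∀ t, t ≠ t₀ → SubReach ends (range c \ {c t₀}) {e ∈ A | c t₀ ∉ ends e}
        (c (t₀ + 1)) (c t) := by
      intro t ht
      have hv : t₀ + 1 + (((t - t₀ - 1).val : ℕ) : ZMod n) = t := by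
        rw [ZMod.natCast_zmod_val]; ring
      have hlt : (t - t₀ - 1).val + 1 < n := by
        have h1 := ZMod.val_lt (t - t₀ - 1)
        refine lt_of_le_of_ne h1 fun h => ht ?_
        have h2 : (((t - t₀ - 1).val + 1 : ℕ) : ZMod n) = 0 := by
          have h' : (t - t₀ - 1).val + 1 = n := h
          rw [h', ZMod.natCast_self]
        rw [Nat.cast_succ, ZMod.natCast_zmod_val] at h2
        linear_combination h2
      have := hub _ hlt
      rwa [hv] at this
    rintro _ ⟨⟨s, rfl⟩, hs⟩ _ ⟨⟨t, rfl⟩, ht⟩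
    exact (hub' s fun h => hs (by rw [h]; rfl)).symm.trans (hub' t fun h => ht (by rw [h]; rfl))

end Blocks

/-! ### Gluing along the blocks -/

lemma PlaneEmbedding.IsFace.nonempty {V : Type*} {G : SimpleGraph V} {Φ : PlaneEmbedding G}
    {F : Set (ℝ × ℝ)} (h : Φ.IsFace F) : F.Nonempty := by
  obtain ⟨p, hp, rfl⟩ := h
  exact ⟨p, mem_connectedComponentIn hp⟩

lemma PlaneEmbedding.IsFace.eq_of_mem {V : Type*} {G : SimpleGraph V} {Φ : PlaneEmbedding G}
    {F F' : Set (ℝ × ℝ)} (h : Φ.IsFace F) (h' : Φ.IsFace F') {x : ℝ × ℝ} (hx : x ∈ F)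
    (hx' : x ∈ F') : F = F' := by
  obtain ⟨p, hp, rfl⟩ := h
  obtain ⟨p', hp', rfl⟩ := h'
  rw [connectedComponentIn_eq hx, connectedComponentIn_eq hx']

lemma exists_crossing {β : Type*} {R : β → β → Prop} {S : Set β} {a b : β}
    (h : Relation.ReflTransGen R a b) (ha : a ∈ S) (hb : b ∉ S) :
    ∃ x ∈ S, ∃ y, y ∉ S ∧ R x y := by
  induction h with
  | refl => exact absurd ha hb
  | @tail c d _ hcd ih =>
    by_cases hc : c ∈ S
    · exact ⟨c, hc, d, hb, hcd⟩
    · exact ih hc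

lemma glue_all {V : Type*} [Finite V] (G : SimpleGraph V) {k : ℕ} (W : Fin k → Set V)
    (hdisj : ∀ i j, ∀ v, v ∈ W i → v ∈ W j → i = j)
    (hadj : ∀ i u v, G.Adj u v → u ∈ W i → v ∈ W i)
    {E : Type*} (ends : E → Sym2 (Fin k))
    (hconn : ∀ a b : Fin k, Relation.ReflTransGen (fun x y => ∃ e, ends e = s(x, y)) a b)
    {p : ℕ} (Bv : Fin p → Set (Fin k)) (Be : Fin p → Set E)
    (hB : ∀ j, IsBlock ends (Bv j) (Be j))
    (hBinj : Function.Injective (fun j => (Bv j, Be j)))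
    (hedge : ∀ e, ∃ j, ∀ x ∈ ends e, x ∈ Bv j)
    (Ψ : ∀ i, PE G (W i)) (f : Fin k → Fin p → Set (ℝ × ℝ))
    (hf : ∀ i j, i ∈ Bv j → (Ψ i).IsFace (f i j)) (i₀ : Fin k) :
    ∃ X : Set V, X = ⋃ i, W i ∧ ∃ Φ : PE G X, ∃ α : Fin k → Set (ℝ × ℝ) → Set (ℝ × ℝ),
      (∀ i A, (Ψ i).IsFace A → Φ.IsFace (α i A) ∧ ∀ v ∈ W i, (Ψ i).On A v → Φ.On (α i A) v) ∧
      ∀ j i i', i ∈ Bv j → i' ∈ Bv j → α i (f i j) = α i' (f i' j) := by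
  classical
  let T : Set (Set (Fin k)) := {S |
    (∀ s ∈ S, ∀ s' ∈ S, Relation.ReflTransGen
      (fun x y => x ∈ S ∧ y ∈ S ∧ ∃ e, ends e = s(x, y)) s s') ∧
    ∃ X : Set V, X = ⋃ i ∈ S, W i ∧ ∃ Φ : PE G X, ∃ α : Fin k → Set (ℝ × ℝ) → Set (ℝ × ℝ),
      (∀ i ∈ S, ∀ A, (Ψ i).IsFace A →
        Φ.IsFace (α i A) ∧ ∀ v ∈ W i, (Ψ i).On A v → Φ.On (α i A) v) ∧
      ∀ j, ∀ i ∈ S, ∀ i' ∈ S, i ∈ Bv j → i' ∈ Bv j → α i (f i j) = α i' (f i' j)}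
  have h0 : {i₀} ∈ T := by
    refine ⟨?_, W i₀, by simp, Ψ i₀, fun _ A => A, ?_, ?_⟩
    · rintro s rfl s' rfl
      exact Relation.ReflTransGen.refl
    · rintro i rfl A hA
      exact ⟨hA, fun v _ h => h⟩
    · rintro j i rfl i' rfl _ _
      rfl
  obtain ⟨S, hle, hmax⟩ := (toFinite T).exists_le_maximal h0
  have hi₀ : i₀ ∈ S := hle rfl
  obtain ⟨hSc, X, hX, Φ, α, hα1, hα2⟩ := hmax.prop
  have hSu : S = univ := by
    by_contra hne
    obtain ⟨b, hb⟩ := (ne_univ_iff_exists_notMem _).1 hne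
    obtain ⟨s₀, hs₀, i', hi', e, he⟩ := exists_crossing (hconn i₀ b) hi₀ hb
    obtain ⟨j₀, hj₀⟩ := hedge e
    have hs₀B : s₀ ∈ Bv j₀ := hj₀ s₀ (by rw [he]; exact Sym2.mem_mk_left _ _)
    have hi'B : i' ∈ Bv j₀ := hj₀ i' (by rw [he]; exact Sym2.mem_mk_right _ _)
    have hXm : ∀ v ∈ X, ∃ i ∈ S, v ∈ W i := by
      intro v hv
      rw [hX] at hv
      simpa using hv
    have hd : Disjoint X (W i') := by
      rw [disjoint_left]
      intro v hv hv'
      obtain ⟨i, hi, hvi⟩ := hXm v hv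
      exact hi' (hdisj i i' v hvi hv' ▸ hi)
    have hno : ∀ u ∈ X, ∀ v ∈ W i', ¬ G.Adj u v := by
      intro u hu v hv huv
      exact disjoint_left.1 hd hu (hadj i' v u huv.symm hv)
    obtain ⟨Θ, α₁, α₂, h1, h2, h3⟩ := merge_lemma hd hno Φ (Ψ i') _ _
      (hα1 s₀ hs₀ _ (hf s₀ j₀ hs₀B)).1 (hf i' j₀ hi'B)
    have hne' : ∀ s ∈ S, s ≠ i' := fun s hs h => hi' (h ▸ hs)
    have hkey : ∀ j, i' ∈ Bv j → ∀ s ∈ S, s ∈ Bv j → α₁ (α s (f s j)) = α₂ (f i' j) := by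
      intro j hj s hs hsj
      have hpath : Relation.ReflTransGen
          (fun x y => x ≠ i' ∧ y ≠ i' ∧ ∃ e, ends e = s(x, y)) s₀ s := by
        have hw := hSc s₀ hs₀ s hs
        clear hs hsj
        induction hw with
        | refl => exact Relation.ReflTransGen.refl
        | tail _ hbc ih =>
          exact ih.tail ⟨hne' _ hbc.1, hne' _ hbc.2.1, hbc.2.2⟩
      obtain ⟨q1, q2⟩ := block_eq (hB j₀) (hB j) hi'B hj hs₀B (hne' _ hs₀) hsj (hne' _ hs) hpath
      have hjj : j₀ = j := hBinj (Prod.ext q1 q2)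
      subst hjj
      rw [← h3, hα2 j₀ s hs s₀ hs₀ hsj hs₀B]
    have hT : insert i' S ∈ T := by
      refine ⟨?_, X ∪ W i', ?_, Θ, fun i A => if i = i' then α₂ A else α₁ (α i A), ?_, ?_⟩
      · have hub : ∀ s ∈ insert i' S, Relation.ReflTransGen
            (fun x y => x ∈ insert i' S ∧ y ∈ insert i' S ∧ ∃ e, ends e = s(x, y)) s₀ s ∧
            Relation.ReflTransGen
            (fun x y => x ∈ insert i' S ∧ y ∈ insert i' S ∧ ∃ e, ends e = s(x, y)) s s₀ := by
          have hmono : ∀ s ∈ S, ∀ s' ∈ S, Relation.ReflTransGen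
              (fun x y => x ∈ insert i' S ∧ y ∈ insert i' S ∧ ∃ e, ends e = s(x, y)) s s' := by
            intro s hs s' hs'
            have hw := hSc s hs s' hs'
            clear hs'
            induction hw with
            | refl => exact Relation.ReflTransGen.refl
            | tail _ hbc ih => exact ih.tail ⟨Or.inr hbc.1, Or.inr hbc.2.1, hbc.2.2⟩
          rintro s (rfl | hs)
          · exact ⟨Relation.ReflTransGen.single ⟨Or.inr hs₀, Or.inl rfl, e, he⟩,
              Relation.ReflTransGen.single ⟨Or.inl rfl, Or.inr hs₀, e, by rw [he, Sym2.eq_swap]⟩⟩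
          · exact ⟨hmono _ hs₀ _ hs, hmono _ hs _ hs₀⟩
        exact fun s hs s' hs' => (hub s hs).2.trans (hub s' hs').1
      · rw [biUnion_insert, hX, union_comm]
      · intro i hi A hA
        by_cases h : i = i'
        · subst h
          simp only [if_true]
          exact h2 A hA
        · simp only [h, if_false]
          have hiS : i ∈ S := hi.resolve_left h
          obtain ⟨g1, g2⟩ := hα1 i hiS A hA
          refine ⟨(h1 _ g1).1, fun v hv hvA => (h1 _ g1).2 v ?_ (g2 v hv hvA)⟩
          rw [hX]
          exact mem_biUnion hiS hv
      · intro j i hi s hs hij hsj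
        by_cases h : i = i' <;> by_cases h' : s = i'
        · rw [h, h']
        · simp only [h, h', if_true, if_false]
          subst h
          exact (hkey j hij s (hs.resolve_left h') hsj).symm
        · simp only [h, h', if_true, if_false]
          subst h'
          exact hkey j hsj i (hi.resolve_left h) hij
        · simp only [h, h', if_false]
          rw [hα2 j i (hi.resolve_left h) s (hs.resolve_left h') hij hsj]
    exact hi' (hmax.le_of_ge hT (subset_insert _ _) (mem_insert _ _))
  subst hSu
  refine ⟨X, by simpa using hX, Φ, α, fun i => hα1 i (mem_univ _), fun j i i' =>
    hα2 j i (mem_univ _) i' (mem_univ _)⟩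

/-- let `G` be a finite simple planar graph with connected components `G_i`
(vertex sets `W i`), and let `M` be a sequence of families of vertex subsets, every set
inducing a connected subgraph.  Let `H` be the edge-labeled multigraph on `Fin k` consisting,
for each global family `h`, of a cycle (given by `cyc h`, injective with range
`{i : some set of M h is G_i-local}` and of length `nh h ≥ 2`) all of whose edges are labeled
`h`; assume `H` is connected and let `(Bv j, Be j)`, `j < p`, be the blocks of `H`.  With
`𝒰_j = ⋃ {M h : h a label on B_j}` and `M_i` the collection of the `G_i`-local families of
`M` together with the families `𝒰_{j,i} = {U ∈ 𝒰_j : U is G_i-local}` for the blocks `B_j`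
with `i ∈ Bv j`: `G` satisfies `M` iff every `G_i` satisfies `M_i`. -/
theorem statement14 {V : Type} [Fintype V] (G : SimpleGraph V)
    (hplanar : Planar G)
    (k : ℕ) (W : Fin k → Set V)
    (hWc : ∀ i : Fin k, ∃ v : V, W i = {u : V | G.Reachable u v})
    (hWcov : ∀ v : V, ∃ i : Fin k, v ∈ W i)
    (hWinj : Function.Injective W)
    (q : ℕ) (M : Fin q → Set (Set V))
    (hMconn : ∀ j : Fin q, ∀ U ∈ M j, (G.induce U).Connected)
    (nh : Fin q → ℕ) (cyc : ∀ h : Fin q, ZMod (nh h) → Fin k)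
    (hcyc1 : ∀ h : Fin q, GGlobal W M h → Function.Injective (cyc h))
    (hcyc2 : ∀ h : Fin q, GGlobal W M h →
      Set.range (cyc h) = {i : Fin k | ∃ U ∈ M h, U ⊆ W i})
    (hcyc3 : ∀ h : Fin q, GGlobal W M h → 2 ≤ nh h)
    (hHconn : ∀ a b : Fin k, Relation.ReflTransGen
      (fun x y : Fin k => ∃ e : HEdge (GGlobal W M) nh,
        hEnds (GGlobal W M) nh cyc e = s(x, y)) a b)
    (p : ℕ) (Bv : Fin p → Set (Fin k)) (Be : Fin p → Set (HEdge (GGlobal W M) nh))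
    (hB : ∀ j : Fin p, IsBlock (hEnds (GGlobal W M) nh cyc) (Bv j) (Be j))
    (hBinj : Function.Injective (fun j => (Bv j, Be j)))
    (hBall : ∀ (Wb : Set (Fin k)) (A : Set (HEdge (GGlobal W M) nh)),
      IsBlock (hEnds (GGlobal W M) nh cyc) Wb A → ∃ j : Fin p, Bv j = Wb ∧ Be j = A) :
    SatSeq G M ↔
      ∀ i : Fin k,
        SatColl (G.induce (W i))
          (resFam (W i) ''
            {Cf : Set (Set V) |
              (∃ h0 : Fin q, Cf = M h0 ∧ ∀ U ∈ M h0, U ⊆ W i) ∨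
              (∃ j : Fin p, i ∈ Bv j ∧
                Cf = {U ∈ {U : Set V | ∃ h0 : Fin q, (∃ e ∈ Be j, e.1.1 = h0) ∧ U ∈ M h0} |
                  U ⊆ W i})}) := by
  classical
  have hadj : ∀ i u v, G.Adj u v → u ∈ W i → v ∈ W i := by
    intro i u v huv hu
    obtain ⟨w, hw⟩ := hWc i
    rw [hw] at hu ⊢
    exact huv.symm.reachable.trans hu
  have hreachW : ∀ i u v, G.Reachable u v → u ∈ W i → v ∈ W i := by
    intro i u v huv hu
    obtain ⟨w, hw⟩ := hWc i
    rw [hw] at hu ⊢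
    exact huv.symm.trans hu
  have hWreach : ∀ i u v, u ∈ W i → v ∈ W i → G.Reachable u v := by
    intro i u v hu hv
    obtain ⟨w, hw⟩ := hWc i
    rw [hw] at hu hv
    exact SimpleGraph.Reachable.trans hu (SimpleGraph.Reachable.symm hv)
  have hdisj : ∀ i j, ∀ v, v ∈ W i → v ∈ W j → i = j := by
    intro i j v hi hj
    apply hWinj
    ext u
    exact ⟨fun h => hreachW j v u (hWreach i v u hi h) hj,
      fun h => hreachW i v u (hWreach j v u hj h) hi⟩
  have hUne : ∀ h, ∀ U ∈ M h, U.Nonempty := by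
    intro h U hU
    obtain ⟨x⟩ := (hMconn h U hU).nonempty
    exact ⟨x, x.2⟩
  have hUW : ∀ h, ∀ U ∈ M h, ∀ i, ∀ x ∈ U, x ∈ W i → U ⊆ W i := by
    intro h U hU i x hx hxi y hy
    have := (hMconn h U hU).preconnected ⟨x, hx⟩ ⟨y, hy⟩
    exact hreachW i x y (this.map (SimpleGraph.Embedding.induce U).toHom) hxi
  have hends : ∀ (e : HEdge (GGlobal W M) nh) (x : Fin k), x ∈ hEnds (GGlobal W M) nh cyc e →
      ∃ U ∈ M e.1.1, U ⊆ W x := by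
    intro e x hx
    have : x ∈ range (cyc e.1.1) := by
      rcases Sym2.mem_iff.1 hx with rfl | rfl <;> exact mem_range_self _
    rw [hcyc2 e.1.1 e.1.2] at this
    exact this
  constructor
  · rintro ⟨Φ, hΦ⟩ i
    obtain ⟨Ψ, hΨ1, hΨ2⟩ := restrict_lemma (W i) (hadj i) Φ
    refine ⟨Ψ, ?_⟩
    choose F hF hFU using hΦ
    rintro _ ⟨Cf, hCf, rfl⟩
    rcases hCf with ⟨h0, rfl, hloc⟩ | ⟨j, hij, rfl⟩
    · obtain ⟨F', hF', -, hon⟩ := hΨ1 (F h0) (hF h0)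
      refine ⟨F', hF', ?_⟩
      rintro _ ⟨U, hU, rfl⟩
      obtain ⟨v, hvU, hv⟩ := hFU h0 U hU
      exact ⟨⟨v, hloc U hU hvU⟩, hvU, hon v (hloc U hU hvU) hv⟩
    · by_cases hex : ∃ e, e ∈ Be j
      swap
      · obtain ⟨F', hF'⟩ := Ψ.exists_isFace
        refine ⟨F', hF', ?_⟩
        rintro _ ⟨U, ⟨⟨h0, ⟨e, he, -⟩, -⟩, -⟩, rfl⟩
        exact (hex ⟨e, he⟩).elim
      have hg : ∀ x, x ≠ i → ∃ F', Ψ.IsFace F' ∧ ∀ v ∈ W x, ∀ F, Φ.IsFace F →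
          Φ.OnFace F v → F ⊆ F' := by
        intro x hx
        obtain ⟨w, hw⟩ := hWc x
        have hwx : w ∈ W x := by rw [hw]; exact SimpleGraph.Reachable.refl w
        obtain ⟨F', hF', h⟩ := hΨ2 w (fun hwi => hx (hdisj x i w hwx hwi))
        exact ⟨F', hF', fun v hv => h v (hWreach x v w hv hwx)⟩
      choose! g hg1 hg2 using hg
      have hFg : ∀ (e : HEdge (GGlobal W M) nh) (x : Fin k),
          x ∈ hEnds (GGlobal W M) nh cyc e → x ≠ i → F e.1.1 ⊆ g x := by
        intro e x hx hxi
        obtain ⟨U, hU, hUx⟩ := hends e x hx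
        obtain ⟨v, hv, hvF⟩ := hFU _ U hU
        exact hg2 x hxi v (hUx hv) _ (hF _) hvF
      have hFne : ∀ h, (F h).Nonempty := fun h => (hF h).nonempty
      have hgg : ∀ x ∈ Bv j, x ≠ i → ∀ y ∈ Bv j, y ≠ i → g x = g y := by
        intro x hx hxi y hy hyi
        have hr := (hB j).2.2.1 i hij x ⟨hx, hxi⟩ y ⟨hy, hyi⟩
        clear hy hyi
        induction hr with
        | refl => rfl
        | @tail b c _ hbc ih =>
          obtain ⟨hb, hc, e, he, hec⟩ := hbc
          rw [ih]
          have h1 := hFg e b (by rw [hec]; exact Sym2.mem_mk_left b c) hb.2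
          have h2 := hFg e c (by rw [hec]; exact Sym2.mem_mk_right b c) hc.2
          obtain ⟨y, hy⟩ := hFne e.1.1
          exact PlaneEmbedding.IsFace.eq_of_mem (hg1 b hb.2) (hg1 c hc.2) (h1 hy) (h2 hy)
      have hend : ∀ e : HEdge (GGlobal W M) nh, ∃ x, x ∈ hEnds (GGlobal W M) nh cyc e ∧ x ≠ i := by
        intro e
        have hne : cyc e.1.1 e.2 ≠ cyc e.1.1 (e.2 + 1) := by
          intro h
          have h1 := hcyc1 e.1.1 e.1.2 h
          have h2 := hcyc3 e.1.1 e.1.2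
          have : Fact (1 < nh e.1.1) := ⟨h2⟩
          have h3 : (1 : ZMod (nh e.1.1)) = 0 := by linear_combination -h1
          exact one_ne_zero h3
        by_cases h : cyc e.1.1 e.2 = i
        · exact ⟨_, Sym2.mem_mk_right _ _, fun h' => hne (h.trans h'.symm)⟩
        · exact ⟨_, Sym2.mem_mk_left _ _, h⟩
      obtain ⟨e0, he0⟩ := hex
      obtain ⟨x0, hx0, hx0i⟩ := hend e0
      have hx0B := (hB j).1 e0 he0 x0 hx0
      refine ⟨g x0, hg1 x0 hx0i, ?_⟩
      rintro _ ⟨U, ⟨⟨h0, ⟨e, he, rfl⟩, hU⟩, hUi⟩, rfl⟩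
      obtain ⟨v, hv, hvF⟩ := hFU _ U hU
      obtain ⟨x, hx, hxi⟩ := hend e
      have hFx := hFg e x hx hxi
      rw [hgg x ((hB j).1 e he x hx) hxi x0 hx0B hx0i] at hFx
      obtain ⟨F', hF', hFF', hon⟩ := hΨ1 (F e.1.1) (hF _)
      obtain ⟨y, hy⟩ := hFne e.1.1
      have : F' = g x0 := PlaneEmbedding.IsFace.eq_of_mem hF' (hg1 x0 hx0i) (hFF' hy) (hFx hy)
      refine ⟨⟨v, hUi hv⟩, hv, ?_⟩
      rw [← this]
      exact hon v (hUi hv) hvF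
  · intro hall
    rcases Nat.eq_zero_or_pos k with hk | hk
    · subst hk
      obtain ⟨Φ⟩ := hplanar
      exact ⟨Φ, fun h => (cyc h 0).elim0⟩
    choose Φ hΦ using hall
    have hPE := fun i => exists_toPE (Φ i)
    choose Ψ hΨ using hPE
    have hf : ∀ i j, i ∈ Bv j → ∃ F, (Ψ i).IsFace F ∧ ∀ e ∈ Be j, ∀ U ∈ M e.1.1, U ⊆ W i →
        ∃ v ∈ U, (Ψ i).On F v := by
      intro i j hij
      obtain ⟨F, hF, hFU⟩ := hΦ i _ (mem_image_of_mem _ (Or.inr ⟨j, hij, rfl⟩))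
      refine ⟨F, (hΨ i F hF).1, ?_⟩
      intro e he U hU hUi
      obtain ⟨v, hv, hvF⟩ := hFU _ (mem_image_of_mem _ ⟨⟨e.1.1, ⟨e, he, rfl⟩, hU⟩, hUi⟩)
      exact ⟨v, hv, (hΨ i F hF).2 v v.2 hvF⟩
    choose! f hf1 hf2 using hf
    have hfinE : Finite (HEdge (GGlobal W M) nh) := by
      have : ∀ h : {h : Fin q // GGlobal W M h}, Finite (ZMod (nh h.1)) := by
        intro h
        have : NeZero (nh h.1) := ⟨by have := hcyc3 h.1 h.2; omega⟩
        infer_instance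
      unfold HEdge
      infer_instance
    have hblk : ∀ h, GGlobal W M h → ∃ j, range (cyc h) ⊆ Bv j ∧
        ∀ e : HEdge (GGlobal W M) nh, e.1.1 = h → e ∈ Be j := by
      intro h hg
      obtain ⟨h1, h2, h3⟩ := cycle_noCut (ends := hEnds (GGlobal W M) nh cyc) (hcyc3 h hg) (cyc h)
        (hcyc1 h hg) {e | e.1.1 = h} (fun t => ⟨⟨⟨h, hg⟩, t⟩, rfl, rfl⟩)
        (by rintro ⟨⟨h', hg'⟩, t⟩ (rfl : h' = h); exact ⟨t, rfl⟩)
      obtain ⟨W', A', hbl, hW', hA'⟩ := exists_block h1 h2 h3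
      obtain ⟨j, rfl, rfl⟩ := hBall W' A' hbl
      exact ⟨j, hW', fun e he => hA' he⟩
    obtain ⟨X, hX, Θ, α, hα1, hα2⟩ := glue_all G W hdisj hadj _ hHconn Bv Be hB hBinj
      (by
        intro e
        obtain ⟨j, hj1, hj2⟩ := hblk e.1.1 e.1.2
        exact ⟨j, fun x hx => (hB j).1 e (hj2 e rfl) x hx⟩) Ψ f hf1 ⟨0, hk⟩
    have hXu : X = univ := by
      rw [hX, eq_univ_iff_forall]
      intro v
      exact mem_iUnion.2 (hWcov v)
    obtain ⟨Ξ, hΞ⟩ := exists_ofPE hXu Θ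
    refine ⟨Ξ, fun h => ?_⟩
    by_cases hg : GGlobal W M h
    · obtain ⟨j, hj1, hj2⟩ := hblk h hg
      have hi0 : cyc h 0 ∈ Bv j := hj1 (mem_range_self _)
      have hfc := hΞ _ (hα1 (cyc h 0) _ (hf1 _ j hi0)).1
      refine ⟨_, hfc.1, ?_⟩
      intro U hU
      obtain ⟨x, hx⟩ := hUne h U hU
      obtain ⟨i, hi⟩ := hWcov x
      have hUi := hUW h U hU i x hx hi
      have hir : i ∈ range (cyc h) := by
        rw [hcyc2 h hg]
        exact ⟨U, hU, hUi⟩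
      have hij := hj1 hir
      obtain ⟨v, hv, hvF⟩ := hf2 i j hij ⟨⟨h, hg⟩, 0⟩ (hj2 _ rfl) U hU hUi
      refine ⟨v, hv, hfc.2 v ?_⟩
      rw [hα2 j _ i hi0 hij]
      exact (hα1 i _ (hf1 i j hij)).2 v (hUi hv) hvF
    · have hloc : ∃ i, ∀ U ∈ M h, U ⊆ W i := by
        simpa [GGlobal] using hg
      obtain ⟨i, hloc⟩ := hloc
      obtain ⟨F, hF, hFU⟩ := hΦ i _ (mem_image_of_mem _ (Or.inl ⟨h, rfl, hloc⟩))
      have hF' := hΨ i F hF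
      have hfc := hΞ _ (hα1 i F hF'.1).1
      refine ⟨_, hfc.1, ?_⟩
      intro U hU
      obtain ⟨v, hv, hvF⟩ := hFU _ (mem_image_of_mem _ hU)
      exact ⟨v, hv, hfc.2 v ((hα1 i F hF'.1).2 v v.2 (hF'.2 v v.2 hvF))⟩
end
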